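/- arXiv:2109.12518 — 5 statements merged into one kernel-verified Lean document; each statement's English description precedes it below -/
import Mathlib

section
/- Let G be a finite group with a unitary representation U on ℂ^d and twirling operation 𝒢. For a density matrix ρ on ℂ^d, define the asymmetry of assistance A_G(ρ) as the supremum, over all finite pure-state decompositions ρ = Σ_x p_x |ψ_x⟩⟨ψ_x| (where p is a probability vector and each ψ_x is a unit vector in ℂ^d), of Σ_x p_x H(𝒢(|ψ_x⟩⟨ψ_x|)). For n ≥ 1, let ρ^{⊗n} be the n-fold Kronecker power of ρ (the matrix indexed by functions f, h : Fin n → Fin d with entries ρ^{⊗n}(f,h) = Π_{i} ρ(f i, h i)); the product group G^n = (Fin n → G) acts on it by the tensor-power representation g⃗ ↦ U_{g_1} ⊗ ⋯ ⊗ U_{g_n}, with associated twirling 𝒢_n and asymmetry of assistance A_{G^n}. Define the regularized asymmetry of assistance A_G^∞(ρ) = limsup_{n→∞} (1/n) A_{G^n}(ρ^{⊗n}). Then A_G(ρ) ≤ A_G^∞(ρ) ≤ H(𝒢(ρ)). -/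
open scoped BigOperators Kronecker ComplexOrder
open Matrix

/-- von Neumann entropy of a matrix (via eigenvalues when Hermitian, else 0). -/
noncomputable def vnEntropy {ι : Type*} [Fintype ι] [DecidableEq ι]
    (ρ : Matrix ι ι ℂ) : ℝ :=
  if h : ρ.IsHermitian then -∑ i, h.eigenvalues i * Real.log (h.eigenvalues i) else 0

/-- Twirling operation induced by a family of matrices indexed by a finite group. -/
noncomputable def twirl {G ι : Type*} [Fintype G] [Fintype ι]
    (U : G → Matrix ι ι ℂ) (X : Matrix ι ι ℂ) : Matrix ι ι ℂ :=
  (Fintype.card G : ℂ)⁻¹ • ∑ g, U g * X * (U g)ᴴ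

/-- Apply a real function spectrally to a Hermitian matrix (0 otherwise). -/
noncomputable def matFun {ι : Type*} [Fintype ι] [DecidableEq ι]
    (f : ℝ → ℝ) (ρ : Matrix ι ι ℂ) : Matrix ι ι ℂ :=
  if h : ρ.IsHermitian then
    (h.eigenvectorUnitary : Matrix ι ι ℂ) *
      Matrix.diagonal (fun i => (f (h.eigenvalues i) : ℂ)) *
      (star (h.eigenvectorUnitary : Matrix ι ι ℂ))
  else 0

/-- Spectral power `ρ ^ t` with the convention `0 ^ t = 0`. -/
noncomputable def matPow {ι : Type*} [Fintype ι] [DecidableEq ι]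
    (ρ : Matrix ι ι ℂ) (t : ℝ) : Matrix ι ι ℂ :=
  matFun (fun x => if x = 0 then 0 else x ^ t) ρ

/-- Spectral logarithm with the convention `log 0 = 0`. -/
noncomputable def matLog {ι : Type*} [Fintype ι] [DecidableEq ι]
    (ρ : Matrix ι ι ℂ) : Matrix ι ι ℂ :=
  matFun Real.log ρ

/-- Absolute value `|M| = √(MᴴM)`. -/
noncomputable def matAbs {ι : Type*} [Fintype ι] [DecidableEq ι]
    (M : Matrix ι ι ℂ) : Matrix ι ι ℂ :=
  matPow (Mᴴ * M) (1/2 : ℝ)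


/-- Asymmetry of assistance: supremum over finite pure-state decompositions of the
average entropy of the twirled pure components. -/
noncomputable def asymAssist {G ι : Type*} [Fintype G] [Fintype ι] [DecidableEq ι]
    (U : G → Matrix ι ι ℂ) (ρ : Matrix ι ι ℂ) : ℝ :=
  sSup { r : ℝ | ∃ (n : ℕ) (p : Fin n → ℝ) (ψ : Fin n → ι → ℂ),
    (∀ x, 0 ≤ p x) ∧ (∑ x, p x = 1) ∧
    (∀ x, ∑ i, Complex.normSq (ψ x i) = 1) ∧
    ρ = ∑ x, (p x : ℂ) • Matrix.vecMulVec (ψ x) (star (ψ x)) ∧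
    r = ∑ x, p x * vnEntropy (twirl U (Matrix.vecMulVec (ψ x) (star (ψ x)))) }

/-- `n`-fold Kronecker power of a matrix, indexed by functions `Fin n → Fin d`. -/
noncomputable def kronPow {d : ℕ} (ρ : Matrix (Fin d) (Fin d) ℂ) (n : ℕ) :
    Matrix (Fin n → Fin d) (Fin n → Fin d) ℂ :=
  fun f h => ∏ i, ρ (f i) (h i)

/-- Tensor-power representation of the product group `Fin n → G`. -/
noncomputable def repPow {G : Type*} {d : ℕ} (U : G → Matrix (Fin d) (Fin d) ℂ) (n : ℕ) :
    (Fin n → G) → Matrix (Fin n → Fin d) (Fin n → Fin d) ℂ :=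
  fun g => fun f h => ∏ i, U (g i) (f i) (h i)


namespace AsymAux

/-- Tensor product of a family of matrices. -/
noncomputable def kron {n d : ℕ} (A : Fin n → Matrix (Fin d) (Fin d) ℂ) :
    Matrix (Fin n → Fin d) (Fin n → Fin d) ℂ :=
  fun f h => ∏ i, A i (f i) (h i)

lemma kron_mul {n d : ℕ} (A B : Fin n → Matrix (Fin d) (Fin d) ℂ) :
    kron A * kron B = kron (fun i => A i * B i) := by
  ext f h
  simp only [kron, Matrix.mul_apply]
  rw [Finset.prod_univ_sum]
  simp [Finset.prod_mul_distrib]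

lemma kron_conjTranspose {n d : ℕ} (A : Fin n → Matrix (Fin d) (Fin d) ℂ) :
    (kron A)ᴴ = kron (fun i => (A i)ᴴ) := by
  ext f h
  simp [kron, Matrix.conjTranspose_apply]

lemma kron_diagonal {n d : ℕ} (v : Fin n → Fin d → ℂ) :
    kron (fun i => Matrix.diagonal (v i)) = Matrix.diagonal (fun f => ∏ i, v i (f i)) := by
  ext f h
  by_cases e : f = h
  · subst e; simp [kron]
  · rw [Matrix.diagonal_apply_ne _ e]
    obtain ⟨i, hi⟩ := Function.ne_iff.mp e
    exact Finset.prod_eq_zero (Finset.mem_univ i) (Matrix.diagonal_apply_ne _ hi)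

lemma kron_one {n d : ℕ} : kron (fun _ : Fin n => (1 : Matrix (Fin d) (Fin d) ℂ)) = 1 := by
  have := kron_diagonal (fun (_ : Fin n) (_ : Fin d) => (1 : ℂ))
  simpa using this

/-- Marginalisation of a product distribution. -/
lemma sum_prod_mul {n : ℕ} {α : Type*} [Fintype α] (w : Fin n → α → ℝ)
    (hw : ∀ j, ∑ a, w j a = 1) (i : Fin n) (g : α → ℝ) :
    ∑ x : Fin n → α, (∏ j, w j (x j)) * g (x i) = ∑ a, w i a * g a := by
  classical
  have h1 : ∀ x : Fin n → α, (∏ j, w j (x j)) * g (x i)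
      = ∏ j, (w j (x j) * if j = i then g (x j) else 1) := by
    intro x
    rw [Finset.prod_mul_distrib, Finset.prod_ite_eq' ]
    simp
  simp_rw [h1]
  have h2 := Finset.prod_univ_sum (fun _ : Fin n => (Finset.univ : Finset α))
    (fun j a => w j a * if j = i then g a else 1)
  rw [Fintype.piFinset_univ] at h2
  rw [← h2, ← Finset.mul_prod_erase _ _ (Finset.mem_univ i)]
  rw [Finset.prod_eq_one, mul_one]
  · simp
  · intro j hj
    simp [Finset.ne_of_mem_erase hj, hw]

lemma entropy_eq {ι : Type*} [Fintype ι] [DecidableEq ι] {ρ : Matrix ι ι ℂ} (h : ρ.IsHermitian) :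
    vnEntropy ρ = ∑ i, Real.negMulLog (h.eigenvalues i) := by
  simp [vnEntropy, h, Real.negMulLog]

lemma entropy_of_diag {ι : Type*} [Fintype ι] [DecidableEq ι] {ρ V : Matrix ι ι ℂ}
    (h : ρ.IsHermitian) (μ : ι → ℝ) (hV : Vᴴ * V = 1)
    (e : ρ = V * Matrix.diagonal (fun i => (μ i : ℂ)) * Vᴴ) :
    vnEntropy ρ = ∑ i, Real.negMulLog (μ i) := by
  rw [entropy_eq h]
  have hc : ρ.charpoly = (Matrix.diagonal (fun i => (μ i : ℂ))).charpoly := by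
    rw [e, Matrix.charpoly_mul_comm, ← mul_assoc, hV, one_mul]
  have hr := h.roots_charpoly_eq_eigenvalues
  have h0 : (∏ i, (Polynomial.X - Polynomial.C ((μ i : ℝ) : ℂ))).roots
      = Multiset.map (fun i => ((μ i : ℝ) : ℂ)) Finset.univ.val := by
    have := Polynomial.roots_multiset_prod_X_sub_C
      (Multiset.map (fun i => ((μ i : ℝ) : ℂ)) Finset.univ.val)
    rw [Multiset.map_map] at this
    exact this
  rw [hc, Matrix.charpoly_diagonal, h0] at hr
  have h3 := congrArg (fun s => (Multiset.map (fun z : ℂ => Real.negMulLog z.re) s).sum) hr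
  simp only [Multiset.map_map] at h3
  exact h3.symm

lemma spectral {ι : Type*} [Fintype ι] [DecidableEq ι] {ρ : Matrix ι ι ℂ} (h : ρ.IsHermitian) :
    ∃ V : Matrix ι ι ℂ, Vᴴ * V = 1 ∧ V * Vᴴ = 1 ∧
      ρ = V * Matrix.diagonal (fun i => (h.eigenvalues i : ℂ)) * Vᴴ := by
  refine ⟨h.eigenvectorUnitary, ?_, ?_, ?_⟩
  · exact Unitary.coe_star_mul_self h.eigenvectorUnitary
  · exact Unitary.coe_mul_star_self h.eigenvectorUnitary
  · exact h.spectral_theorem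

lemma diag_entry {ι : Type*} [Fintype ι] [DecidableEq ι] (W : Matrix ι ι ℂ) (μ : ι → ℝ) (j : ι) :
    ((W * Matrix.diagonal (fun i => (μ i : ℂ)) * Wᴴ) j j).re
      = ∑ i, Complex.normSq (W j i) * μ i := by
  rw [Matrix.mul_apply]
  simp only [Matrix.mul_diagonal, Matrix.conjTranspose_apply, Complex.re_sum]
  refine Finset.sum_congr rfl fun i _ => ?_
  simp [Complex.normSq_apply]
  ring

lemma normSq_row {ι : Type*} [Fintype ι] [DecidableEq ι] {W : Matrix ι ι ℂ} (h : W * Wᴴ = 1)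
    (j : ι) : ∑ i, Complex.normSq (W j i) = 1 := by
  have := diag_entry W (fun _ => 1) j
  simp [h] at this
  exact this.symm

/-- Peierls inequality. -/
lemma peierls {ι : Type*} [Fintype ι] [DecidableEq ι] {ρ : Matrix ι ι ℂ} (h : ρ.PosSemidef)
    {V : Matrix ι ι ℂ} (hV : Vᴴ * V = 1) (hV' : V * Vᴴ = 1) :
    vnEntropy ρ ≤ ∑ j, Real.negMulLog ((Vᴴ * ρ * V) j j).re := by
  obtain ⟨T, hT, hT', e⟩ := spectral h.1
  rw [entropy_eq h.1]
  set μ := h.1.eigenvalues with hμ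
  have hμ0 : ∀ i, 0 ≤ μ i := h.eigenvalues_nonneg
  set W := Vᴴ * T with hW
  have hWH : Wᴴ = Tᴴ * V := by simp [hW]
  have e' : Vᴴ * ρ * V = W * Matrix.diagonal (fun i => (μ i : ℂ)) * Wᴴ := by
    rw [hWH, hW, e]; simp only [mul_assoc]
  have h1 : W * Wᴴ = 1 := by
    rw [hWH, hW, mul_assoc, ← mul_assoc T, hT', one_mul, hV]
  have h2 : Wᴴ * Wᴴᴴ = 1 := by
    rw [Matrix.conjTranspose_conjTranspose, hWH, hW, mul_assoc, ← mul_assoc V, hV', one_mul, hT]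
  have hcol : ∀ i, ∑ j, Complex.normSq (W j i) = 1 := by
    intro i
    have := normSq_row h2 i
    simpa [Matrix.conjTranspose_apply] using this
  have hrow := normSq_row h1
  rw [e']
  calc ∑ i, Real.negMulLog (μ i)
      = ∑ i, ∑ j, Complex.normSq (W j i) * Real.negMulLog (μ i) := by
        refine Finset.sum_congr rfl fun i _ => ?_
        rw [← Finset.sum_mul, hcol, one_mul]
    _ = ∑ j, ∑ i, Complex.normSq (W j i) * Real.negMulLog (μ i) := Finset.sum_comm
    _ ≤ _ := by
        refine Finset.sum_le_sum fun j _ => ?_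
        rw [diag_entry]
        have := Real.concaveOn_negMulLog.le_map_sum (t := Finset.univ)
          (w := fun i => Complex.normSq (W j i)) (p := μ)
          (fun i _ => Complex.normSq_nonneg _) (hrow j) (fun i _ => hμ0 i)
        simpa using this

lemma psd_sum {ι κ : Type*} [Fintype ι] [Fintype κ] (A : κ → Matrix ι ι ℂ)
    (h : ∀ x, (A x).PosSemidef) : (∑ x, A x).PosSemidef :=
  Matrix.posSemidef_sum _ fun x _ => h x

lemma psd_smul {ι : Type*} [Fintype ι] {A : Matrix ι ι ℂ} (h : A.PosSemidef) {c : ℝ}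
    (hc : 0 ≤ c) : ((c : ℂ) • A).PosSemidef :=
  h.smul (by exact_mod_cast hc)

/-- Concavity of the entropy. -/
lemma concave {ι κ : Type*} [Fintype ι] [DecidableEq ι] [Fintype κ] (p : κ → ℝ)
    (hp : ∀ x, 0 ≤ p x) (hs : ∑ x, p x = 1) (A : κ → Matrix ι ι ℂ)
    (h : ∀ x, (A x).PosSemidef) :
    ∑ x, p x * vnEntropy (A x) ≤ vnEntropy (∑ x, (p x : ℂ) • A x) := by
  have hσ : (∑ x, (p x : ℂ) • A x).PosSemidef := psd_sum _ fun x => psd_smul (h x) (hp x)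
  obtain ⟨V, hV, hV', e⟩ := spectral hσ.1
  rw [entropy_eq hσ.1]
  have hl : ∀ j, hσ.1.eigenvalues j = ∑ x, p x * ((Vᴴ * A x * V) j j).re := by
    intro j
    have h1 : Vᴴ * (∑ x, (p x : ℂ) • A x) * V
        = Matrix.diagonal (fun i => (hσ.1.eigenvalues i : ℂ)) := by
      conv_lhs => rw [e]
      rw [mul_assoc, mul_assoc, mul_assoc, hV, ← mul_assoc, hV, one_mul, mul_one]
    have h2 := congrArg (fun M : Matrix ι ι ℂ => (M j j).re) h1
    simp only [Matrix.diagonal_apply_eq, Complex.ofReal_re] at h2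
    rw [← h2, Finset.mul_sum, Finset.sum_mul, Matrix.sum_apply, Complex.re_sum]
    refine Finset.sum_congr rfl fun x _ => ?_
    simp
  have hn : ∀ x j, 0 ≤ ((Vᴴ * A x * V) j j).re := by
    intro x j
    have := ((h x).conjTranspose_mul_mul_same V).diag_nonneg (i := j)
    exact (Complex.le_def.mp this).1
  calc ∑ x, p x * vnEntropy (A x)
      ≤ ∑ x, p x * ∑ j, Real.negMulLog ((Vᴴ * A x * V) j j).re :=
        Finset.sum_le_sum fun x _ => mul_le_mul_of_nonneg_left (peierls (h x) hV hV') (hp x)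
    _ = ∑ j, ∑ x, p x * Real.negMulLog ((Vᴴ * A x * V) j j).re := by
        simp_rw [Finset.mul_sum]; exact Finset.sum_comm
    _ ≤ _ := by
        refine Finset.sum_le_sum fun j _ => ?_
        rw [hl j]
        have := Real.concaveOn_negMulLog.le_map_sum (t := Finset.univ)
          (w := p) (p := fun x => ((Vᴴ * A x * V) j j).re)
          (fun i _ => hp i) hs (fun x _ => hn x j)
        simpa using this

lemma entropy_nonneg {ι : Type*} [Fintype ι] [DecidableEq ι] {ρ : Matrix ι ι ℂ}
    (h : ρ.PosSemidef) (ht : ρ.trace = 1) : 0 ≤ vnEntropy ρ := by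
  rw [entropy_eq h.1]
  have hs : ∑ i, h.1.eigenvalues i = 1 := by
    have := h.1.trace_eq_sum_eigenvalues
    rw [ht] at this
    have h2 := congrArg Complex.re this
    simpa using h2.symm
  refine Finset.sum_nonneg fun i _ => Real.negMulLog_nonneg (h.eigenvalues_nonneg i) ?_
  rw [← hs]
  exact Finset.single_le_sum (fun j _ => h.eigenvalues_nonneg j) (Finset.mem_univ i)

lemma negMulLog_prod {n : ℕ} (v : Fin n → ℝ) :
    Real.negMulLog (∏ i, v i) = ∑ i, (∏ j, v j) * (-Real.log (v i)) := by
  by_cases h : ∃ i, v i = 0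
  · obtain ⟨i, hi⟩ := h
    rw [Finset.prod_eq_zero (Finset.mem_univ i) hi]; simp
  · push Not at h
    rw [Real.negMulLog, Real.log_prod (fun i _ => h i), ← Finset.mul_sum]
    simp

/-- Additivity of the entropy. -/
lemma entropy_kron {n d : ℕ} (A : Fin n → Matrix (Fin d) (Fin d) ℂ) (h : ∀ i, (A i).PosSemidef)
    (ht : ∀ i, (A i).trace = 1) : vnEntropy (kron A) = ∑ i, vnEntropy (A i) := by
  choose V hV hV' e using fun i => spectral (h i).1
  have hs : ∀ i, ∑ a, (h i).1.eigenvalues a = 1 := by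
    intro i
    have := (h i).1.trace_eq_sum_eigenvalues
    rw [ht] at this
    have h2 := congrArg Complex.re this
    simpa using h2.symm
  have hH : (kron A).IsHermitian := by
    rw [Matrix.IsHermitian, kron_conjTranspose]
    congr 1; funext i; exact (h i).1
  rw [entropy_of_diag hH (V := kron V) (fun f => ∏ i, (h i).1.eigenvalues (f i))]
  · simp_rw [negMulLog_prod]
    rw [Finset.sum_comm]
    refine Finset.sum_congr rfl fun i _ => ?_
    have := sum_prod_mul (fun i => (h i).1.eigenvalues) hs i
      (fun a => -Real.log ((h i).1.eigenvalues a))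
    rw [this, entropy_eq (h i).1]
    simp [Real.negMulLog]
  · rw [kron_conjTranspose, kron_mul]; simp_rw [hV]; exact kron_one
  · have : (Matrix.diagonal (fun f : Fin n → Fin d => ((∏ i, (h i).1.eigenvalues (f i) : ℝ) : ℂ)))
        = kron (fun i => Matrix.diagonal (fun a => ((h i).1.eigenvalues a : ℂ))) := by
      rw [kron_diagonal]; simp
    rw [this, kron_conjTranspose, kron_mul, kron_mul]
    congr 1; funext i; exact e i

lemma twirl_psd {G ι : Type*} [Fintype G] [Fintype ι] (U : G → Matrix ι ι ℂ) {X : Matrix ι ι ℂ}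
    (h : X.PosSemidef) : (twirl U X).PosSemidef := by
  have := psd_smul (psd_sum (fun g => U g * X * (U g)ᴴ)
    fun g => h.mul_mul_conjTranspose_same (U g)) (c := (Fintype.card G : ℝ)⁻¹) (by positivity)
  simpa [twirl] using this

lemma twirl_sum {G ι κ : Type*} [Fintype G] [Fintype ι] [Fintype κ] (U : G → Matrix ι ι ℂ)
    (c : κ → ℂ) (X : κ → Matrix ι ι ℂ) :
    twirl U (∑ x, c x • X x) = ∑ x, c x • twirl U (X x) := by
  simp only [twirl, Finset.mul_sum, Finset.sum_mul, Finset.smul_sum, Matrix.mul_smul,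
    Matrix.smul_mul]
  rw [Finset.sum_comm]
  refine Finset.sum_congr rfl fun x _ => Finset.sum_congr rfl fun g _ => ?_
  rw [smul_comm]

lemma twirl_trace {G ι : Type*} [Fintype G] [Nonempty G] [Fintype ι] [DecidableEq ι]
    (U : G → Matrix ι ι ℂ) (hU : ∀ g, (U g)ᴴ * U g = 1) (X : Matrix ι ι ℂ) :
    (twirl U X).trace = X.trace := by
  have : ∀ g, (U g * X * (U g)ᴴ).trace = X.trace := by
    intro g
    rw [Matrix.trace_mul_comm, ← mul_assoc, hU, one_mul]
  simp [twirl, Matrix.trace_sum, this]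

lemma twirl_kron {G : Type*} [Fintype G] {n d : ℕ} (U : G → Matrix (Fin d) (Fin d) ℂ)
    (A : Fin n → Matrix (Fin d) (Fin d) ℂ) :
    twirl (repPow U n) (kron A) = kron (fun i => twirl U (A i)) := by
  have h1 : ∀ g : Fin n → G, repPow U n g * kron A * (repPow U n g)ᴴ
      = kron (fun i => U (g i) * A i * (U (g i))ᴴ) := by
    intro g
    have : repPow U n g = kron (fun i => U (g i)) := rfl
    rw [this, kron_conjTranspose, kron_mul, kron_mul]
  ext f h
  simp only [twirl, h1]
  simp only [kron, Matrix.smul_apply, Matrix.sum_apply, smul_eq_mul, Finset.prod_mul_distrib]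
  rw [Finset.prod_univ_sum, Fintype.piFinset_univ]
  simp

lemma pure_psd {ι : Type*} [Fintype ι] (ψ : ι → ℂ) :
    (Matrix.vecMulVec ψ (star ψ)).PosSemidef := Matrix.posSemidef_vecMulVec_self_star ψ

lemma pure_trace {ι : Type*} [Fintype ι] (ψ : ι → ℂ) (h : ∑ i, Complex.normSq (ψ i) = 1) :
    (Matrix.vecMulVec ψ (star ψ)).trace = 1 := by
  have : ((∑ i, Complex.normSq (ψ i) : ℝ) : ℂ) = 1 := by rw [h]; simp
  rw [← this]
  simp [Matrix.trace, Matrix.vecMulVec_apply, Complex.mul_conj]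

lemma value_le {G ι κ : Type*} [Fintype G] [Fintype ι] [DecidableEq ι] [Fintype κ]
    (U : G → Matrix ι ι ℂ) (ρ : Matrix ι ι ℂ) (p : κ → ℝ) (ψ : κ → ι → ℂ)
    (hp : ∀ x, 0 ≤ p x) (hs : ∑ x, p x = 1)
    (e : ρ = ∑ x, (p x : ℂ) • Matrix.vecMulVec (ψ x) (star (ψ x))) :
    ∑ x, p x * vnEntropy (twirl U (Matrix.vecMulVec (ψ x) (star (ψ x))))
      ≤ vnEntropy (twirl U ρ) := by
  rw [e, twirl_sum]
  exact concave p hp hs _ fun x => twirl_psd U (pure_psd _)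

lemma le_asym {G ι κ : Type*} [Fintype G] [Fintype ι] [DecidableEq ι] [Fintype κ]
    (U : G → Matrix ι ι ℂ) (ρ : Matrix ι ι ℂ) (p : κ → ℝ) (ψ : κ → ι → ℂ)
    (hp : ∀ x, 0 ≤ p x) (hs : ∑ x, p x = 1) (hψ : ∀ x, ∑ i, Complex.normSq (ψ x i) = 1)
    (e : ρ = ∑ x, (p x : ℂ) • Matrix.vecMulVec (ψ x) (star (ψ x))) :
    ∑ x, p x * vnEntropy (twirl U (Matrix.vecMulVec (ψ x) (star (ψ x))))
      ≤ asymAssist U ρ := by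
  refine le_csSup ⟨vnEntropy (twirl U ρ), ?_⟩ ?_
  · rintro r ⟨n, p, ψ, hp, hs, -, e, rfl⟩
    exact value_le U ρ p ψ hp hs e
  · let q := (Fintype.equivFin κ).symm
    refine ⟨Fintype.card κ, fun x => p (q x), fun x => ψ (q x), fun x => hp _, ?_,
      fun x => hψ _, ?_, ?_⟩
    · rw [← hs]; exact q.sum_comp p
    · rw [e]
      exact (q.sum_comp fun x => (p x : ℂ) • Matrix.vecMulVec (ψ x) (star (ψ x))).symm
    · exact (q.sum_comp fun x =>
        p x * vnEntropy (twirl U (Matrix.vecMulVec (ψ x) (star (ψ x))))).symm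

lemma asym_nonneg {G ι : Type*} [Fintype G] [Nonempty G] [Fintype ι] [DecidableEq ι]
    (U : G → Matrix ι ι ℂ) (hU : ∀ g, (U g)ᴴ * U g = 1) (ρ : Matrix ι ι ℂ) :
    0 ≤ asymAssist U ρ := by
  refine Real.sSup_nonneg ?_
  rintro r ⟨n, p, ψ, hp, hs, hψ, e, rfl⟩
  refine Finset.sum_nonneg fun x _ => mul_nonneg (hp x) (entropy_nonneg (twirl_psd U (pure_psd _)) ?_)
  rw [twirl_trace U hU, pure_trace _ (hψ x)]

lemma repPow_unitary {G : Type*} {n d : ℕ} (U : G → Matrix (Fin d) (Fin d) ℂ)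
    (hU : ∀ g, (U g)ᴴ * U g = 1) (g : Fin n → G) :
    (repPow U n g)ᴴ * repPow U n g = 1 := by
  have : repPow U n g = kron (fun i => U (g i)) := rfl
  rw [this, kron_conjTranspose, kron_mul]
  simp_rw [hU]
  exact kron_one

lemma upper {G : Type*} [Fintype G] [Nonempty G] {d : ℕ} (U : G → Matrix (Fin d) (Fin d) ℂ)
    (hU : ∀ g, (U g)ᴴ * U g = 1) (ρ : Matrix (Fin d) (Fin d) ℂ) (hρ : ρ.PosSemidef)
    (ht : ρ.trace = 1) (n : ℕ) :
    asymAssist (repPow U n) (kronPow ρ n) ≤ n * vnEntropy (twirl U ρ) := by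
  have ht' : (twirl U ρ).trace = 1 := by rw [twirl_trace U hU, ht]
  have hk : vnEntropy (twirl (repPow U n) (kronPow ρ n)) = n * vnEntropy (twirl U ρ) := by
    have : kronPow ρ n = kron (fun _ => ρ) := rfl
    rw [this, twirl_kron, entropy_kron _ (fun _ => twirl_psd U hρ) (fun _ => ht')]
    simp
  refine Real.sSup_le ?_ (mul_nonneg (Nat.cast_nonneg n) (entropy_nonneg (twirl_psd U hρ) ht'))
  rintro r ⟨m, p, ψ, hp, hs, -, e, rfl⟩
  rw [← hk]
  exact value_le _ _ p ψ hp hs e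

lemma lower {G : Type*} [Fintype G] [Nonempty G] {d : ℕ} (U : G → Matrix (Fin d) (Fin d) ℂ)
    (hU : ∀ g, (U g)ᴴ * U g = 1) (ρ : Matrix (Fin d) (Fin d) ℂ) (n : ℕ) (hn : n ≠ 0) :
    asymAssist U ρ ≤ (n : ℝ)⁻¹ * asymAssist (repPow U n) (kronPow ρ n) := by
  refine Real.sSup_le ?_ (mul_nonneg (by positivity) (asym_nonneg _ (repPow_unitary U hU) _))
  rintro r ⟨m, p, ψ, hp, hs, hψ, e, rfl⟩
  have hpure : ∀ x : Fin n → Fin m,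
      Matrix.vecMulVec (fun f : Fin n → Fin d => ∏ i, ψ (x i) (f i))
        (star (fun f : Fin n → Fin d => ∏ i, ψ (x i) (f i)))
      = kron (fun i => Matrix.vecMulVec (ψ (x i)) (star (ψ (x i)))) := by
    intro x
    ext f h
    simp [kron, Matrix.vecMulVec_apply, Finset.prod_mul_distrib]
  have key := le_asym (repPow U n) (kronPow ρ n) (κ := Fin n → Fin m)
    (fun x => ∏ i, p (x i)) (fun x f => ∏ i, ψ (x i) (f i))
    (fun x => Finset.prod_nonneg fun i _ => hp _) ?_ ?_ ?_
  · rw [inv_mul_eq_div, le_div_iff₀ (by positivity)]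
    refine le_trans (le_of_eq ?_) key
    simp only [hpure, twirl_kron]
    have : ∀ x : Fin n → Fin m,
        vnEntropy (kron fun i => twirl U (Matrix.vecMulVec (ψ (x i)) (star (ψ (x i)))))
        = ∑ i, vnEntropy (twirl U (Matrix.vecMulVec (ψ (x i)) (star (ψ (x i))))) := by
      intro x
      refine entropy_kron _ (fun i => twirl_psd U (pure_psd _)) fun i => ?_
      rw [twirl_trace U hU, pure_trace _ (hψ _)]
    simp only [this, Finset.mul_sum]
    rw [Finset.sum_comm]
    have h2 := fun i => sum_prod_mul (fun (_ : Fin n) => p) (fun _ => hs) i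
      (fun a => vnEntropy (twirl U (Matrix.vecMulVec (ψ a) (star (ψ a)))))
    rw [Finset.sum_congr rfl fun i _ => h2 i]
    simp [mul_comm]
  · have h2 := Finset.prod_univ_sum (fun _ : Fin n => (Finset.univ : Finset (Fin m)))
      (fun _ a => p a)
    rw [Fintype.piFinset_univ] at h2
    rw [← h2]; simp [hs]
  · intro x
    have h2 := Finset.prod_univ_sum (fun _ : Fin n => (Finset.univ : Finset (Fin d)))
      (fun i a => Complex.normSq (ψ (x i) a))
    rw [Fintype.piFinset_univ] at h2
    simp only [map_prod]
    rw [← h2]; simp [hψ]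
  · simp only [hpure]
    ext f h
    have h2 := Finset.prod_univ_sum (fun _ : Fin n => (Finset.univ : Finset (Fin m)))
      (fun i a => (p a : ℂ) * (Matrix.vecMulVec (ψ a) (star (ψ a)) (f i) (h i)))
    rw [Fintype.piFinset_univ] at h2
    simp only [kronPow]
    conv_lhs => rw [e]
    simp only [Matrix.sum_apply, Matrix.smul_apply, smul_eq_mul]
    rw [h2]
    simp [kron, Finset.prod_mul_distrib]

end AsymAux

/-- Proposition 1: `A_G(ρ) ≤ A_G^∞(ρ) ≤ H(𝒢(ρ))`, where
`A_G^∞(ρ) = limsup_n (1/n) A_{G^n}(ρ^{⊗n})`. -/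
theorem asymAssist_le_regularized_le_entropy_twirl
    {G : Type*} [Group G] [Fintype G] {d : ℕ}
    (U : G → Matrix (Fin d) (Fin d) ℂ)
    (hU : ∀ g, U g ∈ Matrix.unitaryGroup (Fin d) ℂ)
    (hU1 : U 1 = 1) (hUmul : ∀ g g', U (g * g') = U g * U g')
    (ρ : Matrix (Fin d) (Fin d) ℂ) (hρ : ρ.PosSemidef) (hρtr : ρ.trace = 1) :
    asymAssist U ρ ≤
      Filter.limsup (fun n : ℕ => (n : ℝ)⁻¹ * asymAssist (repPow U n) (kronPow ρ n))
        Filter.atTop ∧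
    Filter.limsup (fun n : ℕ => (n : ℝ)⁻¹ * asymAssist (repPow U n) (kronPow ρ n))
        Filter.atTop ≤ vnEntropy (twirl U ρ) := by
  have hU' : ∀ g, (U g)ᴴ * U g = 1 := fun g => (Matrix.mem_unitaryGroup_iff'.mp (hU g))
  have hup : ∀ᶠ n : ℕ in Filter.atTop,
      (n : ℝ)⁻¹ * asymAssist (repPow U n) (kronPow ρ n) ≤ vnEntropy (twirl U ρ) := by
    filter_upwards [Filter.eventually_ne_atTop 0] with n hn
    rw [inv_mul_le_iff₀ (by positivity)]
    exact AsymAux.upper U hU' ρ hρ hρtr n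
  have hlo : ∀ᶠ n : ℕ in Filter.atTop,
      asymAssist U ρ ≤ (n : ℝ)⁻¹ * asymAssist (repPow U n) (kronPow ρ n) := by
    filter_upwards [Filter.eventually_ne_atTop 0] with n hn
    exact AsymAux.lower U hU' ρ n hn
  refine ⟨Filter.le_limsup_of_frequently_le hlo.frequently ?_, Filter.limsup_le_of_le ?_ hup⟩
  · exact Filter.isBoundedUnder_of_eventually_le hup
  · exact Filter.IsBoundedUnder.isCoboundedUnder_le (Filter.isBoundedUnder_of_eventually_ge hlo)
end

section
/- Let |Ψ⟩ be a unit vector in ℂ^{d_A} ⊗ ℂ^{d_F} and Ψ_{AF} = |Ψ⟩⟨Ψ| the corresponding rank-one density matrix indexed by pairs in Fin d_A × Fin d_F. Let G be a finite group with a unitary representation U on ℂ^{d_A} and twirling operation 𝒢. Let M be a finite nonempty message set and X a finite set; let {Λ^x}_{x∈X} be a POVM on ℂ^{d_F}; for each pair (m,x) ∈ M × X let E^{m|x} be a positive trace-preserving linear map on d_A×d_A matrices satisfying E^{m|x}(𝒢(Y)) = 𝒢(Y) and 𝒢(E^{m|x}(Y)) = 𝒢(Y) for every d_A×d_A matrix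 Y; and for each x ∈ X let {Γ^{m|x}}_{m∈M} be a POVM on ℂ^{d_A}. Define the success probability s = (1/|M|) Σ_{m∈M} Σ_{x∈X} Re tr[Γ^{m|x} · E^{m|x}( tr_F[(1 ⊗ Λ^x) Ψ_{AF}] )]. Then for every α ∈ (1,2): s ≤ exp( ((α−1)/α) · ( H_{2−α}(𝒢(tr_F Ψ_{AF})) − log |M| ) ), where H_β(ρ) = (1/(1−β)) log tr[ρ^β]. -/
open scoped BigOperators Kronecker ComplexOrder
open Matrix

/-- Partial trace over the second (F) factor. -/
noncomputable def ptraceF {α β : Type*} [Fintype β]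
    (X : Matrix (α × β) (α × β) ℂ) : Matrix α α ℂ :=
  fun i k => ∑ j, X (i, j) (k, j)

/-- Partial trace over the first (A) factor. -/
noncomputable def ptraceA {α β : Type*} [Fintype α]
    (X : Matrix (α × β) (α × β) ℂ) : Matrix β β ℂ :=
  fun j l => ∑ i, X (i, j) (i, l)

/-- Partial transpose on the second (F) factor. -/
def ptransF {α β : Type*} (X : Matrix (α × β) (α × β) ℂ) :
    Matrix (α × β) (α × β) ℂ :=
  fun p q => X (p.1, q.2) (q.1, p.2)

/-- Quantum Rényi entropy `H_β(ρ) = (1/(1−β)) log tr[ρ^β]`. -/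
noncomputable def renyiEntropy {ι : Type*} [Fintype ι] [DecidableEq ι]
    (β : ℝ) (ρ : Matrix ι ι ℂ) : ℝ :=
  (1 - β)⁻¹ * Real.log ((matPow ρ β).trace.re)


/-- Cauchy–Schwarz for finite complex sums. -/
lemma cs_sum {k : Type*} [Fintype k] (a b : k → ℂ) :
    ‖∑ i, a i * b i‖ ^ 2 ≤ (∑ i, ‖a i‖ ^ 2) * ∑ i, ‖b i‖ ^ 2 := by
  calc ‖∑ i, a i * b i‖ ^ 2 ≤ (∑ i, ‖a i‖ * ‖b i‖) ^ 2 := by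
        gcongr
        refine (norm_sum_le _ _).trans (le_of_eq ?_)
        simp
    _ ≤ _ := Finset.sum_mul_sq_le_sq_mul_sq _ _ _

/-- Real quadratic form of a positive semidefinite matrix factors. -/
lemma psd_factor {n : Type*} [Fintype n] [DecidableEq n] {T : Matrix n n ℂ} (hT : T.PosSemidef) :
    ∃ B : Matrix n n ℂ, T = Bᴴ * B := by
  open scoped MatrixOrder in
  have h : 0 ≤ T := Matrix.nonneg_iff_posSemidef.mpr hT
  obtain ⟨B, hB⟩ := CStarAlgebra.nonneg_iff_eq_star_mul_self.mp h
  exact ⟨B, hB⟩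

lemma star_dot_self {n : Type*} [Fintype n] (z : n → ℂ) :
    star z ⬝ᵥ z = ((∑ i, ‖z i‖ ^ 2 : ℝ) : ℂ) := by
  simp only [dotProduct, Pi.star_apply, Complex.ofReal_sum]
  refine Finset.sum_congr rfl fun i _ => ?_
  rw [mul_comm, RCLike.star_def, Complex.mul_conj, Complex.normSq_eq_norm_sq]

lemma psd_of_nonneg {n : Type*} [Fintype n] [DecidableEq n] {T : Matrix n n ℂ}
    (h : ∀ z : n → ℂ, 0 ≤ star z ⬝ᵥ (T *ᵥ z)) : T.PosSemidef := by
  rw [← Matrix.isPositive_toEuclideanLin_iff, LinearMap.isPositive_iff_complex]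
  intro x
  have h1 := h x.ofLp
  have h2 : inner ℂ (T.toEuclideanLin x) x = star (star x.ofLp ⬝ᵥ (T *ᵥ x.ofLp)) := by
    rw [EuclideanSpace.inner_eq_star_dotProduct, Matrix.star_dotProduct, star_star,
      dotProduct_comm]
    simp [Matrix.toLpLin_apply]
  rw [h2]
  rw [Complex.le_def] at h1
  constructor
  · apply Complex.ext <;> simp at h1 ⊢
    exact h1.2.symm
  · simpa using h1.1

lemma psd_contraction {n : Type*} [Fintype n] [DecidableEq n] {T : Matrix n n ℂ}
    (hT : T.PosSemidef) (hT1 : (1 - T).PosSemidef) (z : n → ℂ) :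
    ∑ i, ‖(T *ᵥ z) i‖ ^ 2 ≤ (star z ⬝ᵥ (T *ᵥ z)).re := by
  have h1 : (T - T * T).PosSemidef := by
    have h2 := (hT1.conjTranspose_mul_mul_same T).add (hT.conjTranspose_mul_mul_same (1 - T))
    rw [hT.isHermitian.eq, hT1.isHermitian.eq] at h2
    convert h2 using 1
    noncomm_ring
  have h3 := h1.dotProduct_mulVec_nonneg z
  rw [sub_mulVec, dotProduct_sub, ← mulVec_mulVec] at h3
  have h4 : star z ⬝ᵥ (T *ᵥ (T *ᵥ z)) = star (T *ᵥ z) ⬝ᵥ (T *ᵥ z) := by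
    rw [star_mulVec, hT.isHermitian.eq, dotProduct_mulVec]
  rw [h4, star_dot_self, Complex.le_def] at h3
  have := h3.1
  simp only [Complex.zero_re, Complex.sub_re, Complex.ofReal_re] at this
  linarith

lemma psd_cs {n : Type*} [Fintype n] [DecidableEq n] {T : Matrix n n ℂ}
    (hT : T.PosSemidef) (z : n → ℂ) (i : n) :
    ‖(T *ᵥ z) i‖ ^ 2 ≤ (star z ⬝ᵥ (T *ᵥ z)).re * (T i i).re := by
  obtain ⟨B, rfl⟩ := psd_factor hT
  have h1 : star z ⬝ᵥ ((Bᴴ * B) *ᵥ z) = star (B *ᵥ z) ⬝ᵥ (B *ᵥ z) := by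
    rw [star_mulVec, ← mulVec_mulVec, dotProduct_mulVec]
  have h2 : ((Bᴴ * B) i i).re = ∑ k, ‖star (B k i)‖ ^ 2 := by
    rw [Matrix.mul_apply, Complex.re_sum]
    refine Finset.sum_congr rfl fun k _ => ?_
    rw [conjTranspose_apply, mul_comm, RCLike.star_def, Complex.mul_conj, Complex.normSq_eq_norm_sq,
      Complex.ofReal_re]
    simp
  rw [h1, star_dot_self, h2, Complex.ofReal_re, ← mulVec_mulVec, mul_comm]
  exact cs_sum (fun k => star (B k i)) (B *ᵥ z)

/-- tangent line bound -/
lemma rpow_tangent {x c t : ℝ} (hx : 0 ≤ x) (hc : 0 < c) (ht0 : 0 < t) (ht1 : t < 1) :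
    x ^ t ≤ t * c ^ (t - 1) * x + (1 - t) * c ^ t := by
  have h := Real.geom_mean_le_arith_mean2_weighted ht0.le (sub_nonneg.mpr ht1.le)
    (div_nonneg hx hc.le) zero_le_one (by ring)
  rw [Real.one_rpow, mul_one, Real.div_rpow hx hc.le] at h
  have hct := Real.rpow_pos_of_pos hc t
  rw [div_le_iff₀ hct] at h
  rw [Real.rpow_sub_one hc.ne']
  calc x ^ t ≤ _ := h
    _ = _ := by field_simp

lemma core {n : Type*} [Fintype n] [DecidableEq n] {T : Matrix n n ℂ}
    (hT : T.PosSemidef) (hT1 : (1 - T).PosSemidef) (l : n → ℝ) (hl : ∀ i, 0 ≤ l i)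
    {c t : ℝ} (hc : 0 < c) (ht0 : 0 < t) (ht1 : t < 1)
    (hlT : ∑ i, l i * (T i i).re ≤ c) (z : n → ℂ) (hz : ∀ i, l i = 0 → z i = 0) :
    (star z ⬝ᵥ (T *ᵥ z)).re ≤
      c ^ t * ∑ i, (if l i = 0 then 0 else l i ^ (-t)) * ‖z i‖ ^ 2 := by
  set q := (star z ⬝ᵥ (T *ᵥ z)).re with hq
  have hq0 : 0 ≤ q := hT.re_dotProduct_nonneg z
  set P : ℝ := ∑ i, (if l i = 0 then 0 else l i ^ (-t)) * ‖z i‖ ^ 2 with hP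
  have hct := Real.rpow_pos_of_pos hc t
  have hct1 := Real.rpow_pos_of_pos hc (t - 1)
  have hP0 : 0 ≤ P := by
    refine Finset.sum_nonneg fun i _ => mul_nonneg ?_ (sq_nonneg _)
    split_ifs
    · exact le_rfl
    · exact Real.rpow_nonneg (hl i) _
  have hR : ∑ i, l i ^ t * ‖(T *ᵥ z) i‖ ^ 2 ≤ c ^ t * q := by
    calc ∑ i, l i ^ t * ‖(T *ᵥ z) i‖ ^ 2
        ≤ ∑ i, (t * c ^ (t - 1) * l i + (1 - t) * c ^ t) * ‖(T *ᵥ z) i‖ ^ 2 := by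
          gcongr with i
          exact rpow_tangent (hl i) hc ht0 ht1
      _ = t * c ^ (t - 1) * ∑ i, l i * ‖(T *ᵥ z) i‖ ^ 2
            + (1 - t) * c ^ t * ∑ i, ‖(T *ᵥ z) i‖ ^ 2 := by
          rw [Finset.mul_sum, Finset.mul_sum, ← Finset.sum_add_distrib]
          refine Finset.sum_congr rfl fun i _ => by ring
      _ ≤ t * c ^ (t - 1) * (q * c) + (1 - t) * c ^ t * q := by
          have h1 : ∑ i, l i * ‖(T *ᵥ z) i‖ ^ 2 ≤ q * c := by
            calc ∑ i, l i * ‖(T *ᵥ z) i‖ ^ 2 ≤ ∑ i, l i * (q * (T i i).re) := by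
                  gcongr with i
                  · exact hl i
                  · exact psd_cs hT z i
              _ = q * ∑ i, l i * (T i i).re := by
                  rw [Finset.mul_sum]
                  refine Finset.sum_congr rfl fun i _ => by ring
              _ ≤ q * c := by gcongr
          have h2 := psd_contraction hT hT1 z
          have h3 : 0 ≤ 1 - t := by linarith
          gcongr
      _ = c ^ t * q := by
          rw [Real.rpow_sub_one hc.ne']
          field_simp
          ring
  have hCS : q ^ 2 ≤ P * ∑ i, l i ^ t * ‖(T *ᵥ z) i‖ ^ 2 := by
    have h0 : star z ⬝ᵥ (T *ᵥ z) = ∑ i, (((if l i = 0 then 0 else l i ^ (-t / 2) : ℝ) : ℂ) * star (z i))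
        * (((l i ^ (t / 2) : ℝ) : ℂ) * (T *ᵥ z) i) := by
      simp only [dotProduct, Pi.star_apply]
      refine Finset.sum_congr rfl fun i _ => ?_
      by_cases h : l i = 0
      · simp [hz i h]
      · have hp : 0 < l i := lt_of_le_of_ne (hl i) (Ne.symm h)
        have : l i ^ (-t / 2) * l i ^ (t / 2) = 1 := by
          rw [← Real.rpow_add hp]
          ring_nf
          simp
        have h' : ((l i ^ (-t / 2) : ℝ) : ℂ) * ((l i ^ (t / 2) : ℝ) : ℂ) = 1 := by
          exact_mod_cast this
        rw [if_neg h]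
        linear_combination (-(star (z i) * (T *ᵥ z) i)) * h'
    have h1 : q ^ 2 ≤ ‖star z ⬝ᵥ (T *ᵥ z)‖ ^ 2 := by
      rw [hq]
      exact sq_le_sq' (by linarith [abs_le.mp (Complex.abs_re_le_norm (star z ⬝ᵥ (T *ᵥ z)))])
        (Complex.re_le_norm _)
    refine h1.trans ?_
    rw [h0]
    refine (cs_sum _ _).trans (le_of_eq ?_)
    congr 1
    · refine Finset.sum_congr rfl fun i _ => ?_
      by_cases h : l i = 0
      · simp [h]
      · rw [if_neg h, if_neg h, norm_mul, mul_pow, Complex.norm_real, norm_star, Real.norm_eq_abs,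
          sq_abs, ← Real.rpow_natCast, ← Real.rpow_mul (hl i)]
        congr 2
        push_cast
        ring
    · refine Finset.sum_congr rfl fun i _ => ?_
      rw [norm_mul, mul_pow, Complex.norm_real, Real.norm_eq_abs,
          sq_abs, ← Real.rpow_natCast, ← Real.rpow_mul (hl i)]
      congr 2
      push_cast
      ring
  by_cases h : q = 0
  · rw [h]; positivity
  · have hqp : 0 < q := lt_of_le_of_ne hq0 (Ne.symm h)
    have : q * q ≤ (c ^ t * P) * q := by nlinarith [mul_le_mul_of_nonneg_left hR hP0]
    exact le_of_mul_le_mul_right this hqp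

lemma functional_rep {n : Type*} [Fintype n] [DecidableEq n] (f : Matrix n n ℂ →ₗ[ℂ] ℂ) :
    ∃ T : Matrix n n ℂ, ∀ Y, f Y = (T * Y).trace := by
  refine ⟨Matrix.of fun i j => f (Matrix.single j i 1), fun Y => ?_⟩
  conv_lhs => rw [Matrix.matrix_eq_sum_single Y]
  simp only [map_sum, Matrix.trace, Matrix.diag, Matrix.mul_apply, Matrix.of_apply]
  rw [Finset.sum_comm]
  refine Finset.sum_congr rfl fun j _ => Finset.sum_congr rfl fun i _ => ?_
  have : Matrix.single i j (Y i j) = Y i j • Matrix.single i j (1 : ℂ) := by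
    simp
  rw [this, map_smul, smul_eq_mul, mul_comm]

lemma trace_mul_vecMulVec_star {n : Type*} [Fintype n] (T : Matrix n n ℂ) (z : n → ℂ) :
    (T * vecMulVec z (star z)).trace = star z ⬝ᵥ (T *ᵥ z) := by
  rw [Matrix.mul_vecMulVec, Matrix.trace_vecMulVec, dotProduct_comm]

lemma psd_of_functional {n : Type*} [Fintype n] [DecidableEq n] {T : Matrix n n ℂ}
    (h : ∀ Y : Matrix n n ℂ, Y.PosSemidef → 0 ≤ (T * Y).trace) : T.PosSemidef := by
  refine psd_of_nonneg fun z => ?_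
  rw [← trace_mul_vecMulVec_star]
  exact h _ (posSemidef_vecMulVec_self_star z)

lemma trace_mul_psd_nonneg {n : Type*} [Fintype n] [DecidableEq n] {A B : Matrix n n ℂ}
    (hA : A.PosSemidef) (hB : B.PosSemidef) : 0 ≤ (A * B).trace := by
  obtain ⟨C, rfl⟩ := psd_factor hB
  rw [← Matrix.mul_assoc, Matrix.trace_mul_comm, ← Matrix.mul_assoc]
  exact (hA.mul_mul_conjTranspose_same C).trace_nonneg

lemma eig_decomp {n : Type*} [Fintype n] [DecidableEq n] {σ : Matrix n n ℂ}
    (h : σ.IsHermitian) :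
    σ = (h.eigenvectorUnitary : Matrix n n ℂ) *
      Matrix.diagonal (fun i => (h.eigenvalues i : ℂ)) *
      (star (h.eigenvectorUnitary : Matrix n n ℂ)) := by
  conv_lhs => rw [h.spectral_theorem]
  rfl

lemma unit1 {n : Type*} [Fintype n] [DecidableEq n] (Q : Matrix.unitaryGroup n ℂ) :
    star (Q : Matrix n n ℂ) * (Q : Matrix n n ℂ) = 1 := by simp

lemma unit2 {n : Type*} [Fintype n] [DecidableEq n] (Q : Matrix.unitaryGroup n ℂ) :
    (Q : Matrix n n ℂ) * star (Q : Matrix n n ℂ) = 1 := by simp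

lemma conj_cancel {n : Type*} [Fintype n] [DecidableEq n] (Q : Matrix.unitaryGroup n ℂ)
    (D : Matrix n n ℂ) :
    star (Q : Matrix n n ℂ) * ((Q : Matrix n n ℂ) * D * star (Q : Matrix n n ℂ)) * Q = D := by
  calc _ = (star (Q : Matrix n n ℂ) * (Q : Matrix n n ℂ)) * D *
        (star (Q : Matrix n n ℂ) * (Q : Matrix n n ℂ)) := by noncomm_ring
    _ = D := by rw [unit1]; simp

lemma trace_columns {n : Type*} [Fintype n] [DecidableEq n] (Q : Matrix.unitaryGroup n ℂ)
    (T B : Matrix n n ℂ) :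
    (T * (Bᴴ * B)).trace = ∑ k, star (fun i => (star (Q : Matrix n n ℂ) * Bᴴ) i k) ⬝ᵥ
      ((star (Q : Matrix n n ℂ) * T * (Q : Matrix n n ℂ)) *ᵥ (fun i => (star (Q : Matrix n n ℂ) * Bᴴ) i k)) := by
  set C := star (Q : Matrix n n ℂ) * Bᴴ with hC
  have h1 : Cᴴ * (star (Q : Matrix n n ℂ) * T * (Q : Matrix n n ℂ)) * C = B * T * Bᴴ := by
    have hCh : Cᴴ = B * (Q : Matrix n n ℂ) := by
      rw [hC, conjTranspose_mul, conjTranspose_conjTranspose, star_eq_conjTranspose,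
        conjTranspose_conjTranspose]
    rw [hCh, hC]
    calc _ = B * ((Q : Matrix n n ℂ) * star (Q : Matrix n n ℂ)) * T *
          ((Q : Matrix n n ℂ) * star (Q : Matrix n n ℂ)) * Bᴴ := by noncomm_ring
      _ = _ := by rw [unit2]; simp
  have h2 : (T * (Bᴴ * B)).trace = (Cᴴ * (star (Q : Matrix n n ℂ) * T * (Q : Matrix n n ℂ)) * C).trace := by
    rw [h1, ← Matrix.mul_assoc, Matrix.trace_mul_comm, ← Matrix.mul_assoc]
  rw [h2, Matrix.trace]
  refine Finset.sum_congr rfl fun k _ => ?_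
  rw [Matrix.diag_apply, Matrix.mul_assoc, Matrix.mul_apply]
  simp only [dotProduct, Pi.star_apply, conjTranspose_apply, mulVec, Matrix.mul_apply]

lemma main_bound_aux {n : Type*} [Fintype n] [DecidableEq n] {T σ R B : Matrix n n ℂ}
    (Q : Matrix.unitaryGroup n ℂ) (l : n → ℝ) (hl0 : ∀ i, 0 ≤ l i)
    (hdec : σ = (Q : Matrix n n ℂ) * Matrix.diagonal (fun i => (l i : ℂ)) *
      star (Q : Matrix n n ℂ)) (hT : T.PosSemidef) (hT1 : (1 - T).PosSemidef)
    {c t : ℝ} (hc : 0 < c) (ht0 : 0 < t) (ht1 : t < 1) (htr : (T * σ).trace.re ≤ c)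
    (hR : R = (Q : Matrix n n ℂ) *
      Matrix.diagonal (fun i => (((if l i = 0 then 0 else l i ^ (-t)) : ℝ) : ℂ)) *
      star (Q : Matrix n n ℂ))
    (K : ℂ) (hK : (K • σ - (Bᴴ * B)).PosSemidef) :
    (T * (Bᴴ * B)).trace.re ≤ c ^ t * (R * (Bᴴ * B)).trace.re := by
  set T' := star (Q : Matrix n n ℂ) * T * Q with hT'
  set C := star (Q : Matrix n n ℂ) * Bᴴ with hC
  have hpow : star (Q : Matrix n n ℂ) * R * Q =
      Matrix.diagonal (fun i => (((if l i = 0 then 0 else l i ^ (-t)) : ℝ) : ℂ)) := by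
    rw [hR]
    exact conj_cancel Q _
  have hT'p : T'.PosSemidef := by
    have := hT.conjTranspose_mul_mul_same (Q : Matrix n n ℂ)
    exact this
  have hT'1 : (1 - T').PosSemidef := by
    have := hT1.conjTranspose_mul_mul_same (Q : Matrix n n ℂ)
    rw [Matrix.mul_sub, Matrix.sub_mul, Matrix.mul_one] at this
    have h2 := unit1 Q
    rw [star_eq_conjTranspose] at h2
    rw [h2] at this
    exact this
  have htr' : ∑ i, l i * (T' i i).re ≤ c := by
    refine le_trans (le_of_eq ?_) htr
    have : (T * σ).trace = (T' * Matrix.diagonal (fun i => (l i : ℂ))).trace := by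
      rw [hT']
      conv_lhs => rw [hdec]
      rw [← Matrix.mul_assoc, Matrix.trace_mul_comm]
      congr 1
      noncomm_ring
    rw [this, Matrix.trace, Complex.re_sum]
    refine Finset.sum_congr rfl fun i _ => ?_
    rw [Matrix.diag_apply, Matrix.mul_diagonal, Complex.re_mul_ofReal, mul_comm]
  have hsupp : ∀ i, l i = 0 → ∀ k, C i k = 0 := by
    intro i hi k
    have h1 := hK.conjTranspose_mul_mul_same (Q : Matrix n n ℂ)
    have h2 : (Q : Matrix n n ℂ)ᴴ * (K • σ - Bᴴ * B) * Q =
        K • Matrix.diagonal (fun i => (l i : ℂ)) - C * Cᴴ := by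
      have hCh : Cᴴ = B * (Q : Matrix n n ℂ) := by
        rw [hC, conjTranspose_mul, conjTranspose_conjTranspose, star_eq_conjTranspose,
          conjTranspose_conjTranspose]
      rw [← star_eq_conjTranspose, Matrix.mul_sub, Matrix.sub_mul, hCh, hC]
      rw [Matrix.mul_smul, Matrix.smul_mul, hdec, conj_cancel Q]
      simp only [Matrix.mul_assoc]
    rw [h2] at h1
    have h3 := h1.diag_nonneg (i := i)
    rw [Matrix.sub_apply, Matrix.smul_apply, Matrix.diagonal_apply_eq, hi, Matrix.mul_apply] at h3
    have h4 : ∑ j, C i j * Cᴴ j i = ((∑ j, ‖C i j‖ ^ 2 : ℝ) : ℂ) := by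
      rw [Complex.ofReal_sum]
      refine Finset.sum_congr rfl fun j _ => ?_
      rw [conjTranspose_apply, RCLike.star_def, Complex.mul_conj, Complex.normSq_eq_norm_sq]
    rw [h4] at h3
    have h5 : ∑ j, ‖C i j‖ ^ 2 ≤ 0 := by
      have := (Complex.le_def.mp h3).1
      rw [Complex.sub_re, Complex.ofReal_re] at this
      simp only [Complex.zero_re, Complex.ofReal_zero, smul_zero] at this
      linarith
    have h6 := (Finset.sum_eq_zero_iff_of_nonneg (fun j _ => sq_nonneg ‖C i j‖)).mp
      (le_antisymm h5 (Finset.sum_nonneg fun j _ => sq_nonneg _)) k (Finset.mem_univ k)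
    simpa using h6
  rw [trace_columns Q T B, trace_columns Q (R) B, Complex.re_sum, Complex.re_sum,
    hpow, Finset.mul_sum]
  refine Finset.sum_le_sum fun k _ => ?_
  refine (core hT'p hT'1 l hl0 hc ht0 ht1 htr'
    (fun i => C i k) (fun i hi => hsupp i hi k)).trans (le_of_eq ?_)
  congr 1
  rw [dotProduct, Complex.re_sum]
  refine Finset.sum_congr rfl fun i _ => ?_
  rw [Matrix.mulVec_diagonal, Pi.star_apply]
  have : star (C i k) * (((if l i = 0 then 0 else l i ^ (-t) : ℝ) : ℂ) * C i k) =
      (((if l i = 0 then 0 else l i ^ (-t)) * ‖C i k‖ ^ 2 : ℝ) : ℂ) := by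
    have h := Complex.mul_conj (C i k)
    rw [Complex.normSq_eq_norm_sq] at h
    rw [Complex.ofReal_mul, ← h, RCLike.star_def]
    ring
  rw [this, Complex.ofReal_re]

lemma main_bound {n : Type*} [Fintype n] [DecidableEq n] {T σ ρ : Matrix n n ℂ}
    (hσ : σ.PosSemidef) (hT : T.PosSemidef) (hT1 : (1 - T).PosSemidef)
    {c t : ℝ} (hc : 0 < c) (ht0 : 0 < t) (ht1 : t < 1) (htr : (T * σ).trace.re ≤ c)
    (hρ : ρ.PosSemidef) (K : ℂ) (hK : (K • σ - ρ).PosSemidef) :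
    (T * ρ).trace.re ≤ c ^ t * (matPow σ (-t) * ρ).trace.re := by
  obtain ⟨B, rfl⟩ := psd_factor hρ
  have hH := hσ.isHermitian
  refine main_bound_aux hH.eigenvectorUnitary hH.eigenvalues (fun i => hσ.eigenvalues_nonneg i)
    (eig_decomp hH) hT hT1 hc ht0 ht1 htr ?_ K hK
  rw [matPow, matFun, dif_pos hH]

lemma matPow_comm {n : Type*} [Fintype n] [DecidableEq n] {σ V : Matrix n n ℂ}
    (hH : σ.IsHermitian) (s : ℝ) (hV : V * σ = σ * V) :
    V * matPow σ s = matPow σ s * V := by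
  have hdec := eig_decomp hH
  rw [matPow, matFun, dif_pos hH]
  set Q := hH.eigenvectorUnitary with hQ
  set l := hH.eigenvalues with hl
  set D := Matrix.diagonal (fun i => (l i : ℂ)) with hD
  set f : ℝ → ℝ := fun x => if x = 0 then 0 else x ^ s with hf
  set F := Matrix.diagonal (fun i => (f (l i) : ℂ)) with hF
  set W := star (Q : Matrix n n ℂ) * V * Q with hW
  have hVW : V = Q * W * star (Q : Matrix n n ℂ) := by
    rw [hW]
    calc V = 1 * V * 1 := by simp
      _ = _ := by rw [← unit2 Q]; noncomm_ring
  have hmul : ∀ A B : Matrix n n ℂ, ((Q : Matrix n n ℂ) * A * star (Q : Matrix n n ℂ)) *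
      ((Q : Matrix n n ℂ) * B * star (Q : Matrix n n ℂ)) =
      (Q : Matrix n n ℂ) * (A * B) * star (Q : Matrix n n ℂ) := by
    intro A B
    calc _ = (Q : Matrix n n ℂ) * A * (star (Q : Matrix n n ℂ) *
      (Q : Matrix n n ℂ)) * B * star (Q : Matrix n n ℂ) := by noncomm_ring
      _ = _ := by rw [unit1]; noncomm_ring
  have hWD : W * D = D * W := by
    rw [hdec, hVW, hmul, hmul] at hV
    rw [← conj_cancel Q (W * D), hV, conj_cancel]
  have hWF : W * F = F * W := by
    ext i j
    have := congrFun (congrFun hWD i) j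
    rw [hD, Matrix.mul_diagonal, Matrix.diagonal_mul] at this
    rw [hF, Matrix.mul_diagonal, Matrix.diagonal_mul]
    by_cases h : W i j = 0
    · simp [h]
    · have h2 : (l j : ℂ) = l i := by
        apply mul_left_cancel₀ h
        rw [this, mul_comm]
      have h3 : l j = l i := by exact_mod_cast h2
      rw [h3, mul_comm]
  rw [hVW, hmul, hmul, hWF]

lemma trace_matPow {n : Type*} [Fintype n] [DecidableEq n] {σ : Matrix n n ℂ}
    (hH : σ.IsHermitian) (s : ℝ) :
    (matPow σ s).trace.re =
      ∑ i, (if hH.eigenvalues i = 0 then 0 else hH.eigenvalues i ^ s) := by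
  rw [matPow, matFun, dif_pos hH, Matrix.trace_mul_comm, ← Matrix.mul_assoc, unit1, Matrix.one_mul,
    Matrix.trace_diagonal, Complex.re_sum]
  simp only [Complex.ofReal_re]

lemma trace_matPow_mul {n : Type*} [Fintype n] [DecidableEq n] {σ : Matrix n n ℂ}
    (hH : σ.IsHermitian) (s : ℝ) :
    (matPow σ s * σ).trace.re =
      ∑ i, hH.eigenvalues i * (if hH.eigenvalues i = 0 then 0 else hH.eigenvalues i ^ s) := by
  have hdec := eig_decomp hH
  rw [matPow, matFun, dif_pos hH]
  set Q := hH.eigenvectorUnitary with hQ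
  set l := hH.eigenvalues with hl
  conv_lhs => rw [hdec]
  rw [← Matrix.mul_assoc, Matrix.trace_mul_comm, ← Matrix.mul_assoc, ← Matrix.mul_assoc,
    ← Matrix.mul_assoc, ← Matrix.mul_assoc, unit1, Matrix.one_mul, Matrix.mul_assoc _ _ (Q : Matrix n n ℂ),
    unit1, Matrix.mul_one, Matrix.diagonal_mul_diagonal,
    Matrix.trace_diagonal, Complex.re_sum]
  refine Finset.sum_congr rfl fun i _ => ?_
  rw [← Complex.ofReal_mul, Complex.ofReal_re, mul_comm]

lemma jensen_bound {n : Type*} [Fintype n] (l : n → ℝ) (hl : ∀ i, 0 ≤ l i) (hs : ∑ i, l i = 1)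
    {α : ℝ} (hα : 1 < α) :
    ∑ i, l i * (if l i = 0 then 0 else l i ^ (-((α - 1) / α))) ≤
      (∑ i, (if l i = 0 then 0 else l i ^ (2 - α))) ^ (1 / α) := by
  refine (Real.arith_mean_le_rpow_mean Finset.univ l
    (fun i => if l i = 0 then 0 else l i ^ (-((α - 1) / α))) (fun i _ => hl i) hs
    (fun i _ => ?_) hα.le).trans (le_of_eq ?_)
  · split_ifs
    · exact le_rfl
    · exact Real.rpow_nonneg (hl i) _
  · congr 1
    refine Finset.sum_congr rfl fun i _ => ?_
    by_cases h : l i = 0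
    · simp [h]
    · have hp : 0 < l i := lt_of_le_of_ne (hl i) (Ne.symm h)
      rw [if_neg h, if_neg h, ← Real.rpow_mul (hl i)]
      nth_rewrite 1 [← Real.rpow_one (l i)]
      rw [← Real.rpow_add hp]
      congr 1
      field_simp
      ring

lemma twirl_inv {G : Type*} [Group G] [Fintype G] {n : Type*} [Fintype n] [DecidableEq n]
    (U : G → Matrix n n ℂ) (hU : ∀ g, U g ∈ Matrix.unitaryGroup n ℂ)
    (hUmul : ∀ g g', U (g * g') = U g * U g') (Y : Matrix n n ℂ) (h : G) :
    U h * twirl U Y = twirl U Y * U h := by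
  have hun : (U h)ᴴ * U h = 1 := by
    have := Matrix.mem_unitaryGroup_iff'.mp (hU h)
    rwa [star_eq_conjTranspose] at this
  have h1 : U h * twirl U Y * (U h)ᴴ = twirl U Y := by
    rw [twirl, Matrix.mul_smul, Matrix.smul_mul, Finset.mul_sum, Finset.sum_mul]
    congr 1
    refine Fintype.sum_equiv (Equiv.mulLeft h) _ _ fun g => ?_
    simp only [Equiv.coe_mulLeft]
    rw [hUmul, conjTranspose_mul]
    simp only [Matrix.mul_assoc]
  calc U h * twirl U Y = U h * twirl U Y * ((U h)ᴴ * U h) := by rw [hun, Matrix.mul_one]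
    _ = (U h * twirl U Y * (U h)ᴴ) * U h := by simp only [Matrix.mul_assoc]
    _ = _ := by rw [h1]

lemma twirl_trace_mul {G : Type*} [Group G] [Fintype G] {n : Type*} [Fintype n] [DecidableEq n]
    (U : G → Matrix n n ℂ) (hU : ∀ g, U g ∈ Matrix.unitaryGroup n ℂ)
    (Y P : Matrix n n ℂ) (hP : ∀ g, U g * P = P * U g) :
    (P * twirl U Y).trace = (P * Y).trace := by
  have h1 : ∀ g, (P * (U g * Y * (U g)ᴴ)).trace = (P * Y).trace := by
    intro g
    have hun : (U g)ᴴ * U g = 1 := by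
      have := Matrix.mem_unitaryGroup_iff'.mp (hU g)
      rwa [star_eq_conjTranspose] at this
    rw [← Matrix.mul_assoc, ← Matrix.mul_assoc, ← hP, Matrix.trace_mul_comm, ← Matrix.mul_assoc,
      ← Matrix.mul_assoc, hun, Matrix.one_mul]
  rw [twirl, Matrix.mul_smul, Finset.mul_sum, Matrix.trace_smul, Matrix.trace_sum,
    Finset.sum_congr rfl (fun g _ => h1 g)]
  have : (Fintype.card G : ℂ) ≠ 0 := by exact_mod_cast Fintype.card_ne_zero
  simp [this]

lemma twirl_psd {G : Type*} [Fintype G] {n : Type*} [Fintype n] [DecidableEq n]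
    (U : G → Matrix n n ℂ) (Y : Matrix n n ℂ) (hY : Y.PosSemidef) : (twirl U Y).PosSemidef := by
  have : (0 : ℂ) ≤ (Fintype.card G : ℂ)⁻¹ := by
    rw [inv_nonneg]
    exact_mod_cast Nat.zero_le _
  exact (posSemidef_sum _ fun g _ => hY.mul_mul_conjTranspose_same (U g)).smul this

lemma twirl_dom {G : Type*} [Group G] [Fintype G] {n : Type*} [Fintype n] [DecidableEq n]
    (U : G → Matrix n n ℂ) (hU1 : U 1 = 1) (Y : Matrix n n ℂ) (hY : Y.PosSemidef) :
    ((Fintype.card G : ℂ) • twirl U Y - Y).PosSemidef := by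
  classical
  have hc : (Fintype.card G : ℂ) ≠ 0 := by exact_mod_cast Fintype.card_ne_zero
  rw [twirl, smul_smul, mul_inv_cancel₀ hc, one_smul,
    ← Finset.add_sum_erase _ _ (Finset.mem_univ (1 : G)), hU1]
  simp only [Matrix.one_mul, conjTranspose_one, Matrix.mul_one, add_sub_cancel_left]
  exact posSemidef_sum _ fun g _ => hY.mul_mul_conjTranspose_same (U g)

lemma ptrace_meas {a f : Type*} [Fintype a] [Fintype f] [DecidableEq a]
    (v : a × f → ℂ) (L : Matrix f f ℂ) :
    ptraceF (((1 : Matrix a a ℂ) ⊗ₖ L) * Matrix.vecMulVec v (star v)) =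
      (Matrix.of fun i j => v (i, j)) * Lᵀ * (Matrix.of fun i j => v (i, j))ᴴ := by
  ext i k
  simp only [ptraceF, Matrix.mul_apply, Fintype.sum_prod_type, Matrix.kroneckerMap_apply,
    Matrix.vecMulVec_apply, Matrix.conjTranspose_apply, Matrix.of_apply, Matrix.transpose_apply,
    Pi.star_apply, Matrix.one_apply]
  refine Finset.sum_congr rfl fun j _ => ?_
  rw [Finset.sum_eq_single i]
  · rw [Finset.sum_mul]
    refine Finset.sum_congr rfl fun j' _ => ?_
    simp
    ring
  · intro b _ hb
    refine Finset.sum_eq_zero fun j' _ => ?_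
    rw [if_neg (Ne.symm hb)]
    simp
  · simp

lemma ptrace_pure {a f : Type*} [Fintype a] [Fintype f] [DecidableEq a] [DecidableEq f]
    (v : a × f → ℂ) :
    ptraceF (Matrix.vecMulVec v (star v)) =
      (Matrix.of fun i j => v (i, j)) * (Matrix.of fun i j => v (i, j))ᴴ := by
  have := ptrace_meas v (1 : Matrix f f ℂ)
  rwa [Matrix.one_kronecker_one, Matrix.one_mul, Matrix.transpose_one, Matrix.mul_one] at this

lemma ptrace_pure_trace {a f : Type*} [Fintype a] [Fintype f]
    (v : a × f → ℂ) (hv : ∑ p, Complex.normSq (v p) = 1) :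
    (ptraceF (Matrix.vecMulVec v (star v))).trace = 1 := by
  simp only [Matrix.trace, Matrix.diag, ptraceF, Matrix.vecMulVec_apply, Pi.star_apply,
    RCLike.star_def, Complex.mul_conj]
  rw [Fintype.sum_prod_type] at hv
  exact_mod_cast hv

/-- Proposition 4: one-shot strong converse bound for enhanced dense coding
codes with one-way LOCC decoders. -/
theorem one_shot_strong_converse_enhanced
    {G : Type*} [Group G] [Fintype G] {dA dF : ℕ}
    (U : G → Matrix (Fin dA) (Fin dA) ℂ)
    (hU : ∀ g, U g ∈ Matrix.unitaryGroup (Fin dA) ℂ)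
    (hU1 : U 1 = 1) (hUmul : ∀ g g', U (g * g') = U g * U g')
    (v : Fin dA × Fin dF → ℂ) (hv : ∑ p, Complex.normSq (v p) = 1)
    {M X : Type*} [Fintype M] [Nonempty M] [Fintype X]
    (Λ : X → Matrix (Fin dF) (Fin dF) ℂ)
    (hΛpos : ∀ x, (Λ x).PosSemidef) (hΛsum : ∑ x, Λ x = 1)
    (E : M → X → Matrix (Fin dA) (Fin dA) ℂ →ₗ[ℂ] Matrix (Fin dA) (Fin dA) ℂ)
    (hEpos : ∀ m x (Y : Matrix (Fin dA) (Fin dA) ℂ), Y.PosSemidef → (E m x Y).PosSemidef)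
    (hEtr : ∀ m x (Y : Matrix (Fin dA) (Fin dA) ℂ), (E m x Y).trace = Y.trace)
    (hEtwirl1 : ∀ m x (Y : Matrix (Fin dA) (Fin dA) ℂ), E m x (twirl U Y) = twirl U Y)
    (hEtwirl2 : ∀ m x (Y : Matrix (Fin dA) (Fin dA) ℂ), twirl U (E m x Y) = twirl U Y)
    (Γ : X → M → Matrix (Fin dA) (Fin dA) ℂ)
    (hΓpos : ∀ x m, (Γ x m).PosSemidef) (hΓsum : ∀ x, ∑ m, Γ x m = 1)
    (α : ℝ) (hα1 : 1 < α) (hα2 : α < 2) :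
    (Fintype.card M : ℝ)⁻¹ *
        ∑ m, ∑ x,
          ((Γ x m *
              E m x (ptraceF ((1 ⊗ₖ Λ x) * Matrix.vecMulVec v (star v)))).trace).re
      ≤ Real.exp (((α - 1) / α) *
          (renyiEntropy (2 - α) (twirl U (ptraceF (Matrix.vecMulVec v (star v))))
            - Real.log (Fintype.card M))) := by
  classical
  set ρ := ptraceF (Matrix.vecMulVec v (star v)) with hρdef
  set σ := twirl U ρ with hσdef
  set ρx : X → Matrix (Fin dA) (Fin dA) ℂ :=
    fun x => ptraceF ((1 ⊗ₖ Λ x) * Matrix.vecMulVec v (star v)) with hρx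
  set t := (α - 1) / α with ht
  have hα0 : 0 < α := by linarith
  have ht0 : 0 < t := div_pos (by linarith) hα0
  have ht1 : t < 1 := by rw [ht, div_lt_one hα0]; linarith
  have hMpos : (0 : ℝ) < Fintype.card M := by exact_mod_cast Fintype.card_pos
  have hMne : (Fintype.card M : ℂ) ≠ 0 := by exact_mod_cast Fintype.card_ne_zero
  have hMinv : (0 : ℂ) ≤ (Fintype.card M : ℂ)⁻¹ := by
    rw [inv_nonneg]
    exact_mod_cast Nat.zero_le _
  have hρxp : ∀ x, (ρx x).PosSemidef := by
    intro x
    simp only [hρx]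
    rw [ptrace_meas]
    exact (hΛpos x).transpose.mul_mul_conjTranspose_same _
  have hρxsum : ∑ x, ρx x = ρ := by
    simp only [hρx, ptrace_meas]
    rw [← Matrix.sum_mul, ← Matrix.mul_sum, ← Matrix.transpose_sum, hΛsum, Matrix.transpose_one,
      Matrix.mul_one, hρdef, ptrace_pure]
  have hρp : ρ.PosSemidef := by
    rw [← hρxsum]
    exact posSemidef_sum _ fun x _ => hρxp x
  have hρtr : ρ.trace = 1 := ptrace_pure_trace v hv
  have hσp : σ.PosSemidef := twirl_psd U ρ hρp
  have hσtr : σ.trace = 1 := by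
    have := twirl_trace_mul U hU ρ 1 (fun g => by simp)
    rw [Matrix.one_mul, Matrix.one_mul] at this
    rw [hσdef, this, hρtr]
  have hdom : ∀ x, ((Fintype.card G : ℂ) • σ - ρx x).PosSemidef := by
    intro x
    have h1 := twirl_dom U hU1 ρ hρp
    have h2 : (ρ - ρx x).PosSemidef := by
      rw [← hρxsum, ← Finset.add_sum_erase _ _ (Finset.mem_univ x), add_sub_cancel_left]
      exact posSemidef_sum _ fun y _ => hρxp y
    have := h1.add h2
    rwa [sub_add_sub_cancel] at this
  -- bound for each measurement outcome
  have hx : ∀ x, (Fintype.card M : ℝ)⁻¹ * ∑ m, ((Γ x m * E m x (ρx x)).trace).re ≤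
      ((Fintype.card M : ℝ)⁻¹) ^ t * (matPow σ (-t) * ρx x).trace.re := by
    intro x
    let f : Matrix (Fin dA) (Fin dA) ℂ →ₗ[ℂ] ℂ :=
      (Fintype.card M : ℂ)⁻¹ • ∑ m, (Matrix.traceLinearMap (Fin dA) ℂ ℂ) ∘ₗ
        (LinearMap.mulLeft ℂ (Γ x m)) ∘ₗ (E m x)
    have hf : ∀ Y, f Y = (Fintype.card M : ℂ)⁻¹ * ∑ m, (Γ x m * E m x Y).trace := by
      intro Y
      simp [f]
    obtain ⟨T, hT⟩ := functional_rep f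
    have hTp : T.PosSemidef := by
      refine psd_of_functional fun Y hY => ?_
      rw [← hT, hf]
      exact mul_nonneg hMinv (Finset.sum_nonneg fun m _ =>
        trace_mul_psd_nonneg (hΓpos x m) (hEpos m x Y hY))
    have hT1 : (1 - T).PosSemidef := by
      refine psd_of_functional fun Y hY => ?_
      rw [Matrix.sub_mul, Matrix.one_mul, Matrix.trace_sub, ← hT, hf]
      have h1 : ∀ m, (Γ x m * E m x Y).trace ≤ Y.trace := by
        intro m
        have h2 : (1 - Γ x m).PosSemidef := by
          rw [← hΓsum x, ← Finset.add_sum_erase _ _ (Finset.mem_univ m), add_sub_cancel_left]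
          exact posSemidef_sum _ fun y _ => hΓpos x y
        have h3 := trace_mul_psd_nonneg h2 (hEpos m x Y hY)
        rw [Matrix.sub_mul, Matrix.one_mul, Matrix.trace_sub, hEtr] at h3
        exact sub_nonneg.mp h3
      rw [sub_nonneg]
      calc (Fintype.card M : ℂ)⁻¹ * ∑ m, (Γ x m * E m x Y).trace
          ≤ (Fintype.card M : ℂ)⁻¹ * ∑ m : M, Y.trace :=
            mul_le_mul_of_nonneg_left (Finset.sum_le_sum fun m _ => h1 m) hMinv
        _ = Y.trace := by
            rw [Finset.sum_const, Finset.card_univ, nsmul_eq_mul, inv_mul_cancel_left₀ hMne]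
    have hTσ : (T * σ).trace.re ≤ (Fintype.card M : ℝ)⁻¹ := by
      rw [← hT, hf]
      have : ∑ m, (Γ x m * E m x σ).trace = 1 := by
        simp only [hσdef, hEtwirl1]
        rw [← Matrix.trace_sum, ← Finset.sum_mul, hΓsum, Matrix.one_mul]
        exact hσtr
      rw [this, mul_one]
      have h : ((Fintype.card M : ℂ))⁻¹ = (((Fintype.card M : ℝ)⁻¹ : ℝ) : ℂ) := by push_cast; rfl
      rw [h, Complex.ofReal_re]
    have hb := main_bound hσp hTp hT1 (inv_pos.mpr hMpos) ht0 ht1 hTσ (hρxp x) _ (hdom x)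
    refine le_trans (le_of_eq ?_) hb
    have h : ((Fintype.card M : ℂ))⁻¹ = (((Fintype.card M : ℝ)⁻¹ : ℝ) : ℂ) := by push_cast; rfl
    rw [← hT, hf, h, Complex.re_ofReal_mul, Complex.re_sum]
  have hH := hσp.isHermitian
  have hl0 : ∀ i, 0 ≤ hH.eigenvalues i := fun i => hσp.eigenvalues_nonneg i
  have hl1 : ∑ i, hH.eigenvalues i = 1 := by
    have := hH.trace_eq_sum_eigenvalues
    rw [hσtr] at this
    have h2 := congrArg Complex.re this
    rw [Complex.re_sum] at h2
    exact h2.symm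
  set S := (matPow σ (2 - α)).trace.re with hS
  have hSeq := trace_matPow hH (2 - α)
  have hSpos : 0 < S := by
    rw [hS, hSeq]
    have hnn : ∀ i ∈ Finset.univ, 0 ≤
        (if hH.eigenvalues i = 0 then 0 else hH.eigenvalues i ^ (2 - α)) := by
      intro i _
      split_ifs
      · exact le_rfl
      · exact Real.rpow_nonneg (hl0 i) _
    obtain ⟨i, hi⟩ : ∃ i, hH.eigenvalues i ≠ 0 := by
      by_contra hcon
      push Not at hcon
      simp [hcon] at hl1
    refine Finset.sum_pos' hnn ⟨i, Finset.mem_univ i, ?_⟩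
    rw [if_neg hi]
    exact Real.rpow_pos_of_pos (lt_of_le_of_ne (hl0 i) (Ne.symm hi)) _
  have hfin : ∑ x, (matPow σ (-t) * ρx x).trace.re ≤ S ^ (1 / α) := by
    have h1 : ∑ x, (matPow σ (-t) * ρx x).trace.re = (matPow σ (-t) * σ).trace.re := by
      rw [← Complex.re_sum, ← Matrix.trace_sum, ← Finset.mul_sum, hρxsum]
      have := twirl_trace_mul U hU ρ (matPow σ (-t))
        (fun g => matPow_comm hH (-t) (twirl_inv U hU hUmul ρ g))
      rw [← this]
    rw [h1, trace_matPow_mul hH, hS, hSeq]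
    exact jensen_bound _ hl0 hl1 hα1
  have hRHS : Real.exp (t * (renyiEntropy (2 - α) σ - Real.log (Fintype.card M))) =
      ((Fintype.card M : ℝ)⁻¹) ^ t * S ^ (1 / α) := by
    rw [renyiEntropy, ← hS, Real.inv_rpow hMpos.le, ← Real.rpow_neg hMpos.le,
      Real.rpow_def_of_pos hMpos, Real.rpow_def_of_pos hSpos, ← Real.exp_add]
    congr 1
    have : α - 1 ≠ 0 := by linarith
    have h2 : 1 - (2 - α) = α - 1 := by ring
    rw [h2, ht]
    field_simp
    ring
  rw [hRHS, Finset.sum_comm, Finset.mul_sum]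
  calc ∑ x, (Fintype.card M : ℝ)⁻¹ * ∑ m, ((Γ x m * E m x (ρx x)).trace).re
      ≤ ∑ x, ((Fintype.card M : ℝ)⁻¹) ^ t * (matPow σ (-t) * ρx x).trace.re :=
        Finset.sum_le_sum fun x _ => hx x
    _ = ((Fintype.card M : ℝ)⁻¹) ^ t * ∑ x, (matPow σ (-t) * ρx x).trace.re := by
        rw [Finset.mul_sum]
    _ ≤ _ := mul_le_mul_of_nonneg_left hfin (Real.rpow_nonneg (inv_nonneg.mpr hMpos.le) _)
end

section
/- Let Ψ_A be a density matrix on ℂ^d, let G be a finite group with a unitary representation U on ℂ^d and twirling operation 𝒢, and set σ = 𝒢(Ψ_A). Let M be a finite nonempty message set; for each m ∈ M let E^m be a positive trace-preserving linear map on d×d matrices satisfying E^m(𝒢(Y)) = 𝒢(Y) and 𝒢(E^m(Y)) = 𝒢(Y) for every d×d matrix Y; and let {Γ^m}_{m∈M} be a POVM on ℂ^d. Define the success probability s = (1/|M|) Σ_{m∈M} Re tr[Γ^m · E^m(Ψ_A)]. Then for every α ∈ (1,∞): s ≤ exp( ((α−1)/α) · ( D̃_α(Ψ_A ‖ σ)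 − log |M| ) ), where D̃_α(ρ‖σ) = (1/(α−1)) log tr[ (σ^{(1−α)/(2α)} ρ σ^{(1−α)/(2α)})^α ] is the sandwiched quantum Rényi divergence. -/
open scoped BigOperators Kronecker ComplexOrder
open Matrix

/-- Sandwiched quantum Rényi divergence
`D̃_α(ρ‖σ) = (1/(α−1)) log tr[(σ^{(1−α)/(2α)} ρ σ^{(1−α)/(2α)})^α]`. -/
noncomputable def sandwichedRenyi {ι : Type*} [Fintype ι] [DecidableEq ι]
    (α : ℝ) (ρ σ : Matrix ι ι ℂ) : ℝ :=
  (α - 1)⁻¹ *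
    Real.log
      ((matPow (matPow σ ((1 - α) / (2 * α)) * ρ * matPow σ ((1 - α) / (2 * α))) α).trace.re)


section Helpers
variable {n : Type*} [Fintype n] [DecidableEq n]

lemma os_matFun_eq (f : ℝ → ℝ) {ρ : Matrix n n ℂ} (h : ρ.IsHermitian) :
    matFun f ρ = (h.eigenvectorUnitary : Matrix n n ℂ) *
      Matrix.diagonal (fun i => (f (h.eigenvalues i) : ℂ)) *
      (h.eigenvectorUnitary : Matrix n n ℂ)ᴴ := by
  rw [matFun, dif_pos h]; rfl

lemma os_uu {ρ : Matrix n n ℂ} (h : ρ.IsHermitian) :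
    (h.eigenvectorUnitary : Matrix n n ℂ) * (h.eigenvectorUnitary : Matrix n n ℂ)ᴴ = 1 :=
  Unitary.coe_mul_star_self h.eigenvectorUnitary

lemma os_uu' {ρ : Matrix n n ℂ} (h : ρ.IsHermitian) :
    (h.eigenvectorUnitary : Matrix n n ℂ)ᴴ * (h.eigenvectorUnitary : Matrix n n ℂ) = 1 :=
  Unitary.coe_star_mul_self h.eigenvectorUnitary

lemma os_matFun_congr {f g : ℝ → ℝ} {ρ : Matrix n n ℂ} (h : ρ.PosSemidef)
    (hfg : ∀ x, 0 ≤ x → f x = g x) : matFun f ρ = matFun g ρ := by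
  rw [os_matFun_eq f h.1, os_matFun_eq g h.1]
  congr; ext i; rw [hfg _ (h.eigenvalues_nonneg i)]

lemma os_matFun_id {ρ : Matrix n n ℂ} (h : ρ.IsHermitian) : matFun (fun x => x) ρ = ρ := by
  rw [os_matFun_eq _ h]
  exact h.spectral_theorem.symm

lemma os_matFun_herm (f : ℝ → ℝ) (ρ : Matrix n n ℂ) : (matFun f ρ)ᴴ = matFun f ρ := by
  by_cases h : ρ.IsHermitian
  · rw [os_matFun_eq f h]
    simp only [conjTranspose_mul, conjTranspose_conjTranspose, diagonal_conjTranspose, mul_assoc]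
    congr; ext i; simp
  · simp [matFun, h]

lemma os_matFun_mul (f g : ℝ → ℝ) {ρ : Matrix n n ℂ} (h : ρ.IsHermitian) :
    matFun f ρ * matFun g ρ = matFun (fun x => f x * g x) ρ := by
  simp only [os_matFun_eq _ h]
  set V := (h.eigenvectorUnitary : Matrix n n ℂ) with hV
  have : ∀ D D' : Matrix n n ℂ, V * D * Vᴴ * (V * D' * Vᴴ) = V * (D * D') * Vᴴ := by
    intro D D'
    have := os_uu' h
    calc _ = V * D * (Vᴴ * V) * D' * Vᴴ := by simp only [mul_assoc]
      _ = _ := by rw [this]; simp only [mul_assoc, one_mul]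
  rw [this, diagonal_mul_diagonal]
  simp

lemma os_matPow_mul (s t : ℝ) {ρ : Matrix n n ℂ} (h : ρ.PosSemidef) :
    matPow ρ s * matPow ρ t = matPow ρ (s + t) := by
  unfold matPow
  rw [os_matFun_mul _ _ h.1]
  apply os_matFun_congr h
  intro x hx
  by_cases h0 : x = 0
  · simp [h0]
  · simp only [h0, if_false]
    rw [Real.rpow_add (lt_of_le_of_ne hx (Ne.symm h0))]

lemma os_matPow_one {ρ : Matrix n n ℂ} (h : ρ.PosSemidef) : matPow ρ 1 = ρ := by
  conv_rhs => rw [← os_matFun_id h.1]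
  unfold matPow
  apply os_matFun_congr h
  intro x hx
  by_cases h0 : x = 0 <;> simp [h0]

lemma os_matPow_herm (ρ : Matrix n n ℂ) (t : ℝ) : (matPow ρ t)ᴴ = matPow ρ t :=
  os_matFun_herm _ _

lemma os_trace_matFun (f : ℝ → ℝ) {ρ : Matrix n n ℂ} (h : ρ.IsHermitian) :
    (matFun f ρ).trace.re = ∑ i, f (h.eigenvalues i) := by
  rw [os_matFun_eq f h, trace_mul_comm, ← mul_assoc, os_uu' h, one_mul]
  simp [trace]

lemma os_trace_matPow {p : ℝ} (hp : 1 ≤ p) {ρ : Matrix n n ℂ} (h : ρ.IsHermitian) :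
    (matPow ρ p).trace.re = ∑ i, (h.eigenvalues i) ^ p := by
  unfold matPow
  rw [os_trace_matFun _ h]
  refine Finset.sum_congr rfl fun i _ => ?_
  by_cases h0 : h.eigenvalues i = 0
  · simp [h0, Real.zero_rpow (by linarith : p ≠ 0)]
  · simp [h0]

lemma os_trace_mul_nonneg {A Y : Matrix n n ℂ} (hA : A.PosSemidef) (hY : Y.PosSemidef) :
    0 ≤ (A * Y).trace := by
  have e : A = matPow A (1/2) * matPow A (1/2) := by
    rw [os_matPow_mul _ _ hA]; norm_num [os_matPow_one hA]
  rw [e, mul_assoc, trace_mul_comm]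
  have := (hY.mul_mul_conjTranspose_same (matPow A (1/2))).trace_nonneg
  rwa [os_matPow_herm] at this

lemma os_diag_entry (N : Matrix n n ℂ) (l : n → ℝ) (j : n) :
    ((N * diagonal (fun i => (l i : ℂ)) * Nᴴ) j j).re = ∑ i, ‖N j i‖ ^ 2 * l i := by
  rw [mul_apply, Complex.re_sum]
  refine Finset.sum_congr rfl fun i _ => ?_
  rw [mul_diagonal, conjTranspose_apply, mul_right_comm]
  have : N j i * star (N j i) = ((‖N j i‖ ^ 2 : ℝ) : ℂ) := by
    rw [Complex.star_def, Complex.mul_conj, Complex.normSq_eq_norm_sq]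
  rw [this, ← Complex.ofReal_mul, Complex.ofReal_re]

/-- Jensen trace inequality for contractions. -/
lemma os_jensen {p : ℝ} (hp : 1 ≤ p) {ρ : Matrix n n ℂ} (h : ρ.PosSemidef) (f : ℝ → ℝ)
    (hf : ∀ x, 0 ≤ x → 0 ≤ f x) (N : Matrix n n ℂ) (hN : (1 - N * Nᴴ).PosSemidef) :
    ∑ j, (((N * matFun f ρ * Nᴴ) j j).re) ^ p
      ≤ (N * matFun (fun x => f x ^ p) ρ * Nᴴ).trace.re := by
  rw [trace, Complex.re_sum]
  refine Finset.sum_le_sum fun j _ => ?_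
  have key : ∀ g : ℝ → ℝ, ((N * matFun g ρ * Nᴴ) j j).re
      = ∑ i, ‖(N * (h.1.eigenvectorUnitary : Matrix n n ℂ)) j i‖ ^ 2 * g (h.1.eigenvalues i) := by
    intro g
    rw [← os_diag_entry, os_matFun_eq g h.1, conjTranspose_mul]
    simp only [mul_assoc]
  rw [diag_apply, key, key]
  set w := fun i => ‖(N * (h.1.eigenvectorUnitary : Matrix n n ℂ)) j i‖ ^ 2 with hw
  set l := h.1.eigenvalues
  have hl : ∀ i, 0 ≤ f (l i) := fun i => hf _ (h.eigenvalues_nonneg i)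
  have hw0 : ∀ i, 0 ≤ w i := fun i => by positivity
  have hw1 : ∑ i, w i ≤ 1 := by
    have h1 := key (fun _ => 1)
    have h2 : matFun (fun _ => (1:ℝ)) ρ = 1 := by
      rw [os_matFun_eq _ h.1]; simp [os_uu h.1]
    rw [h2] at h1
    have h3 := hN.diag_nonneg (i := j)
    have h4 := (Complex.le_def.1 h3).1
    simp at h1 h4
    simp only [hw]; linarith
  have h5 := Real.inner_le_weight_mul_Lp_of_nonneg Finset.univ hp w (fun i => f (l i)) hw0 hl
  have hS : 0 ≤ ∑ i, w i * f (l i) ^ p :=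
    Finset.sum_nonneg fun i _ => mul_nonneg (hw0 i) (Real.rpow_nonneg (hl i) _)
  have h6 : (∑ i, w i) ^ (1 - p⁻¹) ≤ 1 :=
    Real.rpow_le_one (Finset.sum_nonneg fun i _ => hw0 i) hw1
      (by rw [sub_nonneg]; exact inv_le_one_of_one_le₀ hp)
  have h7 : ∑ i, w i * f (l i) ≤ (∑ i, w i * f (l i) ^ p) ^ p⁻¹ :=
    h5.trans (mul_le_of_le_one_left (Real.rpow_nonneg hS _) h6)
  calc _ ≤ ((∑ i, w i * f (l i) ^ p) ^ p⁻¹) ^ p :=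
        Real.rpow_le_rpow (Finset.sum_nonneg fun i _ => mul_nonneg (hw0 i) (hl i)) h7 (by linarith)
    _ = _ := Real.rpow_inv_rpow hS (by linarith)

lemma os_holder {a p : ℝ} (hap : a.HolderConjugate p) {X C : Matrix n n ℂ}
    (hX : X.PosSemidef) (hC : C.PosSemidef) :
    (X * C).trace.re ≤ ((matPow X a).trace.re) ^ (1 / a) * ((matPow C p).trace.re) ^ (1 / p) := by
  have ha : 1 ≤ a := hap.lt.le
  have hp : 1 ≤ p := hap.symm.lt.le
  set W := (hX.1.eigenvectorUnitary : Matrix n n ℂ) with hW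
  set c := fun i => ((Wᴴ * C * W) i i).re with hc
  have h1 : (X * C).trace.re = ∑ i, hX.1.eigenvalues i * c i := by
    conv_lhs => rw [← os_matFun_id hX.1, os_matFun_eq _ hX.1]
    rw [mul_assoc, mul_assoc, trace_mul_comm, mul_assoc, trace, Complex.re_sum]
    refine Finset.sum_congr rfl fun i _ => ?_
    rw [diag_apply, diagonal_mul, Complex.re_ofReal_mul]
  have hc0 : ∀ i, 0 ≤ c i := fun i =>
    (Complex.le_def.1 (hC.conjTranspose_mul_mul_same W).diag_nonneg).1
  have h2 : ∑ i, c i ^ p ≤ (matPow C p).trace.re := by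
    have hN : (1 - Wᴴ * Wᴴᴴ).PosSemidef := by
      rw [conjTranspose_conjTranspose, os_uu' hX.1, sub_self]; exact PosSemidef.zero
    have := os_jensen hp hC (fun x => x) (fun _ h => h) Wᴴ hN
    rw [conjTranspose_conjTranspose, os_matFun_id hC.1] at this
    refine this.trans (le_of_eq ?_)
    rw [mul_assoc, trace_mul_comm, mul_assoc, os_uu hX.1, mul_one, os_trace_matPow hp hC.1,
      os_trace_matFun _ hC.1]
  rw [h1, os_trace_matPow ha hX.1]
  refine (Real.inner_le_Lp_mul_Lq_of_nonneg Finset.univ hap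
    (fun i _ => hX.eigenvalues_nonneg i) (fun i _ => hc0 i)).trans ?_
  have hp0 : 0 ≤ 1 / p := by positivity
  refine mul_le_mul_of_nonneg_left (Real.rpow_le_rpow ?_ h2 hp0) ?_
  · exact Finset.sum_nonneg fun i _ => Real.rpow_nonneg (hc0 i) _
  · exact Real.rpow_nonneg (Finset.sum_nonneg fun i _ =>
      Real.rpow_nonneg (hX.eigenvalues_nonneg i) _) _

lemma os_trace_swap {p : ℝ} (hp : 1 ≤ p) (D : Matrix n n ℂ) :
    (matPow (Dᴴ * D) p).trace.re = (matPow (D * Dᴴ) p).trace.re := by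
  have h1 := (posSemidef_conjTranspose_mul_self D).1
  have h2 := (posSemidef_self_mul_conjTranspose D).1
  rw [os_trace_matPow hp h1, os_trace_matPow hp h2,
    (IsHermitian.eigenvalues_eq_eigenvalues_iff h1 h2).2 (charpoly_mul_comm _ _)]

/-- `tr (S A S)^p ≤ tr A σ` for `S = σ^{1/2p}` and `0 ≤ A ≤ 1`. -/
lemma os_alt {p : ℝ} (hp : 1 ≤ p) {A σ : Matrix n n ℂ} (hA : A.PosSemidef)
    (hA1 : (1 - A).PosSemidef) (hσ : σ.PosSemidef) :
    (matPow (matPow σ (1 / (2 * p)) * A * matPow σ (1 / (2 * p))) p).trace.re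
      ≤ (A * σ).trace.re := by
  have hp0 : p ≠ 0 := by linarith
  set S := matPow σ (1 / (2 * p)) with hS
  set B := matPow A (1/2) with hB
  have hBB : B * B = A := by
    rw [hB, os_matPow_mul _ _ hA]; norm_num [os_matPow_one hA]
  have hBh : Bᴴ = B := os_matPow_herm _ _
  have hSh : Sᴴ = S := os_matPow_herm _ _
  have hSS : S * S = matPow σ (1 / p) := by
    rw [hS, os_matPow_mul _ _ hσ]; congr 1; field_simp; norm_num
  have e1 : S * A * S = (B * S)ᴴ * (B * S) := by
    rw [conjTranspose_mul, hBh, hSh, ← hBB]; simp only [mul_assoc]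
  have e2 : (B * S) * (B * S)ᴴ = B * matPow σ (1 / p) * Bᴴ := by
    rw [conjTranspose_mul, hBh, hSh, ← hSS]; simp only [mul_assoc]
  have hK := posSemidef_self_mul_conjTranspose (B * S)
  rw [e1, os_trace_swap hp, e2]
  rw [e2] at hK
  rw [os_trace_matPow hp hK.1]
  set K := B * matPow σ (1 / p) * Bᴴ with hKd
  set W := (hK.1.eigenvectorUnitary : Matrix n n ℂ) with hW
  have hdiag : Wᴴ * K * W = diagonal (fun i => (hK.1.eigenvalues i : ℂ)) := by
    have := os_matFun_eq (fun x => x) hK.1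
    rw [os_matFun_id hK.1] at this
    calc Wᴴ * K * W = Wᴴ * (W * diagonal (fun i => (hK.1.eigenvalues i : ℂ)) * Wᴴ) * W := by
          rw [← this]
      _ = (Wᴴ * W) * diagonal (fun i => (hK.1.eigenvalues i : ℂ)) * (Wᴴ * W) := by
          simp only [mul_assoc]
      _ = _ := by rw [os_uu' hK.1, one_mul, mul_one]
  have hN : (1 - (Wᴴ * B) * (Wᴴ * B)ᴴ).PosSemidef := by
    have := hA1.conjTranspose_mul_mul_same W
    rw [mul_sub, sub_mul, mul_one, os_uu' hK.1] at this
    rw [conjTranspose_mul, hBh, conjTranspose_conjTranspose]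
    rwa [← hBB, show Wᴴ * (B * B) * W = Wᴴ * B * (B * W) by simp only [mul_assoc]] at this
  have hJ := os_jensen hp hσ (fun x => if x = 0 then 0 else x ^ (1 / p))
    (fun x hx => by
      by_cases h0 : x = 0
      · simp [h0]
      · simp only [h0, if_false]; exact Real.rpow_nonneg hx _) (Wᴴ * B) hN
  have e3 : matFun (fun x => (if x = 0 then 0 else x ^ (1 / p)) ^ p) σ = σ := by
    conv_rhs => rw [← os_matFun_id hσ.1]
    apply os_matFun_congr hσ
    intro x hx
    by_cases h0 : x = 0
    · simp [h0, Real.zero_rpow hp0]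
    · simp only [h0, if_false]
      rw [one_div, Real.rpow_inv_rpow hx hp0]
  rw [e3] at hJ
  have e4 : (Wᴴ * B) * matFun (fun x => if x = 0 then 0 else x ^ (1 / p)) σ * (Wᴴ * B)ᴴ
      = diagonal (fun i => (hK.1.eigenvalues i : ℂ)) := by
    rw [← hdiag, hKd, conjTranspose_mul, conjTranspose_conjTranspose]
    simp only [mul_assoc]; rfl
  rw [e4] at hJ
  simp only [diagonal_apply_eq, Complex.ofReal_re] at hJ
  refine hJ.trans (le_of_eq ?_)
  rw [conjTranspose_mul, conjTranspose_conjTranspose, hBh]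
  congr 1
  calc (Wᴴ * B * σ * (B * W)).trace = (Wᴴ * (B * σ * B * W)).trace := by simp only [mul_assoc]
    _ = (B * σ * B * (W * Wᴴ)).trace := by rw [trace_mul_comm]; simp only [mul_assoc]
    _ = (B * (B * σ)).trace := by rw [os_uu hK.1, mul_one, trace_mul_comm]
    _ = _ := by rw [← mul_assoc, hBB]

lemma os_mul_eq_zero {Y Q : Matrix n n ℂ} (hY : Y.PosSemidef) (h : Qᴴ * Y * Q = 0) :
    Y * Q = 0 := by
  have e : Y = matPow Y (1/2) * matPow Y (1/2) := by
    rw [os_matPow_mul _ _ hY]; norm_num [os_matPow_one hY]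
  have h2 : (matPow Y (1/2) * Q)ᴴ * (matPow Y (1/2) * Q) = 0 := by
    rw [conjTranspose_mul, os_matPow_herm, ← h]
    conv_rhs => rw [e]
    simp only [mul_assoc]
  have h3 := conjTranspose_mul_self_eq_zero.1 h2
  rw [e, mul_assoc, h3, mul_zero]

lemma os_support {Y σ : Matrix n n ℂ} (hY : Y.PosSemidef) (hσ : σ.PosSemidef)
    (hle : (σ - Y).PosSemidef) : Y * matPow σ 0 = Y := by
  set Q := 1 - matPow σ 0 with hQ
  have hQh : Qᴴ = Q := by rw [hQ, conjTranspose_sub, os_matPow_herm, conjTranspose_one]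
  have hσQ : σ * Q = 0 := by
    rw [hQ, mul_sub, mul_one]
    nth_rw 2 [← os_matPow_one hσ]
    rw [os_matPow_mul _ _ hσ, add_zero, os_matPow_one hσ, sub_self]
  have h1 := hle.conjTranspose_mul_mul_same Q
  have e1 : Qᴴ * (σ - Y) * Q = -(Qᴴ * Y * Q) := by
    calc Qᴴ * (σ - Y) * Q = Qᴴ * (σ * Q) - Qᴴ * Y * Q := by noncomm_ring
      _ = _ := by rw [hσQ, mul_zero, zero_sub]
  rw [e1] at h1
  have h2 := hY.conjTranspose_mul_mul_same Q
  have h3 : (Qᴴ * Y * Q).trace = 0 := by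
    apply le_antisymm _ h2.trace_nonneg
    have := h1.trace_nonneg
    rwa [trace_neg, neg_nonneg] at this
  have h4 := os_mul_eq_zero hY (h2.trace_eq_zero_iff.1 h3)
  rw [hQ, mul_sub, mul_one, sub_eq_zero] at h4
  exact h4.symm

/-- Core inequality. -/
lemma os_core {a p : ℝ} (hap : a.HolderConjugate p) {A σ Y : Matrix n n ℂ} (hA : A.PosSemidef)
    (hA1 : (1 - A).PosSemidef) (hσ : σ.PosSemidef) (hY : Y.PosSemidef)
    (hsup : Y * matPow σ 0 = Y) :
    (A * Y).trace.re ≤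
      ((matPow (matPow σ (-(1 / (2 * p))) * Y * matPow σ (-(1 / (2 * p)))) a).trace.re) ^ (1 / a)
        * ((A * σ).trace.re) ^ (1 / p) := by
  set S := matPow σ (1 / (2 * p)) with hS
  set T := matPow σ (-(1 / (2 * p))) with hT
  have hp : 1 ≤ p := hap.symm.lt.le
  have hTh : Tᴴ = T := os_matPow_herm _ _
  have hSh : Sᴴ = S := os_matPow_herm _ _
  have hX : (T * Y * T).PosSemidef := by
    have := hY.mul_mul_conjTranspose_same T
    rwa [hTh] at this
  have hC : (S * A * S).PosSemidef := by
    have := hA.mul_mul_conjTranspose_same S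
    rwa [hSh] at this
  have hTS : T * S = matPow σ 0 := by rw [hT, hS, os_matPow_mul _ _ hσ]; simp
  have hST : S * T = matPow σ 0 := by rw [hT, hS, os_matPow_mul _ _ hσ]; simp
  have hsup' : matPow σ 0 * Y = Y := by
    have := congrArg conjTranspose hsup
    rwa [conjTranspose_mul, os_matPow_herm, hY.1.eq] at this
  have e : (A * Y).trace = ((T * Y * T) * (S * A * S)).trace := by
    calc (A * Y).trace = (A * (S * T * Y * (T * S))).trace := by rw [hST, hTS, hsup', hsup]
      _ = ((A * S) * (T * Y * T * S)).trace := by simp only [mul_assoc]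
      _ = _ := by rw [trace_mul_comm]; simp only [mul_assoc]
  rw [e]
  refine (os_holder hap hX hC).trans ?_
  have hp0 : 0 ≤ 1 / p := by positivity
  refine mul_le_mul_of_nonneg_left (Real.rpow_le_rpow ?_ (os_alt hp hA hA1 hσ) hp0) ?_
  · rw [os_trace_matPow hp hC.1]
    exact Finset.sum_nonneg fun i _ => Real.rpow_nonneg (hC.eigenvalues_nonneg i) _
  · rw [os_trace_matPow hap.lt.le hX.1]
    exact Real.rpow_nonneg (Finset.sum_nonneg fun i _ =>
      Real.rpow_nonneg (hX.eigenvalues_nonneg i) _) _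

lemma os_posSemidef_of_trace {A : Matrix n n ℂ}
    (h : ∀ Y : Matrix n n ℂ, Y.PosSemidef → 0 ≤ (A * Y).trace) : A.PosSemidef := by
  rw [← Matrix.isPositive_toEuclideanLin_iff, LinearMap.isPositive_iff_complex]
  intro x
  have h1 := h _ (posSemidef_vecMulVec_self_star (x.ofLp))
  have h2 : (A * vecMulVec x.ofLp (star x.ofLp)).trace
      = star (inner ℂ (A.toEuclideanLin x) x) := by
    rw [mul_vecMulVec, trace_vecMulVec, EuclideanSpace.inner_eq_star_dotProduct]
    simp [dotProduct, mul_comm]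
  rw [h2] at h1
  generalize inner ℂ (A.toEuclideanLin x) x = z at h1
  obtain ⟨h3, h4⟩ := Complex.le_def.1 h1
  simp only [Complex.star_def, Complex.conj_re, Complex.conj_im, Complex.zero_re,
    Complex.zero_im] at h3 h4
  refine ⟨?_, h3⟩
  apply Complex.ext
  · simp
  · simp; linarith

/-- Riesz representation of a linear functional through the trace. -/
lemma os_riesz (φ : Matrix n n ℂ →ₗ[ℂ] ℂ) : ∃ A : Matrix n n ℂ, ∀ Y, (A * Y).trace = φ Y := by
  refine ⟨Matrix.of fun i j => φ (Matrix.single j i 1), fun Y => ?_⟩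
  conv_rhs => rw [matrix_eq_sum_single Y]
  simp only [map_sum]
  rw [trace, Finset.sum_comm]
  refine Finset.sum_congr rfl fun i _ => ?_
  rw [diag_apply, mul_apply]
  refine Finset.sum_congr rfl fun j _ => ?_
  have : single j i (Y j i) = Y j i • single j i (1:ℂ) := by simp
  rw [this, map_smul, of_apply, smul_eq_mul, mul_comm]

end Helpers

/-- Proposition 5: one-shot strong converse bound for dense coding codes with
super-quantum (positive-map) encoders and local decoders. -/
theorem one_shot_strong_converse_local
    {G : Type*} [Group G] [Fintype G] {d : ℕ}
    (U : G → Matrix (Fin d) (Fin d) ℂ)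
    (hU : ∀ g, U g ∈ Matrix.unitaryGroup (Fin d) ℂ)
    (hU1 : U 1 = 1) (hUmul : ∀ g g', U (g * g') = U g * U g')
    (Ψ : Matrix (Fin d) (Fin d) ℂ) (hΨ : Ψ.PosSemidef) (hΨtr : Ψ.trace = 1)
    {M : Type*} [Fintype M] [Nonempty M]
    (E : M → Matrix (Fin d) (Fin d) ℂ →ₗ[ℂ] Matrix (Fin d) (Fin d) ℂ)
    (hEpos : ∀ m (Y : Matrix (Fin d) (Fin d) ℂ), Y.PosSemidef → (E m Y).PosSemidef)
    (hEtr : ∀ m (Y : Matrix (Fin d) (Fin d) ℂ), (E m Y).trace = Y.trace)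
    (hEtwirl1 : ∀ m (Y : Matrix (Fin d) (Fin d) ℂ), E m (twirl U Y) = twirl U Y)
    (hEtwirl2 : ∀ m (Y : Matrix (Fin d) (Fin d) ℂ), twirl U (E m Y) = twirl U Y)
    (Γ : M → Matrix (Fin d) (Fin d) ℂ)
    (hΓpos : ∀ m, (Γ m).PosSemidef) (hΓsum : ∑ m, Γ m = 1)
    (α : ℝ) (hα : 1 < α) :
    (Fintype.card M : ℝ)⁻¹ * ∑ m, ((Γ m * E m Ψ).trace).re
      ≤ Real.exp (((α - 1) / α) *
          (sandwichedRenyi α Ψ (twirl U Ψ) - Real.log (Fintype.card M))) := by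
  classical
  set σ := twirl U Ψ with hσd
  have hcG : (0:ℝ) < Fintype.card G := by exact_mod_cast Fintype.card_pos
  have hcM : (0:ℝ) < Fintype.card M := by exact_mod_cast Fintype.card_pos
  have hterm : ∀ g, (U g * Ψ * (U g)ᴴ).PosSemidef := fun g => hΨ.mul_mul_conjTranspose_same _
  have hcG' : (0:ℂ) ≤ (Fintype.card G : ℂ)⁻¹ := by
    have : ((Fintype.card G : ℂ))⁻¹ = (((Fintype.card G : ℝ)⁻¹ : ℝ) : ℂ) := by push_cast; rfl
    rw [this]; exact_mod_cast (inv_pos.2 hcG).le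
  have hσ : σ.PosSemidef := (posSemidef_sum _ fun g _ => hterm g).smul hcG'
  have hσtr : σ.trace = 1 := by
    rw [hσd, twirl, trace_smul, trace_sum]
    have : ∀ g, (U g * Ψ * (U g)ᴴ).trace = 1 := by
      intro g
      have h1 : (U g)ᴴ * U g = 1 := (Unitary.mem_iff.1 (hU g)).1
      rw [trace_mul_comm, ← mul_assoc, h1, one_mul, hΨtr]
    have hne : (Fintype.card G : ℂ) ≠ 0 := by exact_mod_cast hcG.ne'
    simp [this, hne]
  -- support condition
  have hsup : Ψ * matPow σ 0 = Ψ := by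
    have hY : ((Fintype.card G : ℂ)⁻¹ • Ψ).PosSemidef := hΨ.smul hcG'
    have hle : (σ - (Fintype.card G : ℂ)⁻¹ • Ψ).PosSemidef := by
      have : σ - (Fintype.card G : ℂ)⁻¹ • Ψ
          = (Fintype.card G : ℂ)⁻¹ • ∑ g ∈ Finset.univ.erase 1, U g * Ψ * (U g)ᴴ := by
        rw [hσd, twirl, ← smul_sub, ← Finset.sum_erase_add _ _ (Finset.mem_univ (1:G)), hU1]
        simp
      rw [this]
      exact (posSemidef_sum _ fun g _ => hterm g).smul hcG'
    have := os_support hY hσ hle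
    rw [smul_mul_assoc] at this
    have hne : (Fintype.card G : ℂ)⁻¹ ≠ 0 := by
      have : (Fintype.card G : ℂ) ≠ 0 := by exact_mod_cast hcG.ne'
      exact inv_ne_zero this
    exact smul_right_injective _ hne this
  -- Heisenberg dual
  set c : ℂ := (Fintype.card M : ℂ)⁻¹ with hc
  have hcr : c = (((Fintype.card M : ℝ)⁻¹ : ℝ) : ℂ) := by rw [hc]; push_cast; rfl
  have hc0 : (0:ℂ) ≤ c := by rw [hcr]; exact_mod_cast (inv_pos.2 hcM).le
  have hcM1 : c * (Fintype.card M : ℂ) = 1 := by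
    have : (Fintype.card M : ℂ) ≠ 0 := by exact_mod_cast hcM.ne'
    rw [hc]; field_simp
  obtain ⟨A, hA⟩ := os_riesz (c • ∑ m, (Matrix.traceLinearMap (Fin d) ℂ ℂ) ∘ₗ
    (LinearMap.mulLeft ℂ (Γ m)) ∘ₗ (E m))
  have hA : ∀ Y, (A * Y).trace = c * ∑ m, (Γ m * E m Y).trace := by
    intro Y; rw [hA Y]; simp
  have hApos : A.PosSemidef := by
    apply os_posSemidef_of_trace
    intro Y hY
    rw [hA]
    exact mul_nonneg hc0 (Finset.sum_nonneg fun m _ =>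
      os_trace_mul_nonneg (hΓpos m) (hEpos m Y hY))
  have hΓ1 : ∀ m, (1 - Γ m).PosSemidef := by
    intro m
    rw [← hΓsum, ← Finset.sum_erase_add _ _ (Finset.mem_univ m), add_sub_cancel_right]
    exact posSemidef_sum _ fun g _ => hΓpos g
  have hA1 : (1 - A).PosSemidef := by
    apply os_posSemidef_of_trace
    intro Y hY
    have : ((1 - A) * Y).trace = c * ∑ m, ((1 - Γ m) * E m Y).trace := by
      simp only [sub_mul, one_mul, trace_sub, hA, hEtr, Finset.sum_sub_distrib, mul_sub]
      simp only [Finset.sum_const, Finset.card_univ, nsmul_eq_mul]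
      rw [← mul_assoc, hcM1, one_mul]
    rw [this]
    exact mul_nonneg hc0 (Finset.sum_nonneg fun m _ =>
      os_trace_mul_nonneg (hΓ1 m) (hEpos m Y hY))
  have hAσ : (A * σ).trace.re = (Fintype.card M : ℝ)⁻¹ := by
    have : (A * σ).trace = c := by
      rw [hA]
      have : ∀ m, E m σ = σ := fun m => hEtwirl1 m Ψ
      simp only [this]
      rw [← trace_sum, ← Finset.sum_mul, hΓsum, one_mul, hσtr, mul_one]
    rw [this, hcr, Complex.ofReal_re]
  have hAΨ : (A * Ψ).trace.re = (Fintype.card M : ℝ)⁻¹ * ∑ m, ((Γ m * E m Ψ).trace).re := by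
    rw [hA, hcr, Complex.re_ofReal_mul, Complex.re_sum]
  have hα0 : 0 < α := by linarith
  have hα1 : 0 < α - 1 := by linarith
  have hap : α.HolderConjugate (α / (α - 1)) := Real.HolderConjugate.conjExponent hα
  have hexp : -(1 / (2 * (α / (α - 1)))) = (1 - α) / (2 * α) := by field_simp; ring
  have hcore := os_core hap hApos hA1 hσ hΨ hsup
  rw [hexp, hAσ, hAΨ] at hcore
  refine hcore.trans (le_of_eq ?_)
  rw [sandwichedRenyi]
  set T := matPow σ ((1 - α) / (2 * α)) with hT
  have hTh : Tᴴ = T := os_matPow_herm _ _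
  have hX : (T * Ψ * T).PosSemidef := by
    have := hΨ.mul_mul_conjTranspose_same T
    rwa [hTh] at this
  have htpos : 0 < (matPow (T * Ψ * T) α).trace.re := by
    rw [os_trace_matPow hα.le hX.1]
    have hnn : ∀ i ∈ Finset.univ, 0 ≤ hX.1.eigenvalues i ^ α := fun i _ =>
      Real.rpow_nonneg (hX.eigenvalues_nonneg i) _
    refine lt_of_le_of_ne (Finset.sum_nonneg hnn) fun h0 => ?_
    have hz := (Finset.sum_eq_zero_iff_of_nonneg hnn).1 h0.symm
    have hX0 : T * Ψ * T = 0 := by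
      rw [← hX.1.eigenvalues_eq_zero_iff]
      ext i
      exact ((Real.rpow_eq_zero (hX.eigenvalues_nonneg i) hα0.ne').1 (hz i (Finset.mem_univ i)))
    have hΨT : Ψ * T = 0 := os_mul_eq_zero hΨ (by rw [hTh, hX0])
    have hΨ0 : Ψ = 0 := by
      rw [← hsup]
      have : matPow σ 0 = T * matPow σ (-((1 - α) / (2 * α))) := by
        rw [hT, os_matPow_mul _ _ hσ]; simp
      rw [this, ← mul_assoc, hΨT, zero_mul]
    rw [hΨ0, trace_zero] at hΨtr
    exact zero_ne_one hΨtr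
  rw [Real.rpow_def_of_pos htpos, Real.rpow_def_of_pos (inv_pos.2 hcM), ← Real.exp_add,
    Real.log_inv]
  congr 1
  field_simp
  ring
end

section
/- Let N, T, L ≥ 1 be natural numbers with N = T · L. Let Ω be a finite nonempty set of functions f : Fin N → Fin T such that (i) for every f ∈ Ω and every t ∈ Fin T the fiber f⁻¹(t) has exactly L elements, and (ii) for all n ≠ n' in Fin N, the fraction of f ∈ Ω with f(n) = f(n') is at most 1/T (the 2-universal hashing property). Let ρ : Fin N → (d×d matrices) be a family of positive semidefinite matrices and ρ̄ = (1/N) Σ_n ρ_n. Then for every s ∈ (0,1]: (1/|Ω|) Σ_{f∈Ω} (1/T) Σ_{t∈Fin T} tr[ ((1/L) Σ_{n : f(n)=t} ρ_n)^{1+s} ] ≤ (1/L^s) · (1/N) Σ_{n∈Fin N} tr[ρ_n^{1+s}] + tr[ρ̄^{1+s}]. -/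
open scoped BigOperators Kronecker ComplexOrder
open Matrix

section HashAuxSection
open scoped MatrixOrder Matrix.Norms.L2Operator NNReal

namespace HashAux
variable {d : ℕ}

lemma trace_mul_nonneg {A B : Matrix (Fin d) (Fin d) ℂ} (hA : 0 ≤ A) (hB : 0 ≤ B) :
    0 ≤ ((A * B).trace).re := by
  have hK : (CFC.sqrt A) * (CFC.sqrt A) = A := CFC.sqrt_mul_sqrt_self A hA
  have hKh : (CFC.sqrt A)ᴴ = CFC.sqrt A := (nonneg_iff_posSemidef.1 (CFC.sqrt_nonneg A)).1
  have h := ((nonneg_iff_posSemidef.1 hB).conjTranspose_mul_mul_same (CFC.sqrt A)).trace_nonneg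
  rw [hKh, Matrix.trace_mul_cycle, hK] at h
  exact (Complex.le_def.1 h).1

lemma trace_mul_mono {A B C : Matrix (Fin d) (Fin d) ℂ} (hA : 0 ≤ A) (hB : B ≤ C) :
    ((A * B).trace).re ≤ ((A * C).trace).re := by
  have := trace_mul_nonneg hA (sub_nonneg.2 hB)
  rw [mul_sub, trace_sub, Complex.sub_re] at this
  linarith

lemma posDef_add (t : ℝ) (ht : 0 < t) {A : Matrix (Fin d) (Fin d) ℂ} (hA : 0 ≤ A) :
    (t • (1 : Matrix (Fin d) (Fin d) ℂ) + A).PosDef :=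
  ((PosDef.one (n := Fin d) (R := ℂ)).smul ht).add_posSemidef (nonneg_iff_posSemidef.1 hA)

/-- Woodbury -/
lemma woodbury {K P R M : Matrix (Fin d) (Fin d) ℂ} (hP : M * P = 1)
    (hR : (M + K * K) * R = 1) : (1 + K * P * K) * (1 - K * R * K) = 1 := by
  have hP' : P * M = 1 := mul_eq_one_comm.1 hP
  have h1 : P = R + P * (K * K) * R := by
    calc P = P * ((M + K * K) * R) := by rw [hR, mul_one]
      _ = (P * M) * R + P * (K * K) * R := by noncomm_ring
      _ = _ := by rw [hP', one_mul]
  calc _ = 1 + K * (P - (R + P * (K * K) * R)) * K := by noncomm_ring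
    _ = 1 := by rw [← h1]; simp

lemma le_inv_scalar (t : ℝ) (ht : 0 < t) {B P : Matrix (Fin d) (Fin d) ℂ} (hB : 0 ≤ B)
    (hP : (t • (1 : Matrix (Fin d) (Fin d) ℂ) + B) * P = 1) (hPh : Pᴴ = P) :
    0 ≤ t⁻¹ • (1 : Matrix (Fin d) (Fin d) ℂ) - P := by
  have hP' : P * (t • (1 : Matrix (Fin d) (Fin d) ℂ) + B) = 1 := mul_eq_one_comm.1 hP
  have hBh : Bᴴ = B := (nonneg_iff_posSemidef.1 hB).1
  have h : 0 ≤ Pᴴ * (B + t⁻¹ • (Bᴴ * B)) * P := by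
    refine nonneg_iff_posSemidef.2 (PosSemidef.conjTranspose_mul_mul_same ?_ P)
    exact (nonneg_iff_posSemidef.1 hB).add
      ((posSemidef_conjTranspose_mul_self B).smul (inv_nonneg.2 ht.le))
  convert h using 1
  rw [hPh, hBh]
  have e : B + t⁻¹ • (B * B) = t⁻¹ • ((t • (1 : Matrix (Fin d) (Fin d) ℂ) + B) * (t • (1 : Matrix (Fin d) (Fin d) ℂ) + B)) - (t • (1 : Matrix (Fin d) (Fin d) ℂ) + B) := by
    simp only [mul_add, add_mul, smul_mul_assoc, mul_smul_comm, one_mul, mul_one, smul_add, smul_smul, inv_mul_cancel₀ ht.ne', one_smul, ← mul_assoc]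
    abel_nf
  rw [e]
  generalize (t • (1 : Matrix (Fin d) (Fin d) ℂ) + B) = M at *
  rw [mul_sub, sub_mul, hP', one_mul, mul_smul_comm, smul_mul_assoc, ← mul_assoc, hP', one_mul, hP]

lemma key_resolvent (t : ℝ) (ht : 0 < t) {A B : Matrix (Fin d) (Fin d) ℂ} (hA : 0 ≤ A)
    (hB : 0 ≤ B) :
    0 ≤ ((A * (t⁻¹ • (1 : Matrix (Fin d) (Fin d) ℂ)
      - (t • (1 : Matrix (Fin d) (Fin d) ℂ) + B)⁻¹
      - (t • (1 : Matrix (Fin d) (Fin d) ℂ) + A)⁻¹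
      + (t • (1 : Matrix (Fin d) (Fin d) ℂ) + (A + B))⁻¹)).trace).re := by
  have dP := posDef_add t ht hB
  have dS := posDef_add t ht hA
  have dR := posDef_add t ht (add_nonneg hA hB)
  have hP := mul_nonsing_inv _ ((isUnit_iff_isUnit_det _).1 dP.isUnit)
  have hS := mul_nonsing_inv _ ((isUnit_iff_isUnit_det _).1 dS.isUnit)
  have hR := mul_nonsing_inv _ ((isUnit_iff_isUnit_det _).1 dR.isUnit)
  have hPn := dP.inv.posSemidef
  have hSh := dS.inv.1
  have hRh := dR.inv.1
  set P := (t • (1 : Matrix (Fin d) (Fin d) ℂ) + B)⁻¹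
  set S := (t • (1 : Matrix (Fin d) (Fin d) ℂ) + A)⁻¹
  set R := (t • (1 : Matrix (Fin d) (Fin d) ℂ) + (A + B))⁻¹
  have hDP := le_inv_scalar t ht hB hP hPn.1
  have hK : (CFC.sqrt A) * (CFC.sqrt A) = A := CFC.sqrt_mul_sqrt_self A hA
  have hKh : (CFC.sqrt A)ᴴ = CFC.sqrt A := (nonneg_iff_posSemidef.1 (CFC.sqrt_nonneg A)).1
  set K := CFC.sqrt A
  have hZ : (1 + K * P * K) * (1 - K * R * K) = 1 := by
    refine woodbury hP ?_
    rw [hK, add_assoc, add_comm B A, hR]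
  have hW : (1 + K * (t⁻¹ • (1 : Matrix (Fin d) (Fin d) ℂ)) * K) * (1 - K * S * K) = 1 := by
    refine woodbury (M := t • (1 : Matrix (Fin d) (Fin d) ℂ)) ?_ ?_
    · simp [smul_smul, ht.ne']
    · rw [hK, hS]
  have hZ' := mul_eq_one_comm.1 hZ
  have hW' := mul_eq_one_comm.1 hW
  have hX : (K * P * K).PosSemidef := by
    have := hPn.conjTranspose_mul_mul_same K
    rwa [hKh] at this
  have hY : (K * (t⁻¹ • (1 : Matrix (Fin d) (Fin d) ℂ)) * K).PosSemidef := by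
    have := (PosSemidef.one.smul (inv_nonneg.2 ht.le) : (t⁻¹ • (1 : Matrix (Fin d) (Fin d) ℂ)).PosSemidef).conjTranspose_mul_mul_same K
    rwa [hKh] at this
  have hD : (K * (t⁻¹ • (1 : Matrix (Fin d) (Fin d) ℂ)) * K - K * P * K).PosSemidef := by
    have := (nonneg_iff_posSemidef.1 hDP).conjTranspose_mul_mul_same K
    rwa [hKh, mul_sub, sub_mul] at this
  have hZh : (1 - K * R * K)ᴴ = 1 - K * R * K := by
    simp [conjTranspose_mul, hKh, hRh.eq, mul_assoc]
  have hWh : (1 - K * S * K)ᴴ = 1 - K * S * K := by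
    simp [conjTranspose_mul, hKh, hSh.eq, mul_assoc]
  have goal_eq : ((A * (t⁻¹ • (1 : Matrix (Fin d) (Fin d) ℂ) - P - S + R)).trace) =
      ((K * (t⁻¹ • (1 : Matrix (Fin d) (Fin d) ℂ)) * K - K * P * K) + ((1 - K * S * K) - (1 - K * R * K))).trace := by
    have : (K * (t⁻¹ • (1 : Matrix (Fin d) (Fin d) ℂ)) * K - K * P * K) + ((1 - K * S * K) - (1 - K * R * K))
      = K * (t⁻¹ • (1 : Matrix (Fin d) (Fin d) ℂ) - P - S + R) * K := by
        simp only [mul_sub, mul_add, sub_mul, add_mul]; abel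
    rw [this, Matrix.trace_mul_cycle, hK]
  rw [goal_eq]
  clear goal_eq
  generalize 1 - K * R * K = Z at *
  generalize 1 - K * S * K = W at *
  generalize K * P * K = X at *
  generalize K * (t⁻¹ • (1 : Matrix (Fin d) (Fin d) ℂ)) * K = Y at *
  have h1 : 0 ≤ (((W - Z) * (1 + Y) * (W - Z)).trace).re := by
    have := ((PosSemidef.one.add hY).conjTranspose_mul_mul_same (W - Z)).trace_nonneg
    rw [conjTranspose_sub, hZh, hWh] at this
    exact (Complex.le_def.1 this).1
  have h2 : 0 ≤ (((Y - X) * (Z * (X + X + X * X) * Z)).trace).re := by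
    refine trace_mul_nonneg (nonneg_iff_posSemidef.2 hD) (nonneg_iff_posSemidef.2 ?_)
    have : (X + X + X * X).PosSemidef := by
      have := posSemidef_conjTranspose_mul_self X
      rw [hX.1] at this
      exact (hX.add hX).add this
    have := this.conjTranspose_mul_mul_same Z
    rwa [hZh] at this
  have e1 : (W - Z) * (1 + Y) * (W - Z) = W - Z + Z * (Y - X) * Z := by
    calc _ = (W * (1 + Y)) * W - (W * (1+Y)) * Z - Z * ((1 + Y) * W)
        + (Z * (1 + X)) * Z + Z * (Y - X) * Z := by noncomm_ring
      _ = _ := by rw [hW', hW, hZ']; simp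
  have e2 : Z * (X + X + X * X) * Z = 1 - Z * Z := by
    calc _ = (Z * (1 + X)) * ((1 + X) * Z) - Z * Z := by noncomm_ring
      _ = _ := by rw [hZ', hZ]; simp
  rw [e1, trace_add, Matrix.trace_mul_cycle, Matrix.trace_mul_comm (Z * Z)] at h1
  rw [e2, mul_sub, mul_one, trace_sub] at h2
  rw [trace_add]
  simp only [Complex.add_re, Complex.sub_re] at *
  linarith


lemma cfcn_integrand {p t : ℝ} (hp : p ∈ Set.Ioo (0 : ℝ) 1) (ht : 0 < t)
    {A : Matrix (Fin d) (Fin d) ℂ} (hA : 0 ≤ A) :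
    cfcₙ (Real.rpowIntegrand₀₁ p t) A = t ^ p • (t⁻¹ • (1 : Matrix (Fin d) (Fin d) ℂ)
      - (t • (1 : Matrix (Fin d) (Fin d) ℂ) + A)⁻¹) := by
  have hspec : ∀ x ∈ spectrum ℝ A, 0 ≤ x := fun x hx => spectrum_nonneg_of_nonneg hA hx
  have hsa : IsSelfAdjoint A := IsSelfAdjoint.of_nonneg hA
  have hne : ∀ x ∈ spectrum ℝ A, t + x ≠ 0 := fun x hx => by have := hspec x hx; positivity
  have hc : ContinuousOn (Real.rpowIntegrand₀₁ p t) (quasispectrum ℝ A) :=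
    (Real.continuousOn_rpowIntegrand₀₁_Ici hp ht).mono
      fun x hx => quasispectrum_nonneg_of_nonneg A hA x hx
  have hci : ContinuousOn (fun x : ℝ => (t + x)⁻¹) (spectrum ℝ A) :=
    ContinuousOn.inv₀ (by fun_prop) hne
  rw [cfcₙ_eq_cfc hc (Real.rpowIntegrand₀₁_zero_right)]
  unfold Real.rpowIntegrand₀₁
  rw [cfc_const_mul _ _ _ (by fun_prop), cfc_sub _ _ _ (by fun_prop) hci, cfc_const _ _ hsa,
    cfc_inv (fun x => t + x) A hne (by fun_prop) hsa, cfc_const_add _ _ _ (by fun_prop) hsa,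
    cfc_id' ℝ A hsa, Algebra.algebraMap_eq_smul_one, Algebra.algebraMap_eq_smul_one,
    nonsing_inv_eq_ringInverse]

/-- Trace subadditivity. -/
lemma trace_pow_add {p : ℝ≥0} (hp0 : 0 < p) (hp1 : p ≤ 1) {A B : Matrix (Fin d) (Fin d) ℂ}
    (hA : 0 ≤ A) (hB : 0 ≤ B) :
    ((A * (A + B) ^ p).trace).re ≤ ((A * A ^ p).trace).re + ((A * B ^ p).trace).re := by
  rcases hp1.eq_or_lt with rfl | hp1
  · rw [CFC.nnrpow_one _ hA, CFC.nnrpow_one _ hB, CFC.nnrpow_one _ (add_nonneg hA hB), mul_add,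
      trace_add, Complex.add_re]
  have hp : p ∈ Set.Ioo 0 1 := ⟨hp0, hp1⟩
  have hp' : (p : ℝ) ∈ Set.Ioo (0 : ℝ) 1 := ⟨by exact_mod_cast hp0, by exact_mod_cast hp1⟩
  obtain ⟨μ, hμ⟩ := CFC.exists_measure_nnrpow_eq_integral_cfcₙ_rpowIntegrand₀₁
    (Matrix (Fin d) (Fin d) ℂ) hp
  let φ0 : Matrix (Fin d) (Fin d) ℂ →ₗ[ℝ] ℝ :=
    Complex.reLm ∘ₗ ((traceLinearMap (Fin d) ℝ ℂ) ∘ₗ (LinearMap.mulLeft ℝ A))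
  let φ : Matrix (Fin d) (Fin d) ℂ →L[ℝ] ℝ := LinearMap.toContinuousLinearMap φ0
  have hφ : ∀ M, ((A * M).trace).re = φ M := fun M => rfl
  have hint : ∀ a : Matrix (Fin d) (Fin d) ℂ, 0 ≤ a →
      MeasureTheory.IntegrableOn (fun t => φ (cfcₙ (Real.rpowIntegrand₀₁ p t) a)) (Set.Ioi 0) μ :=
    fun a ha => φ.integrable_comp (hμ a ha).1
  have heq : ∀ a : Matrix (Fin d) (Fin d) ℂ, 0 ≤ a →
      φ (a ^ p) = ∫ t in Set.Ioi 0, φ (cfcₙ (Real.rpowIntegrand₀₁ p t) a) ∂μ := fun a ha => by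
    rw [(hμ a ha).2, φ.integral_comp_comm (hμ a ha).1]
  rw [hφ, hφ, hφ, heq _ hA, heq _ hB, heq _ (add_nonneg hA hB),
    ← MeasureTheory.integral_add (hint A hA) (hint B hB)]
  refine MeasureTheory.setIntegral_mono_on (hint _ (add_nonneg hA hB))
    ((hint A hA).add (hint B hB)) measurableSet_Ioi ?_
  intro t ht
  have ht : 0 < t := ht
  rw [cfcn_integrand hp' ht hA, cfcn_integrand hp' ht hB, cfcn_integrand hp' ht (add_nonneg hA hB)]
  have h := key_resolvent t ht hA hB
  rw [hφ] at h
  have ht' : 0 ≤ t ^ (p : ℝ) := by positivity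
  simp only [map_smul, map_sub, map_add, smul_eq_mul] at h ⊢
  nlinarith [mul_nonneg ht' h]

lemma nnrpow_eq_cfc {p : ℝ≥0} (hp : 0 < p) {A : Matrix (Fin d) (Fin d) ℂ} (hA : 0 ≤ A) :
    A ^ p = cfc (fun x : ℝ => x ^ (p : ℝ)) A := by
  have hp' : (0 : ℝ) < p := by exact_mod_cast hp
  rw [CFC.nnrpow_eq_cfcₙ_real A p hA, cfcₙ_eq_cfc (Real.continuous_rpow_const hp'.le).continuousOn (Real.zero_rpow hp'.ne')]

lemma smul_nnrpow {p : ℝ≥0} (hp : 0 < p) {c : ℝ} (hc : 0 ≤ c) {A : Matrix (Fin d) (Fin d) ℂ}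
    (hA : 0 ≤ A) : (c • A) ^ p = (c ^ (p : ℝ)) • A ^ p := by
  have hp' : (0 : ℝ) < p := by exact_mod_cast hp
  have hcont := Real.continuous_rpow_const hp'.le
  rw [nnrpow_eq_cfc hp hA, nnrpow_eq_cfc hp (smul_nonneg hc hA),
    ← cfc_comp_const_mul c (fun x : ℝ => x ^ (p : ℝ)) A hcont.continuousOn
      (IsSelfAdjoint.of_nonneg hA), ← cfc_const_mul _ _ _ hcont.continuousOn]
  refine cfc_congr fun x hx => ?_
  exact Real.mul_rpow hc (spectrum_nonneg_of_nonneg hA hx)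

lemma matPow_eq {p : ℝ≥0} (hp : 0 < p) {A : Matrix (Fin d) (Fin d) ℂ} (hA : 0 ≤ A) :
    matPow A (1 + p) = A * A ^ p := by
  have hh : A.IsHermitian := (nonneg_iff_posSemidef.1 hA).1
  have e : A * A ^ p = A ^ (1 + p) := by
    rw [CFC.nnrpow_add one_pos hp, CFC.nnrpow_one A hA]
  rw [e, nnrpow_eq_cfc (by positivity) hA, hh.cfc_eq, IsHermitian.cfc, matPow, matFun, dif_pos hh,
    Unitary.conjStarAlgAut_apply]
  congr 3
  funext i
  have : (1 + (p : ℝ)) ≠ 0 := by positivity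
  simp only [Function.comp, NNReal.coe_add, NNReal.coe_one]
  split_ifs with h
  · rw [h, Real.zero_rpow this]; rfl
  · rfl

lemma inv_natCast_smul (L : ℕ) (M : Matrix (Fin d) (Fin d) ℂ) :
    (L : ℂ)⁻¹ • M = (L : ℝ)⁻¹ • M := by
  ext i j; simp

lemma main {p : ℝ≥0} (hp0 : 0 < p) (hp1 : p ≤ 1) (N T L : ℕ)
    (hN : 1 ≤ N) (hT : 1 ≤ T) (hL : 1 ≤ L) (hNTL : N = T * L)
    (Ω : Finset (Fin N → Fin T)) (hΩ : Ω.Nonempty)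
    (hhash : ∀ n n' : Fin N, n ≠ n' →
      ((Ω.filter (fun f => f n = f n')).card : ℝ) ≤ (Ω.card : ℝ) / T)
    (ρ : Fin N → Matrix (Fin d) (Fin d) ℂ) (hρ : ∀ n, 0 ≤ ρ n) :
    (Ω.card : ℝ)⁻¹ *
        ∑ f ∈ Ω, (T : ℝ)⁻¹ *
          ∑ t : Fin T,
            ((matPow ((L : ℂ)⁻¹ •
                ∑ n ∈ Finset.univ.filter (fun n : Fin N => f n = t), ρ n) (1 + p)).trace).re
      ≤ ((L : ℝ) ^ (p : ℝ))⁻¹ * ((N : ℝ)⁻¹ * ∑ n, ((matPow (ρ n) (1 + p)).trace).re)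
          + ((matPow ((N : ℂ)⁻¹ • ∑ n, ρ n) (1 + p)).trace).re := by
  have hTpos : (0 : ℝ) < T := by exact_mod_cast hT
  have hLpos : (0 : ℝ) < L := by exact_mod_cast hL
  have hNpos : (0 : ℝ) < N := by exact_mod_cast hN
  have hΩpos : (0 : ℝ) < Ω.card := by exact_mod_cast hΩ.card_pos
  have hNr : (N : ℝ) = T * L := by exact_mod_cast hNTL
  let X : (Fin N → Fin T) → Fin T → Matrix (Fin d) (Fin d) ℂ := fun f t =>
    (L : ℝ)⁻¹ • ∑ n ∈ Finset.univ.filter (fun n : Fin N => f n = t), ρ n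
  have hX : ∀ f t, 0 ≤ X f t := fun f t =>
    smul_nonneg (by positivity) (Finset.sum_nonneg fun n _ => hρ n)
  let ρb : Matrix (Fin d) (Fin d) ℂ := (N : ℝ)⁻¹ • ∑ n, ρ n
  have hρb : 0 ≤ ρb := smul_nonneg (by positivity) (Finset.sum_nonneg fun n _ => hρ n)
  have step1 : ∀ f : Fin N → Fin T, ∑ t : Fin T,
      ((matPow ((L : ℂ)⁻¹ •
                ∑ n ∈ Finset.univ.filter (fun n : Fin N => f n = t), ρ n) (1 + p)).trace).re
      = (L : ℝ)⁻¹ * ∑ n, ((ρ n * (X f (f n)) ^ p).trace).re := by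
    intro f
    rw [← Finset.sum_fiberwise Finset.univ f, Finset.mul_sum]
    refine Finset.sum_congr rfl fun t _ => ?_
    rw [inv_natCast_smul, matPow_eq hp0 (hX f t)]
    have : ∑ n ∈ Finset.univ.filter (fun n : Fin N => f n = t), ((ρ n * (X f (f n)) ^ p).trace).re
      = ∑ n ∈ Finset.univ.filter (fun n : Fin N => f n = t), ((ρ n * (X f t) ^ p).trace).re := by
      refine Finset.sum_congr rfl fun n hn => ?_
      rw [(Finset.mem_filter.1 hn).2]
    rw [this, ← Complex.re_sum, ← trace_sum, ← Finset.sum_mul]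
    change (Matrix.trace ((((L : ℝ)⁻¹ • (_ : Matrix (Fin d) (Fin d) ℂ)) * _ : Matrix (Fin d) (Fin d) ℂ))).re = _
    rw [smul_mul_assoc, trace_smul, Complex.smul_re, smul_eq_mul]
  -- pointwise bound
  have step2 : ∀ n, (Ω.card : ℝ)⁻¹ * ∑ f ∈ Ω, ((ρ n * (X f (f n)) ^ p).trace).re
      ≤ ((L : ℝ) ^ (p : ℝ))⁻¹ * ((ρ n * ρ n ^ p).trace).re + ((ρ n * ρb ^ p).trace).re := by
    intro n
    have hav : ∑ f ∈ Ω, (Ω.card : ℝ)⁻¹ • X f (f n) ≤ (L : ℝ)⁻¹ • ρ n + ρb := by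
      have e1 : ∑ f ∈ Ω, (Ω.card : ℝ)⁻¹ • X f (f n) = ∑ m, ((Ω.card : ℝ)⁻¹ * (L : ℝ)⁻¹ *
          ((Ω.filter (fun f => f m = f n)).card : ℝ)) • ρ m := by
        simp only [X, Finset.sum_filter, Finset.smul_sum]
        rw [Finset.sum_comm]
        refine Finset.sum_congr rfl fun m _ => ?_
        rw [Finset.card_filter, Nat.cast_sum, Finset.mul_sum, Finset.sum_smul]
        refine Finset.sum_congr rfl fun f _ => ?_
        split_ifs <;> simp [smul_smul]
      have e2 : (L : ℝ)⁻¹ • ρ n + ρb = ∑ m, ((if m = n then (L : ℝ)⁻¹ else 0) + (N : ℝ)⁻¹) • ρ m := by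
        simp only [add_smul, Finset.sum_add_distrib, ite_smul, zero_smul, Finset.sum_ite_eq',
          Finset.mem_univ, if_true, ρb, Finset.smul_sum]
      rw [e1, e2]
      refine Finset.sum_le_sum fun m _ => smul_le_smul_of_nonneg_right ?_ (hρ m)
      split_ifs with h
      · have : ((Ω.filter (fun f => f m = f n)).card : ℝ) ≤ Ω.card := by
          exact_mod_cast Finset.card_filter_le _ _
        calc _ ≤ (Ω.card : ℝ)⁻¹ * (L : ℝ)⁻¹ * Ω.card := by gcongr
          _ = (L : ℝ)⁻¹ := by field_simp
          _ ≤ _ := by have : 0 ≤ (N : ℝ)⁻¹ := by positivity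
                      linarith
      · calc _ ≤ (Ω.card : ℝ)⁻¹ * (L : ℝ)⁻¹ * (Ω.card / T) := by gcongr; exact hhash m n h
          _ = 0 + (N : ℝ)⁻¹ := by rw [hNr]; field_simp; simp
    have hconc := (CFC.concaveOn_nnrpow (A := Matrix (Fin d) (Fin d) ℂ)
      (p := p) ⟨hp0.le, hp1⟩).le_map_sum (t := Ω) (w := fun _ => (Ω.card : ℝ)⁻¹)
      (p := fun f => X f (f n)) (fun _ _ => by positivity)
      (by rw [Finset.sum_const, nsmul_eq_mul]; field_simp) (fun f _ => hX f (f n))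
    have hle := hconc.trans (CFC.nnrpow_le_nnrpow (p := p) ⟨hp0.le, hp1⟩ hav)
    have h1 := trace_mul_mono (hρ n) hle
    have e3 : ((ρ n * ∑ f ∈ Ω, (Ω.card : ℝ)⁻¹ • (X f (f n)) ^ p).trace).re =
        (Ω.card : ℝ)⁻¹ * ∑ f ∈ Ω, ((ρ n * (X f (f n)) ^ p).trace).re := by
      rw [← Finset.smul_sum, mul_smul_comm, trace_smul, Complex.smul_re, smul_eq_mul,
        Finset.mul_sum, trace_sum, Complex.re_sum]
    rw [← e3]
    refine h1.trans ?_
    -- trace subadditivity with A = L⁻¹ ρ n, rescaled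
    have h2 := trace_pow_add hp0 hp1 (smul_nonneg (inv_nonneg.2 hLpos.le) (hρ n)) hρb
    simp only [smul_mul_assoc, trace_smul, Complex.smul_re, smul_eq_mul] at h2
    rw [← mul_add] at h2
    have h3 := le_of_mul_le_mul_left h2 (inv_pos.2 hLpos)
    rw [smul_nnrpow hp0 (inv_nonneg.2 hLpos.le) (hρ n), mul_smul_comm, trace_smul,
      Complex.smul_re, smul_eq_mul, Real.inv_rpow hLpos.le] at h3
    exact h3
  have e4 : ((matPow ((N : ℂ)⁻¹ • ∑ n, ρ n) (1 + p)).trace).re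
      = (N : ℝ)⁻¹ * ∑ n, ((ρ n * ρb ^ p).trace).re := by
    rw [inv_natCast_smul, matPow_eq hp0 hρb]
    change (Matrix.trace ((((N : ℝ)⁻¹ • (_ : Matrix (Fin d) (Fin d) ℂ)) * _ : Matrix (Fin d) (Fin d) ℂ))).re = _
    rw [smul_mul_assoc, trace_smul, Complex.smul_re, smul_eq_mul, Finset.sum_mul, trace_sum,
      Complex.re_sum]
  have e5 : ∀ n, ((matPow (ρ n) (1 + p)).trace).re = ((ρ n * ρ n ^ p).trace).re := fun n => by
    rw [matPow_eq hp0 (hρ n)]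
  rw [e4]
  simp only [step1, e5]
  have hs := Finset.sum_le_sum fun n (_ : n ∈ Finset.univ) => step2 n
  rw [Finset.sum_add_distrib, ← Finset.mul_sum, ← Finset.mul_sum, Finset.sum_comm] at hs
  have hs' := mul_le_mul_of_nonneg_left hs (inv_nonneg.2 hNpos.le)
  refine le_trans (le_of_eq ?_) (hs'.trans (le_of_eq ?_))
  · rw [← Finset.mul_sum, ← Finset.mul_sum, hNr, mul_inv]; ring
  · ring

end HashAux

end HashAuxSection


/-- The hashing expectation bound Eq. (C8) of Appendix C: averaging over a
2-universal family of hash functions with uniform fibers. -/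
theorem hashing_expectation_bound {d : ℕ} (N T L : ℕ)
    (hN : 1 ≤ N) (hT : 1 ≤ T) (hL : 1 ≤ L) (hNTL : N = T * L)
    (Ω : Finset (Fin N → Fin T)) (hΩ : Ω.Nonempty)
    (hfiber : ∀ f ∈ Ω, ∀ t : Fin T,
      (Finset.univ.filter (fun n : Fin N => f n = t)).card = L)
    (hhash : ∀ n n' : Fin N, n ≠ n' →
      ((Ω.filter (fun f => f n = f n')).card : ℝ) ≤ (Ω.card : ℝ) / T)
    (ρ : Fin N → Matrix (Fin d) (Fin d) ℂ) (hρ : ∀ n, (ρ n).PosSemidef)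
    (s : ℝ) (hs0 : 0 < s) (hs1 : s ≤ 1) :
    (Ω.card : ℝ)⁻¹ *
        ∑ f ∈ Ω, (T : ℝ)⁻¹ *
          ∑ t : Fin T,
            ((matPow ((L : ℂ)⁻¹ •
                ∑ n ∈ Finset.univ.filter (fun n : Fin N => f n = t), ρ n) (1 + s)).trace).re
      ≤ ((L : ℝ) ^ s)⁻¹ * ((N : ℝ)⁻¹ * ∑ n, ((matPow (ρ n) (1 + s)).trace).re)
          + ((matPow ((N : ℂ)⁻¹ • ∑ n, ρ n) (1 + s)).trace).re := by
  exact HashAux.main (p := ⟨s, hs0.le⟩) hs0 hs1 N T L hN hT hL hNTL Ω hΩ hhash ρ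
    (fun n => Matrix.nonneg_iff_posSemidef.2 (hρ n))
end

section
/- Let G be a finite group with a unitary representation U on ℂ^d and twirling operation 𝒢. Let L ≥ 1 and let Q : Fin L → (d×d matrices) be a family of Hermitian idempotent matrices with Q_l Q_{l'} = 0 for l ≠ l', Q_l U_g = U_g Q_l for all g ∈ G and l, and such that for all l ≠ l' and every d×d matrix X, 𝒢(Q_l X Q_{l'}) = 0 (the multiplicity-free condition). Let ψ_l ∈ ℂ^d (l ∈ Fin L) be unit vectors, and let |ψ_{AF}⟩ = (1/√L) Σ_{l∈Fin L} ψ_l ⊗ e_l ∈ ℂ^d ⊗ ℂ^L, where (e_l) is the standard basis of ℂ^L. Define δ = 1 − (1/L) Σ_{l} Re⟨ψ_l, Q_l ψ_l⟩ and σ̄ = (1/L) Σ_{l} Q_l 𝒢(ψ_l ψ_l†) Q_l, and assume δ < 1. Then for every natural number M ≥ 1 and every s ∈ [0,1], there exists an assignment to each codeword tuple (g_1,…,g_M) ∈ G^M of a one-way LOCC decoder — namely a finite set X, a POVM {B^x}_{x∈X} on ℂ^L, and for each x ∈ X a POVM {Γ^{m|x}}_{m∈Fin M} on ℂ^d — such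 that the expected decoding error over uniformly random codewords satisfies (1/|G|^M) Σ_{(g_1,…,g_M)∈G^M} [ 1 − (1/M) Σ_{m∈Fin M} Σ_{x∈X} Re tr[ (Γ^{m|x} ⊗ B^x) (U_{g_m} ⊗ 1_L) |ψ_{AF}⟩⟨ψ_{AF}| (U_{g_m} ⊗ 1_L)† ] ] ≤ (8 M^s / (1−δ)^s) · tr[σ̄^{1+s}] + 2δ. -/
open scoped BigOperators Kronecker ComplexOrder
open Matrix

lemma herm_spec {n : Type*} [Fintype n] [DecidableEq n] {K : Matrix n n ℂ} (h : K.IsHermitian) :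
    K = (h.eigenvectorUnitary : Matrix n n ℂ) * Matrix.diagonal (fun i => (h.eigenvalues i : ℂ)) *
      (star (h.eigenvectorUnitary : Matrix n n ℂ)) := by
  conv_lhs => rw [h.spectral_theorem]
  rw [Unitary.conjStarAlgAut_apply]
  rfl

lemma sandwich_mul {n : Type*} [Fintype n] [DecidableEq n] {V : Matrix n n ℂ} (hV : star V * V = 1)
    (a b : n → ℂ) :
    (V * diagonal a * star V) * (V * diagonal b * star V) = V * diagonal (fun i => a i * b i) * star V := by
  rw [← Matrix.diagonal_mul_diagonal]
  calc _ = V * diagonal a * (star V * V) * (diagonal b * star V) := by simp only [Matrix.mul_assoc]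
    _ = _ := by rw [hV]; simp only [Matrix.mul_assoc, Matrix.mul_one]

lemma sandwich_conj {n : Type*} [Fintype n] [DecidableEq n] (V : Matrix n n ℂ)
    (a : n → ℝ) :
    (V * diagonal (fun i => (a i : ℂ)) * star V)ᴴ = V * diagonal (fun i => (a i : ℂ)) * star V := by
  simp only [Matrix.star_eq_conjTranspose, conjTranspose_mul, conjTranspose_conjTranspose,
    diagonal_conjTranspose, Matrix.mul_assoc]
  congr 3
  ext i
  simp

lemma sandwich_diag {n : Type*} [Fintype n] [DecidableEq n] (V : Matrix n n ℂ)
    (a : n → ℝ) (m : n) :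
    (V * diagonal (fun i => (a i : ℂ)) * star V) m m
      = ((∑ i, Complex.normSq (V m i) * a i : ℝ) : ℂ) := by
  rw [Matrix.mul_apply]
  push_cast
  refine Finset.sum_congr rfl fun i _ => ?_
  rw [Matrix.mul_diagonal, Matrix.star_apply, Complex.normSq_eq_conj_mul_self]
  simp only [RCLike.star_def]; ring

/-- PGM-like decoder for pure states -/
lemma decoder {d M : ℕ} (hM : 1 ≤ M) (P : Matrix (Fin d) (Fin d) ℂ) (hP : Pᴴ = P) (hPP : P * P = P)
    (u : Fin M → Fin d → ℂ) :
    ∃ Γ : Fin M → Matrix (Fin d) (Fin d) ℂ, (∀ m, (Γ m).PosSemidef) ∧ (∑ m, Γ m = 1) ∧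
      ∀ m, (star (u m) ⬝ᵥ (P *ᵥ u m)).re ≤ 1 →
        1 - (star (u m) ⬝ᵥ (Γ m *ᵥ u m)).re ≤
        2 * (1 - (star (u m) ⬝ᵥ (P *ᵥ u m)).re)
          + ∑ m' ∈ Finset.univ.erase m, Complex.normSq (star (u m) ⬝ᵥ (P *ᵥ u m')) := by
  classical
  set N : Matrix (Fin d) (Fin M) ℂ := Matrix.of fun i m => u m i with hN
  set A := P * N with hA
  set K := Aᴴ * A with hK
  have hKN : Aᴴ * N = K := by
    rw [hK, hA, conjTranspose_mul, hP, Matrix.mul_assoc, Matrix.mul_assoc, ← Matrix.mul_assoc P P, hPP]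
  have hKpsd : K.PosSemidef := posSemidef_conjTranspose_mul_self A
  have hKh := hKpsd.1
  set V : Matrix (Fin M) (Fin M) ℂ := (hKh.eigenvectorUnitary : Matrix (Fin M) (Fin M) ℂ) with hV
  set lam := hKh.eigenvalues with hlam
  have hlam0 : ∀ i, 0 ≤ lam i := hKpsd.eigenvalues_nonneg
  have hVV : star V * V = 1 := by
    rw [hV]; exact Unitary.coe_star_mul_self _
  have hKs : K = V * diagonal (fun i => (lam i : ℂ)) * star V := herm_spec hKh
  set gg : Fin M → ℝ := fun i => (Real.sqrt (lam i))⁻¹ with hgg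
  set Gm := V * diagonal (fun i => (gg i : ℂ)) * star V with hGm
  have hGh : Gmᴴ = Gm := sandwich_conj V gg
  set W := A * Gm with hW
  have hWN : Wᴴ * N = V * diagonal (fun i => ((Real.sqrt (lam i) : ℝ) : ℂ)) * star V := by
    rw [hW, conjTranspose_mul, Matrix.mul_assoc, hKN, hGh, hGm, hKs, sandwich_mul hVV]
    congr 3
    ext i
    rw [← Complex.ofReal_mul]
    congr 1
    simp only [hgg]
    conv_lhs => rw [← Real.mul_self_sqrt (hlam0 i)]
    by_cases h : Real.sqrt (lam i) = 0
    · simp [h]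
    · rw [Real.sqrt_mul_self (Real.sqrt_nonneg _)]; field_simp
  have hWWW : W * (Wᴴ * W) = W := by
    have : Wᴴ * W = Gm * K * Gm := by
      rw [hW, conjTranspose_mul, hGh, hK]; simp only [Matrix.mul_assoc]
    rw [this, hW, Matrix.mul_assoc]
    congr 1
    rw [hGm, hKs, sandwich_mul hVV, sandwich_mul hVV, sandwich_mul hVV]
    congr 3
    ext i
    rw [← Complex.ofReal_mul, ← Complex.ofReal_mul, ← Complex.ofReal_mul]
    congr 1
    simp only [hgg]
    by_cases h : Real.sqrt (lam i) = 0
    · simp [h]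
    · have h2 : lam i = Real.sqrt (lam i) * Real.sqrt (lam i) := (Real.mul_self_sqrt (hlam0 i)).symm
      rw [h2, Real.sqrt_mul_self (Real.sqrt_nonneg _)]; field_simp
  set R := 1 - W * Wᴴ with hR
  have hRh : Rᴴ = R := by simp [hR]
  have hRR : R * R = R := by
    have : W * Wᴴ * (W * Wᴴ) = W * Wᴴ := by
      calc _ = W * (Wᴴ * W) * Wᴴ := by simp only [Matrix.mul_assoc]
        _ = _ := by rw [hWWW]
    rw [hR, Matrix.mul_sub, Matrix.sub_mul, Matrix.sub_mul, this]; simp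
  have hRpsd : R.PosSemidef := by
    have := posSemidef_conjTranspose_mul_self R
    rwa [hRh, hRR] at this
  let m0 : Fin M := ⟨0, hM⟩
  let T : Fin M → Matrix (Fin d) (Fin d) ℂ := fun m => vecMulVec (fun i => W i m) (star fun i => W i m)
  have hT : ∀ m, (T m).PosSemidef := fun m => posSemidef_vecMulVec_self_star _
  have hTsum : ∑ m, T m = W * Wᴴ := by
    ext i j
    simp [T, Matrix.sum_apply, Matrix.mul_apply, vecMulVec_apply]
  refine ⟨fun m => T m + if m = m0 then R else 0, ?_, ?_, ?_⟩
  · intro m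
    refine (hT m).add ?_
    split_ifs
    · exact hRpsd
    · exact PosSemidef.zero
  · rw [Finset.sum_add_distrib, hTsum]; simp [hR]
  · intro m ha1
    have hKe : ∀ m m', K m m' = star (u m) ⬝ᵥ (P *ᵥ u m') := by
      intro m m'
      rw [← hKN, hA, conjTranspose_mul, hP, Matrix.mul_assoc]
      simp only [Matrix.mul_apply, dotProduct, mulVec, hN, conjTranspose_apply, of_apply, Pi.star_apply]
    have hk : (K m m).re = ∑ i, Complex.normSq (V m i) * lam i := by
      conv_lhs => rw [hKs, sandwich_diag]
      exact Complex.ofReal_re _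
    have hk2 : ∑ m', Complex.normSq (K m m') = ∑ i, Complex.normSq (V m i) * (lam i * lam i) := by
      have h1 : (K * K) m m = ((∑ i, Complex.normSq (V m i) * (lam i * lam i) : ℝ) : ℂ) := by
        conv_lhs => rw [hKs, sandwich_mul hVV]
        rw [← sandwich_diag V (fun i => lam i * lam i)]
        simp
      have h2 : (K * K) m m = ((∑ m', Complex.normSq (K m m') : ℝ) : ℂ) := by
        rw [Matrix.mul_apply]
        push_cast
        refine Finset.sum_congr rfl fun j _ => ?_
        rw [Complex.normSq_eq_conj_mul_self, ← hKh.apply j m, mul_comm]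
        simp
      exact_mod_cast h2.symm.trans h1
    set r := ∑ i, Complex.normSq (V m i) * Real.sqrt (lam i) with hr
    have hrlow : (3 * (K m m).re - ∑ m', Complex.normSq (K m m')) / 2 ≤ r := by
      rw [hk, hk2, hr, Finset.mul_sum, ← Finset.sum_sub_distrib, Finset.sum_div]
      refine Finset.sum_le_sum fun i _ => ?_
      have h0 := Complex.normSq_nonneg (V m i)
      have h1 := Real.sqrt_nonneg (lam i)
      have h2 : lam i = Real.sqrt (lam i) * Real.sqrt (lam i) := (Real.mul_self_sqrt (hlam0 i)).symm
      set q := Real.sqrt (lam i)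
      rw [h2]
      have : (3 * (q * q) - (q * q) * (q * q)) / 2 ≤ q := by
        nlinarith [mul_nonneg h1 (mul_nonneg (sq_nonneg (q - 1)) (by linarith : 0 ≤ q + 2))]
      nlinarith [mul_le_mul_of_nonneg_left this h0]
    have hsucc : r ^ 2 ≤ (star (u m) ⬝ᵥ ((T m + if m = m0 then R else 0) *ᵥ u m)).re := by
      have h1 : 0 ≤ (star (u m) ⬝ᵥ ((if m = m0 then R else 0) *ᵥ u m)).re := by
        split_ifs
        · exact (Complex.nonneg_iff.1 (hRpsd.dotProduct_mulVec_nonneg _)).1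
        · simp
      have h2 : (Wᴴ * N) m m = (r : ℂ) := by
        rw [hWN, sandwich_diag]
      have h3 : star (u m) ⬝ᵥ (T m *ᵥ u m) = ((r ^ 2 : ℝ) : ℂ) := by
        have e1 : (star fun i => W i m) ⬝ᵥ u m = (r : ℂ) := by
          rw [← h2, Matrix.mul_apply]; rfl
        have e2 : star (u m) ⬝ᵥ (fun i => W i m) = (r : ℂ) := by
          have := congrArg star e1
          rw [Matrix.star_dotProduct, star_star] at this
          simpa using this
        simp only [T]
        rw [Matrix.vecMulVec_mulVec, e1]
        simp [e2, sq]
      rw [Matrix.add_mulVec, dotProduct_add, Complex.add_re, h3, Complex.ofReal_re]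
      linarith
    rw [← hKe] at ha1 ⊢
    simp only [← hKe]
    have hsplit : ∑ m', Complex.normSq (K m m') =
        (K m m).re ^ 2 + ∑ m' ∈ Finset.univ.erase m, Complex.normSq (K m m') := by
      rw [← Finset.add_sum_erase _ _ (Finset.mem_univ m)]
      congr 1
      rw [hKs, sandwich_diag, Complex.normSq_ofReal, Complex.ofReal_re, sq]
    have ha0 : 0 ≤ (K m m).re := by
      rw [hk]; exact Finset.sum_nonneg fun i _ => mul_nonneg (Complex.normSq_nonneg _) (hlam0 i)
    rw [hsplit] at hrlow
    nlinarith [sq_nonneg (r - 1)]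


lemma noise_bound {d : ℕ} (E : Matrix (Fin d) (Fin d) ℂ) (hE : E.PosSemidef) (hE1 : (1 - E).PosSemidef)
    (p r : Fin d → ℂ) :
    (star (p + r) ⬝ᵥ (E *ᵥ (p + r))).re ≤ 2 * (star p ⬝ᵥ (E *ᵥ p)).re + 2 * (star r ⬝ᵥ r).re := by
  have h1 := (Complex.nonneg_iff.1 (hE.dotProduct_mulVec_nonneg (p - r))).1
  have h2 := (Complex.nonneg_iff.1 (hE1.dotProduct_mulVec_nonneg r)).1
  simp only [star_add, star_sub, mulVec_add, mulVec_sub, dotProduct_add, add_dotProduct, dotProduct_sub,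
    sub_dotProduct, Complex.add_re, Complex.sub_re, Matrix.sub_mulVec, Matrix.one_mulVec] at h1 h2 ⊢
  linarith

lemma avg_update {G : Type*} [Group G] [Fintype G] {M : ℕ} (m : Fin M) 
    (F : (Fin M → G) → G → ℝ) (hF : ∀ g a h, F (Pi.mulSingle m a * g) h = F g h) :
    ∑ g : Fin M → G, F g (g m) = (Fintype.card G : ℝ)⁻¹ * ∑ g : Fin M → G, ∑ h, F g h := by
  have h0 : (Fintype.card G : ℝ) ≠ 0 := by exact_mod_cast Fintype.card_ne_zero
  rw [eq_inv_mul_iff_mul_eq₀ h0]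
  have key : ∀ a : G, ∑ g : Fin M → G, F g (g m) = ∑ g : Fin M → G, F g (a * g m) := by
    intro a
    rw [← Equiv.sum_comp (Equiv.mulLeft (Pi.mulSingle m a : Fin M → G))]
    simp [hF]
  calc _ = ∑ a : G, ∑ g : Fin M → G, F g (g m) := by simp [Finset.sum_const, nsmul_eq_mul]
    _ = ∑ a : G, ∑ g : Fin M → G, F g (a * g m) := Finset.sum_congr rfl fun a _ => key a
    _ = ∑ g : Fin M → G, ∑ a : G, F g (a * g m) := Finset.sum_comm
    _ = _ := Finset.sum_congr rfl fun g _ => Equiv.sum_comp (Equiv.mulRight (g m)) (F g)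

lemma avg_one {G : Type*} [Group G] [Fintype G] {M : ℕ} (m : Fin M) (f : G → ℝ) :
    ((Fintype.card G : ℝ) ^ M)⁻¹ * ∑ g : Fin M → G, f (g m) = (Fintype.card G : ℝ)⁻¹ * ∑ h, f h := by
  have h0 : (Fintype.card G : ℝ) ≠ 0 := by exact_mod_cast Fintype.card_ne_zero
  rw [avg_update m (fun _ h => f h) (fun _ _ _ => rfl)]
  simp
  field_simp

lemma avg_two {G : Type*} [Group G] [Fintype G] {M : ℕ} (m m' : Fin M) (hm : m' ≠ m) (f : G → G → ℝ) :
    ((Fintype.card G : ℝ) ^ M)⁻¹ * ∑ g : Fin M → G, f (g m) (g m') =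
      (Fintype.card G : ℝ)⁻¹ * ((Fintype.card G : ℝ)⁻¹ * ∑ h, ∑ k, f h k) := by
  rw [avg_update m' (fun g k => f (g m) k)]
  · rw [mul_left_comm, avg_one m (fun h => ∑ k, f h k)]
  · intro g a h
    simp [Pi.mulSingle_eq_of_ne hm.symm]

lemma vmv_conj {d : ℕ} (A : Matrix (Fin d) (Fin d) ℂ) (u : Fin d → ℂ) :
    A * vecMulVec u (star u) * Aᴴ = vecMulVec (A *ᵥ u) (star (A *ᵥ u)) := by
  rw [Matrix.mul_vecMulVec, Matrix.vecMulVec_mul, Matrix.star_mulVec]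

lemma tr_vmv {d : ℕ} (P : Matrix (Fin d) (Fin d) ℂ) (a b : Fin d → ℂ) :
    (P * vecMulVec a (star b)).trace = star b ⬝ᵥ (P *ᵥ a) := by
  rw [Matrix.mul_vecMulVec, Matrix.trace_vecMulVec, dotProduct_comm]

lemma normSq_tr {d : ℕ} (P : Matrix (Fin d) (Fin d) ℂ) (hP : Pᴴ = P) (a b : Fin d → ℂ) :
    ((Complex.normSq (star a ⬝ᵥ (P *ᵥ b)) : ℝ) : ℂ) =
      (P * vecMulVec a (star a) * P * vecMulVec b (star b)).trace := by
  rw [tr_vmv, Complex.normSq_eq_conj_mul_self]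
  have : (starRingEnd ℂ) (star a ⬝ᵥ (P *ᵥ b)) = star b ⬝ᵥ (P *ᵥ a) := by
    change star _ = _
    rw [Matrix.star_dotProduct, star_star, Matrix.star_mulVec, hP, Matrix.dotProduct_mulVec]
  rw [this, ← Matrix.mulVec_mulVec, Matrix.mul_vecMulVec, Matrix.vecMulVec_mulVec]
  simp [mul_comm]

lemma fourier_basis (L : ℕ) (hL : 1 ≤ L) : ∃ F : Fin L → Fin L → ℂ,
    (∀ x l, star (F x l) * F x l = (L : ℂ)⁻¹) ∧
    (∀ l l', ∑ x, star (F x l) * F x l' = if l = l' then 1 else 0) := by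
  have hL0 : (L : ℂ) ≠ 0 := by exact_mod_cast (by omega : L ≠ 0)
  have : NeZero L := ⟨by omega⟩
  set ω := Complex.exp (2 * Real.pi * Complex.I / L) with hω
  have hp : IsPrimitiveRoot ω L := Complex.isPrimitiveRoot_exp L (by omega)
  have hn : star ω * ω = 1 := by
    have : ‖ω‖ = 1 := hp.norm'_eq_one (by omega)
    change (starRingEnd ℂ) ω * ω = 1
    rw [← Complex.normSq_eq_conj_mul_self, Complex.normSq_eq_norm_sq, this]; simp
  set c : ℂ := ((Real.sqrt L : ℝ) : ℂ)⁻¹ with hc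
  have hcc : star c * c = (L : ℂ)⁻¹ := by
    rw [hc, RCLike.star_def, map_inv₀, Complex.conj_ofReal, ← mul_inv, ← Complex.ofReal_mul, Real.mul_self_sqrt (by positivity)]
    simp
  refine ⟨fun x l => c * ω ^ (x.1 * l.1), ?_, ?_⟩
  · intro x l
    rw [star_mul, star_pow]
    calc _ = (star c * c) * (star ω * ω) ^ (x.1 * l.1) := by rw [mul_pow]; ring
      _ = _ := by rw [hn, hcc]; simp
  · intro l l'
    have : ∀ x : Fin L, star (c * ω ^ (x.1 * l.1)) * (c * ω ^ (x.1 * l'.1)) =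
        (L : ℂ)⁻¹ * (star ω ^ l.1 * ω ^ l'.1) ^ x.1 := by
      intro x
      rw [star_mul, star_pow, ← hcc, mul_pow, ← pow_mul, ← pow_mul, mul_comm l.1, mul_comm l'.1]; ring
    simp only [this]
    rw [← Finset.mul_sum, Fin.sum_univ_eq_sum_range (fun x => (star ω ^ l.1 * ω ^ l'.1) ^ x)]
    split_ifs with h
    · subst h
      rw [← mul_pow, hn]; simp [hL0]
    · set z := star ω ^ l.1 * ω ^ l'.1 with hz
      have hz1 : z ≠ 1 := by
        intro h1
        apply h
        have h2 : ω ^ l'.1 = ω ^ l.1 := by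
          calc ω ^ l'.1 = (star ω * ω) ^ l.1 * ω ^ l'.1 := by rw [hn]; simp
            _ = z * ω ^ l.1 := by rw [mul_pow, hz]; ring
            _ = _ := by rw [h1, one_mul]
        exact Fin.ext (hp.pow_inj l'.2 l.2 h2).symm
      have hzL : z ^ L = 1 := by
        rw [hz, mul_pow, ← pow_mul, ← pow_mul, mul_comm l.1, mul_comm l'.1, pow_mul, pow_mul, ← star_pow, hp.pow_eq_one]
        simp
      have := mul_geom_sum z L
      rw [hzL, sub_self] at this
      rcases mul_eq_zero.1 this with h3 | h3
      · exact absurd (sub_eq_zero.1 h3) hz1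
      · rw [h3, mul_zero]

lemma sandwich_trace {n : Type*} [Fintype n] [DecidableEq n] {V : Matrix n n ℂ} (hV : star V * V = 1)
    (a : n → ℂ) : (V * diagonal a * star V).trace = ∑ i, a i := by
  rw [Matrix.trace_mul_comm, ← Matrix.mul_assoc, hV, Matrix.one_mul, Matrix.trace_diagonal]

lemma scalar_ineq (l c M s : ℝ) (hl : 0 ≤ l) (hc : 0 < c) (hM : 0 < M) (hs0 : 0 ≤ s) (hs1 : s ≤ 1) :
    2 * (l - (if M * l ≤ c then 1 else 0) * l) +
      M / c * (((if M * l ≤ c then 1 else 0) * l) * ((if M * l ≤ c then 1 else 0) * l)) ≤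
    2 * (M ^ s / c ^ s) * (if l = 0 then 0 else l ^ (1 + s)) := by
  rcases hl.eq_or_lt with h | h
  · subst h; simp
  · rw [if_neg h.ne', Real.rpow_add h, Real.rpow_one]
    have e : 2 * (M ^ s / c ^ s) * (l * l ^ s) = 2 * l * (M * l / c) ^ s := by
      rw [Real.div_rpow (by positivity) hc.le, Real.mul_rpow hM.le hl]; ring
    rw [e]
    split_ifs with hh
    · have h1 : M * l / c ≤ 1 := (div_le_one hc).2 hh
      have h0 : 0 < M * l / c := by positivity
      have h2 : M * l / c ≤ (M * l / c) ^ s := by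
        calc M * l / c = (M * l / c) ^ (1 : ℝ) := (Real.rpow_one _).symm
          _ ≤ _ := Real.rpow_le_rpow_of_exponent_ge h0 h1 hs1
      have e2 : M / c * ((1 * l) * (1 * l)) = l * (M * l / c) := by ring
      rw [e2]
      nlinarith [mul_le_mul_of_nonneg_left h2 hl, mul_nonneg hl h0.le]
    · have h1 : 1 ≤ M * l / c := (one_le_div hc).2 (not_le.1 hh).le
      have h2 := Real.one_le_rpow h1 hs0
      nlinarith

lemma spectral_test {d : ℕ} (σ : Matrix (Fin d) (Fin d) ℂ) (hσ : σ.PosSemidef) (c M s : ℝ)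
    (hc : 0 < c) (hM : 0 < M) (hs0 : 0 ≤ s) (hs1 : s ≤ 1) :
    ∃ P : Matrix (Fin d) (Fin d) ℂ, Pᴴ = P ∧ P * P = P ∧ 0 ≤ (P * σ * P * σ).trace.re ∧
      0 ≤ (matPow σ (1 + s)).trace.re ∧
      2 * (σ.trace.re - (P * σ).trace.re) + M / c * (P * σ * P * σ).trace.re ≤
        2 * (M ^ s / c ^ s) * (matPow σ (1 + s)).trace.re := by
  have hh := hσ.1
  set V : Matrix (Fin d) (Fin d) ℂ := (hh.eigenvectorUnitary : Matrix (Fin d) (Fin d) ℂ) with hV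
  set lam := hh.eigenvalues with hlam
  have hlam0 : ∀ i, 0 ≤ lam i := hσ.eigenvalues_nonneg
  have hVV : star V * V = 1 := by
    rw [hV]; exact Unitary.coe_star_mul_self _
  have hs : σ = V * diagonal (fun i => (lam i : ℂ)) * star V := herm_spec hh
  let χ : Fin d → ℝ := fun i => if M * lam i ≤ c then 1 else 0
  have ht : σ.trace = ((∑ i, lam i : ℝ) : ℂ) := by
    conv_lhs => rw [hs, sandwich_trace hVV]
    push_cast; rfl
  have hPσ : (V * diagonal (fun i => (χ i : ℂ)) * star V) * σ =
      V * diagonal (fun i => ((χ i : ℂ) * lam i)) * star V := by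
    conv_lhs => rw [hs, sandwich_mul hVV]
  have ht1 : ((V * diagonal (fun i => (χ i : ℂ)) * star V) * σ).trace = ((∑ i, χ i * lam i : ℝ) : ℂ) := by
    rw [hPσ, sandwich_trace hVV]; push_cast; rfl
  have ht2 : ((V * diagonal (fun i => (χ i : ℂ)) * star V) * σ *
      (V * diagonal (fun i => (χ i : ℂ)) * star V) * σ).trace =
      ((∑ i, (χ i * lam i) * (χ i * lam i) : ℝ) : ℂ) := by
    rw [Matrix.mul_assoc _ _ σ, hPσ, sandwich_mul hVV, sandwich_trace hVV]; push_cast; rfl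
  have ht3 : (matPow σ (1 + s)).trace = ((∑ i, (if lam i = 0 then 0 else lam i ^ (1 + s)) : ℝ) : ℂ) := by
    rw [matPow, matFun, dif_pos hh, sandwich_trace hVV, Complex.ofReal_sum]
  refine ⟨V * diagonal (fun i => (χ i : ℂ)) * star V, sandwich_conj V χ, ?_, ?_, ?_, ?_⟩
  · rw [sandwich_mul hVV]
    congr 3
    ext i
    simp only [χ]; split_ifs <;> simp
  · rw [ht2, Complex.ofReal_re]; exact Finset.sum_nonneg fun i _ => mul_self_nonneg _
  · rw [ht3, Complex.ofReal_re]
    refine Finset.sum_nonneg fun i _ => ?_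
    split_ifs
    · exact le_rfl
    · exact Real.rpow_nonneg (hlam0 i) _
  · rw [ht, ht1, ht2, ht3]
    simp only [Complex.ofReal_re]
    rw [← Finset.sum_sub_distrib, Finset.mul_sum, Finset.mul_sum, Finset.mul_sum, ← Finset.sum_add_distrib]
    exact Finset.sum_le_sum fun i _ => scalar_ineq _ _ _ _ (hlam0 i) hc hM hs0 hs1

lemma random_coding {G : Type*} [Group G] [Fintype G] {d M : ℕ} (hM : 1 ≤ M)
    (U : G → Matrix (Fin d) (Fin d) ℂ) (hU : ∀ g, (U g)ᴴ * U g = 1)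
    (u : Fin d → ℂ) (hu : star u ⬝ᵥ u = 1) (P τ : Matrix (Fin d) (Fin d) ℂ) (hP : Pᴴ = P)
    (hPP : P * P = P)
    (hτ : twirl U (vecMulVec u (star u)) = τ) (hpos : 0 ≤ (P * τ * P * τ).trace.re) :
    ∃ Γ : (Fin M → G) → Fin M → Matrix (Fin d) (Fin d) ℂ,
      (∀ g m, (Γ g m).PosSemidef) ∧ (∀ g, ∑ m, Γ g m = 1) ∧
      ((Fintype.card G : ℝ) ^ M)⁻¹ * ∑ g : Fin M → G, (M : ℝ)⁻¹ * ∑ m,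
        (1 - (star (U (g m) *ᵥ u) ⬝ᵥ (Γ g m *ᵥ (U (g m) *ᵥ u))).re) ≤
      2 * (1 - (P * τ).trace.re) + M * (P * τ * P * τ).trace.re := by
  have hdec := fun g : Fin M → G => decoder hM P hP hPP (fun m => U (g m) *ᵥ u)
  choose Γ h1 h2 h3 using hdec
  refine ⟨Γ, h1, h2, ?_⟩
  have h0 : (Fintype.card G : ℝ) ≠ 0 := by exact_mod_cast Fintype.card_ne_zero
  have hM0 : (0 : ℝ) < M := by exact_mod_cast hM
  have hnorm : ∀ h, star (U h *ᵥ u) ⬝ᵥ (U h *ᵥ u) = 1 := by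
    intro h
    rw [Matrix.star_mulVec, Matrix.dotProduct_mulVec, Matrix.vecMul_vecMul, hU, Matrix.vecMul_one, hu]
  have hle : ∀ h, (star (U h *ᵥ u) ⬝ᵥ (P *ᵥ (U h *ᵥ u))).re ≤ 1 := by
    intro h
    have hps : (1 - P).PosSemidef := by
      have := posSemidef_conjTranspose_mul_self (1 - P)
      have e : (1 - P)ᴴ * (1 - P) = 1 - P := by
        rw [conjTranspose_sub, conjTranspose_one, hP, Matrix.mul_sub, Matrix.sub_mul, Matrix.sub_mul, hPP]; simp
      rwa [e] at this
    have := (Complex.nonneg_iff.1 (hps.dotProduct_mulVec_nonneg (U h *ᵥ u))).1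
    rw [Matrix.sub_mulVec, Matrix.one_mulVec, dotProduct_sub, hnorm] at this
    rw [Complex.sub_re, Complex.one_re] at this
    linarith
  set f1 : G → ℝ := fun h => 1 - (star (U h *ᵥ u) ⬝ᵥ (P *ᵥ (U h *ᵥ u))).re with hf1
  set f2 : G → G → ℝ := fun h k => Complex.normSq (star (U h *ᵥ u) ⬝ᵥ (P *ᵥ (U k *ᵥ u))) with hf2
  have hτ' : τ = (Fintype.card G : ℂ)⁻¹ • ∑ g, vecMulVec (U g *ᵥ u) (star (U g *ᵥ u)) := by
    rw [← hτ, twirl]; simp only [vmv_conj]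
  have a1 : (Fintype.card G : ℝ)⁻¹ * ∑ h, f1 h = 1 - (P * τ).trace.re := by
    have : (P * τ).trace = ((Fintype.card G : ℝ)⁻¹ : ℝ) * ∑ h, star (U h *ᵥ u) ⬝ᵥ (P *ᵥ (U h *ᵥ u)) := by
      rw [hτ', Matrix.mul_smul, Matrix.trace_smul, Matrix.mul_sum, Matrix.trace_sum]
      simp only [tr_vmv]; simp
    rw [this, Complex.re_ofReal_mul, Complex.re_sum, hf1, Finset.sum_sub_distrib]
    simp
    field_simp
  have a2 : (Fintype.card G : ℝ)⁻¹ * ((Fintype.card G : ℝ)⁻¹ * ∑ h, ∑ k, f2 h k) = (P * τ * P * τ).trace.re := by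
    have : (P * τ * P * τ).trace = (((Fintype.card G : ℝ)⁻¹ * ((Fintype.card G : ℝ)⁻¹ * ∑ h, ∑ k, f2 h k) : ℝ) : ℂ) := by
      push_cast
      simp only [hf2, normSq_tr P hP]
      conv_lhs => rw [hτ']
      simp only [Matrix.mul_smul, Matrix.smul_mul, Matrix.trace_smul, Matrix.mul_sum, Matrix.sum_mul, Matrix.trace_sum]
      simp only [smul_eq_mul]
      rw [← Finset.mul_sum, Finset.sum_comm]
    rw [this, Complex.ofReal_re]
  have hb : ∀ g : Fin M → G, ∀ m, (1 - (star (U (g m) *ᵥ u) ⬝ᵥ (Γ g m *ᵥ (U (g m) *ᵥ u))).re) ≤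
      2 * f1 (g m) + ∑ m' ∈ Finset.univ.erase m, f2 (g m) (g m') := fun g m => h3 g m (hle _)
  calc _ ≤ ((Fintype.card G : ℝ) ^ M)⁻¹ * ∑ g : Fin M → G, (M : ℝ)⁻¹ * ∑ m,
        (2 * f1 (g m) + ∑ m' ∈ Finset.univ.erase m, f2 (g m) (g m')) := by
        gcongr with g _ m _
        exact hb g m
    _ = (M : ℝ)⁻¹ * ∑ m, (2 * (((Fintype.card G : ℝ) ^ M)⁻¹ * ∑ g : Fin M → G, f1 (g m)) +
          ∑ m' ∈ Finset.univ.erase m, ((Fintype.card G : ℝ) ^ M)⁻¹ * ∑ g : Fin M → G, f2 (g m) (g m')) := by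
        rw [← Finset.mul_sum, Finset.sum_comm, mul_left_comm, Finset.mul_sum _ _ (((Fintype.card G : ℝ) ^ M)⁻¹)]
        congr 1
        refine Finset.sum_congr rfl fun m _ => ?_
        rw [Finset.sum_add_distrib, mul_add, ← Finset.mul_sum, Finset.sum_comm, Finset.mul_sum _ _ (((Fintype.card G : ℝ) ^ M)⁻¹)]
        ring
    _ = (M : ℝ)⁻¹ * ∑ m : Fin M, (2 * (1 - (P * τ).trace.re) +
          ∑ m' ∈ Finset.univ.erase m, (P * τ * P * τ).trace.re) := by
        congr 1
        refine Finset.sum_congr rfl fun m _ => ?_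
        rw [avg_one m f1, a1]
        congr 1
        refine Finset.sum_congr rfl fun m' hm' => ?_
        rw [avg_two m m' (Finset.ne_of_mem_erase hm'), a2]
    _ ≤ (M : ℝ)⁻¹ * ∑ m : Fin M, (2 * (1 - (P * τ).trace.re) + M * (P * τ * P * τ).trace.re) := by
        gcongr with m _
        rw [Finset.sum_const, nsmul_eq_mul]
        gcongr
        simp
    _ = _ := by
        simp
        field_simp

lemma twirl_sum' {G ι : Type*} [Fintype G] [Fintype ι] {κ : Type*} (S : Finset κ)
    (U : G → Matrix ι ι ℂ) (X : κ → Matrix ι ι ℂ) :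
    twirl U (∑ k ∈ S, X k) = ∑ k ∈ S, twirl U (X k) := by
  simp only [twirl, Matrix.mul_sum, Matrix.sum_mul]
  rw [Finset.sum_comm, Finset.smul_sum]

lemma twirl_smul' {G ι : Type*} [Fintype G] [Fintype ι] 
    (U : G → Matrix ι ι ℂ) (a : ℂ) (X : Matrix ι ι ℂ) :
    twirl U (a • X) = a • twirl U X := by
  simp only [twirl, Matrix.mul_smul, Matrix.smul_mul]
  rw [← Finset.smul_sum, smul_comm]

lemma twirl_trace {G ι : Type*} [Group G] [Fintype G] [Fintype ι] [DecidableEq ι]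
    (U : G → Matrix ι ι ℂ) (hU : ∀ g, (U g)ᴴ * U g = 1) (X : Matrix ι ι ℂ) :
    (twirl U X).trace = X.trace := by
  have h0 : (Fintype.card G : ℂ) ≠ 0 := by exact_mod_cast Fintype.card_ne_zero
  have : ∀ g, (U g * X * (U g)ᴴ).trace = X.trace := by
    intro g
    rw [Matrix.trace_mul_comm, ← Matrix.mul_assoc, hU, Matrix.one_mul]
  rw [twirl, Matrix.trace_smul, Matrix.trace_sum]
  simp [this, h0]

lemma twirl_psd_s18 {G ι : Type*} [Group G] [Fintype G] [Fintype ι] [DecidableEq ι]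
    (U : G → Matrix ι ι ℂ) (X : Matrix ι ι ℂ) (hX : X.PosSemidef) :
    (twirl U X).PosSemidef := by
  refine Matrix.PosSemidef.smul ?_ ?_
  · exact Matrix.posSemidef_sum _ fun g _ => hX.mul_mul_conjTranspose_same (U g)
  · rw [← Complex.ofReal_natCast, ← Complex.ofReal_inv]
    exact Complex.zero_le_real.2 (by positivity)

lemma twirl_comm {G ι : Type*} [Fintype G] [Fintype ι] 
    (U : G → Matrix ι ι ℂ) (Q : Matrix ι ι ℂ) (hQ : Qᴴ = Q) (hc : ∀ g, Q * U g = U g * Q)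
    (X : Matrix ι ι ℂ) : twirl U (Q * X * Q) = Q * twirl U X * Q := by
  have hc' : ∀ g, Q * (U g)ᴴ = (U g)ᴴ * Q := by
    intro g
    have := congrArg conjTranspose (hc g)
    rw [conjTranspose_mul, conjTranspose_mul, hQ] at this
    exact this.symm
  simp only [twirl, Matrix.mul_smul, Matrix.smul_mul, Matrix.mul_sum, Matrix.sum_mul]
  congr 1
  refine Finset.sum_congr rfl fun g _ => ?_
  calc U g * (Q * X * Q) * (U g)ᴴ = (U g * Q) * X * (Q * (U g)ᴴ) := by simp only [Matrix.mul_assoc]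
    _ = _ := by rw [← hc, hc']; simp only [Matrix.mul_assoc]

/-- Parseval for the Fourier measurement. -/
lemma parseval {d L : ℕ} (F : Fin L → Fin L → ℂ)
    (hF : ∀ l l', ∑ x, star (F x l) * F x l' = if l = l' then 1 else 0)
    (c0 : ℂ) (hc0 : star c0 * c0 = (L : ℂ)⁻¹) (a : Fin L → Fin d → ℂ) :
    ∑ x, star (∑ l, (star (F x l) * c0) • a l) ⬝ᵥ (∑ l, (star (F x l) * c0) • a l) =
      (L : ℂ)⁻¹ * ∑ l, star (a l) ⬝ᵥ a l := by
  have h1 : ∀ x, star (∑ l, (star (F x l) * c0) • a l) ⬝ᵥ (∑ l, (star (F x l) * c0) • a l) =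
      ∑ l, ∑ l', (star (F x l') * F x l) * ((L : ℂ)⁻¹ * (star (a l) ⬝ᵥ a l')) := by
    intro x
    rw [star_sum, sum_dotProduct]
    refine Finset.sum_congr rfl fun l _ => ?_
    rw [dotProduct_sum]
    refine Finset.sum_congr rfl fun l' _ => ?_
    rw [star_smul, smul_dotProduct, dotProduct_smul, ← hc0]
    simp only [smul_eq_mul, star_mul, star_star]
    ring
  simp only [h1]
  rw [Finset.sum_comm, Finset.mul_sum]
  refine Finset.sum_congr rfl fun l _ => ?_
  rw [Finset.sum_comm]
  simp only [← Finset.sum_mul, hF]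
  simp

lemma trace_term {d L : ℕ} (Γ A : Matrix (Fin d) (Fin d) ℂ) (f : Fin L → ℂ) (w : Fin d × Fin L → ℂ) :
    ((Γ ⊗ₖ vecMulVec f (star f)) * ((A ⊗ₖ (1 : Matrix (Fin L) (Fin L) ℂ)) *
                      Matrix.vecMulVec w (star w) *
                      (A ⊗ₖ (1 : Matrix (Fin L) (Fin L) ℂ))ᴴ)).trace =
      star (A *ᵥ (fun j => ∑ l, star (f l) * w (j, l))) ⬝ᵥ
        (Γ *ᵥ (A *ᵥ (fun j => ∑ l, star (f l) * w (j, l)))) := by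
  rw [Matrix.mul_vecMulVec, Matrix.vecMulVec_mul, ← Matrix.star_mulVec, Matrix.mul_vecMulVec,
    Matrix.trace_vecMulVec, dotProduct_comm]
  set y := (A ⊗ₖ (1 : Matrix (Fin L) (Fin L) ℂ)) *ᵥ w with hy
  have hz : A *ᵥ (fun j => ∑ l, star (f l) * w (j, l)) = fun i => ∑ l, star (f l) * y (i, l) := by
    ext i
    simp only [hy, mulVec, dotProduct, Fintype.sum_prod_type, kroneckerMap_apply, Matrix.one_apply,
      Finset.mul_sum]
    rw [Finset.sum_comm]
    refine Finset.sum_congr rfl fun l _ => Finset.sum_congr rfl fun j _ => ?_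
    rw [Finset.sum_eq_single l]
    · simp; ring
    · intro b _ hb; simp [hb.symm]
    · simp
  rw [hz]
  simp only [mulVec, dotProduct, Fintype.sum_prod_type, kroneckerMap_apply, vecMulVec_apply, Pi.star_apply,
    star_sum, star_mul, star_star, Finset.sum_mul, Finset.mul_sum]
  refine Finset.sum_congr rfl fun i _ => ?_
  rw [Finset.sum_comm]
  refine Finset.sum_congr rfl fun j _ => ?_
  rw [Finset.sum_comm]
  refine Finset.sum_congr rfl fun l' _ => Finset.sum_congr rfl fun l _ => ?_
  ring

/-- Lemma 3 (the one-shot achievability lemma): for each codeword tuple there is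
a one-way LOCC decoder such that the expected decoding error over uniformly
random codewords is bounded by `8 M^s/(1−δ)^s · tr[σ̄^{1+s}] + 2δ`. -/
theorem one_shot_achievability
    {G : Type*} [Group G] [Fintype G] {d : ℕ}
    (U : G → Matrix (Fin d) (Fin d) ℂ)
    (hU : ∀ g, U g ∈ Matrix.unitaryGroup (Fin d) ℂ)
    (hU1 : U 1 = 1) (hUmul : ∀ g g', U (g * g') = U g * U g')
    (L : ℕ) (hL : 1 ≤ L)
    (Q : Fin L → Matrix (Fin d) (Fin d) ℂ)
    (hQherm : ∀ l, (Q l).IsHermitian)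
    (hQidem : ∀ l, Q l * Q l = Q l)
    (hQorth : ∀ l l', l ≠ l' → Q l * Q l' = 0)
    (hQcomm : ∀ l g, Q l * U g = U g * Q l)
    (hQmf : ∀ l l', l ≠ l' → ∀ X : Matrix (Fin d) (Fin d) ℂ,
      twirl U (Q l * X * Q l') = 0)
    (ψ : Fin L → Fin d → ℂ) (hψ : ∀ l, ∑ i, Complex.normSq (ψ l i) = 1)
    (w : Fin d × Fin L → ℂ)
    (hw : ∀ i l, w (i, l) = ((Real.sqrt L : ℝ) : ℂ)⁻¹ * ψ l i)
    (δ : ℝ)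
    (hδdef : δ = 1 - (L : ℝ)⁻¹ *
      ∑ l, (∑ i, (starRingEnd ℂ) (ψ l i) * (Q l).mulVec (ψ l) i).re)
    (σbar : Matrix (Fin d) (Fin d) ℂ)
    (hσbar : σbar = (L : ℂ)⁻¹ •
      ∑ l : Fin L, Q l * twirl U (Matrix.vecMulVec (ψ l) (star (ψ l))) * Q l)
    (hδlt : δ < 1)
    (M : ℕ) (hM : 1 ≤ M) (s : ℝ) (hs0 : 0 ≤ s) (hs1 : s ≤ 1) :
    ∃ (n : (Fin M → G) → ℕ)
      (B : ∀ g : Fin M → G, Fin (n g) → Matrix (Fin L) (Fin L) ℂ)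
      (Γ : ∀ g : Fin M → G, Fin (n g) → Fin M → Matrix (Fin d) (Fin d) ℂ),
      (∀ g x, (B g x).PosSemidef) ∧ (∀ g, ∑ x, B g x = 1) ∧
      (∀ g x m, (Γ g x m).PosSemidef) ∧ (∀ g x, ∑ m, Γ g x m = 1) ∧
      ((Fintype.card G : ℝ) ^ M)⁻¹ *
          ∑ g : Fin M → G,
            (1 - (M : ℝ)⁻¹ *
              ∑ m, ∑ x,
                (((Γ g x m ⊗ₖ B g x) *
                    ((U (g m) ⊗ₖ (1 : Matrix (Fin L) (Fin L) ℂ)) *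
                      Matrix.vecMulVec w (star w) *
                      (U (g m) ⊗ₖ (1 : Matrix (Fin L) (Fin L) ℂ))ᴴ)).trace).re)
        ≤ 8 * (M : ℝ) ^ s / (1 - δ) ^ s * ((matPow σbar (1 + s)).trace).re
            + 2 * δ := by
  have hUU : ∀ g, (U g)ᴴ * U g = 1 := fun g => (Matrix.mem_unitaryGroup_iff').1 (hU g)
  have hLR : (0 : ℝ) < L := by exact_mod_cast hL
  have hMR : (0 : ℝ) < M := by exact_mod_cast hM
  have hLC : (L : ℂ) ≠ 0 := by exact_mod_cast hLR.ne'
  have hcard : (Fintype.card G : ℝ) ≠ 0 := by exact_mod_cast Fintype.card_ne_zero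
  set c : ℝ := 1 - δ with hc
  have hc0 : 0 < c := by linarith
  obtain ⟨F, hF1, hF2⟩ := fourier_basis L hL
  set c0 : ℂ := ((Real.sqrt L : ℝ) : ℂ)⁻¹ with hc0def
  have hcc : star c0 * c0 = (L : ℂ)⁻¹ := by
    rw [hc0def, RCLike.star_def, map_inv₀, Complex.conj_ofReal, ← mul_inv, ← Complex.ofReal_mul,
      Real.mul_self_sqrt (by positivity)]
    simp
  set v : Fin L → Fin d → ℂ := fun x => ∑ l, (star (F x l) * c0) • ψ l with hv
  set p : Fin L → Fin d → ℂ := fun x => ∑ l, (star (F x l) * c0) • (Q l *ᵥ ψ l) with hp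
  set r : Fin L → Fin d → ℂ := fun x => ∑ l, (star (F x l) * c0) • (ψ l - Q l *ᵥ ψ l) with hr
  have hvpr : ∀ x, v x = p x + r x := by
    intro x
    simp only [hv, hp, hr, ← Finset.sum_add_distrib, ← smul_add]
    simp
  have hψ1 : ∀ l, star (ψ l) ⬝ᵥ ψ l = 1 := by
    intro l
    have := congrArg (fun t : ℝ => (t : ℂ)) (hψ l)
    simp only [Complex.ofReal_sum, Complex.normSq_eq_conj_mul_self] at this
    simpa [dotProduct] using this
  have hQQ : ∀ l, star (Q l *ᵥ ψ l) ⬝ᵥ (Q l *ᵥ ψ l) = star (ψ l) ⬝ᵥ (Q l *ᵥ ψ l) := by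
    intro l
    rw [Matrix.star_mulVec, (hQherm l).eq, ← Matrix.dotProduct_mulVec, Matrix.mulVec_mulVec, hQidem]
  have hQs : ∀ l, star (Q l *ᵥ ψ l) ⬝ᵥ (ψ l) = star (ψ l) ⬝ᵥ (Q l *ᵥ ψ l) := by
    intro l
    rw [Matrix.star_mulVec, (hQherm l).eq, ← Matrix.dotProduct_mulVec]
  have hcq : c = (L : ℝ)⁻¹ * ∑ l, (star (ψ l) ⬝ᵥ (Q l *ᵥ ψ l)).re := by
    rw [hc, hδdef, sub_sub_cancel]; rfl
  have hvsum : ∑ x, (star (v x) ⬝ᵥ v x).re = 1 := by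
    have := parseval F hF2 c0 hcc ψ
    simp only [hψ1] at this
    rw [← Complex.re_sum, this]
    simp [hLC]
  have hrsum : ∑ x, (star (r x) ⬝ᵥ r x).re = δ := by
    have := parseval F hF2 c0 hcc (fun l => ψ l - Q l *ᵥ ψ l)
    have e : ∀ l, star (ψ l - Q l *ᵥ ψ l) ⬝ᵥ (ψ l - Q l *ᵥ ψ l) = 1 - star (ψ l) ⬝ᵥ (Q l *ᵥ ψ l) := by
      intro l
      rw [star_sub, sub_dotProduct, dotProduct_sub, dotProduct_sub, hQQ, hQs, hψ1]; ring
    simp only [e] at this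
    rw [← Complex.re_sum, this, ← Complex.ofReal_natCast, ← Complex.ofReal_inv, Complex.re_ofReal_mul,
      Complex.re_sum]
    simp only [Complex.sub_re, Complex.one_re, Finset.sum_sub_distrib]
    rw [mul_sub, ← hcq, hc]
    simp
    field_simp
    ring
  -- the twirled projected state
  have htw : ∀ x, twirl U (vecMulVec (p x) (star (p x))) = (L : ℂ)⁻¹ • σbar := by
    intro x
    have e1 : vecMulVec (p x) (star (p x)) = ∑ l, ∑ l', ((star (F x l) * F x l') * (L : ℂ)⁻¹) •
        (Q l * vecMulVec (ψ l) (star (ψ l')) * Q l') := by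
      ext i j
      simp only [vecMulVec_apply, hp, Matrix.sum_apply, Finset.sum_apply, Pi.star_apply, star_sum,
        Finset.sum_mul, Finset.mul_sum, Matrix.smul_apply, Pi.smul_apply]
      rw [Finset.sum_comm]
      refine Finset.sum_congr rfl fun l _ => Finset.sum_congr rfl fun l' _ => ?_
      rw [Matrix.mul_vecMulVec, Matrix.vecMulVec_mul]
      have : star (ψ l') ᵥ* Q l' = star (Q l' *ᵥ ψ l') := by
        rw [Matrix.star_mulVec, (hQherm l').eq]
      rw [this, vecMulVec_apply, ← hcc]
      simp only [smul_eq_mul, star_mul, star_star, Pi.star_apply]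
      ring
    rw [e1, twirl_sum', hσbar, smul_smul, Finset.smul_sum]
    refine Finset.sum_congr rfl fun l _ => ?_
    rw [twirl_sum', Finset.sum_eq_single l]
    · rw [twirl_smul', hF1, twirl_comm U (Q l) (hQherm l).eq (hQcomm l)]
    · intro b _ hb
      rw [twirl_smul', hQmf l b hb.symm, smul_zero]
    · simp
  have htrσ : σbar.trace = (c : ℂ) := by
    have e : ∀ l, (Q l * twirl U (vecMulVec (ψ l) (star (ψ l))) * Q l).trace =
        (((star (ψ l) ⬝ᵥ (Q l *ᵥ ψ l)).re : ℝ) : ℂ) := by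
      intro l
      rw [← twirl_comm U (Q l) (hQherm l).eq (hQcomm l), twirl_trace U hUU, Matrix.mul_assoc,
        Matrix.trace_mul_comm, Matrix.mul_assoc, hQidem, Matrix.trace_mul_comm, tr_vmv]
      refine (Complex.conj_eq_iff_re.1 ?_).symm
      change star _ = _
      conv_lhs => rw [Matrix.star_dotProduct, star_star, hQs]
    rw [hσbar, Matrix.trace_smul, Matrix.trace_sum, hcq]
    simp only [e]
    push_cast
    rfl
  have hpn : ∀ x, star (p x) ⬝ᵥ p x = ((c / L : ℝ) : ℂ) := by
    intro x
    have : (twirl U (vecMulVec (p x) (star (p x)))).trace = star (p x) ⬝ᵥ p x := by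
      rw [twirl_trace U hUU, Matrix.trace_vecMulVec, dotProduct_comm]
    rw [← this, htw, Matrix.trace_smul, htrσ]
    push_cast
    rw [smul_eq_mul]; ring
  have hσpsd : σbar.PosSemidef := by
    have h1 := htw ⟨0, hL⟩
    have h2 : σbar = (L : ℂ) • twirl U (vecMulVec (p ⟨0, hL⟩) (star (p ⟨0, hL⟩))) := by
      rw [h1, smul_smul, mul_inv_cancel₀ hLC, one_smul]
    rw [h2]
    refine (twirl_psd_s18 U _ (posSemidef_vecMulVec_self_star _)).smul ?_
    rw [← Complex.ofReal_natCast]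
    exact Complex.zero_le_real.2 hLR.le
  obtain ⟨P, hP, hPP, hPpos, hpow, hPineq⟩ := spectral_test σbar hσpsd c M s hc0 hMR hs0 hs1
  -- normalised states
  set κ : ℝ := Real.sqrt (c / L) with hκ
  have hκ2 : κ * κ = c / L := Real.mul_self_sqrt (by positivity)
  have hκ0 : 0 < κ := Real.sqrt_pos.2 (by positivity)
  have hκC : (κ : ℂ) ≠ 0 := by exact_mod_cast hκ0.ne'
  have hκ2C : (κ : ℂ) * κ = c / L := by exact_mod_cast hκ2
  have hcC : (c : ℂ) ≠ 0 := by exact_mod_cast hc0.ne'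
  set u : Fin L → Fin d → ℂ := fun x => ((κ : ℂ)⁻¹) • p x with hu
  have hpu : ∀ x, p x = (κ : ℂ) • u x := by
    intro x; simp only [hu]; rw [smul_smul, mul_inv_cancel₀ hκC, one_smul]
  have hκs : star ((κ : ℂ)⁻¹) = (κ : ℂ)⁻¹ := by
    rw [← Complex.ofReal_inv]; exact Complex.conj_ofReal _
  have hun : ∀ x, star (u x) ⬝ᵥ u x = 1 := by
    intro x
    simp only [hu]
    rw [star_smul, smul_dotProduct, dotProduct_smul, hpn, hκs, ← hκ2]
    simp only [smul_eq_mul]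
    push_cast
    field_simp
  have hutw : ∀ x, twirl U (vecMulVec (u x) (star (u x))) = (c : ℂ)⁻¹ • σbar := by
    intro x
    have : vecMulVec (u x) (star (u x)) = ((κ : ℂ)⁻¹ * (κ : ℂ)⁻¹) • vecMulVec (p x) (star (p x)) := by
      simp only [hu]
      rw [star_smul, Matrix.smul_vecMulVec, Matrix.vecMulVec_smul, smul_smul, hκs]
    rw [this, twirl_smul', htw, smul_smul, ← mul_inv, hκ2C]
    congr 1
    field_simp
  set τ := (c : ℂ)⁻¹ • σbar with hτ
  have ht1 : (P * τ).trace.re = c⁻¹ * (P * σbar).trace.re := by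
    rw [hτ, Matrix.mul_smul, Matrix.trace_smul, smul_eq_mul, ← Complex.ofReal_inv, Complex.re_ofReal_mul]
  have ht2 : (P * τ * P * τ).trace.re = c⁻¹ * (c⁻¹ * (P * σbar * P * σbar).trace.re) := by
    rw [hτ]
    simp only [Matrix.mul_smul, Matrix.smul_mul, Matrix.trace_smul, smul_eq_mul]
    rw [← Complex.ofReal_inv, Complex.re_ofReal_mul, Complex.re_ofReal_mul]
  have hrc := fun x => random_coding (M := M) hM U hUU (u x) (hun x) P τ hP hPP (hutw x)
    (by rw [ht2]; positivity)
  choose Γ hΓ1 hΓ2 hΓ3 using hrc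
  have hbound : 2 * (1 - (P * τ).trace.re) + M * (P * τ * P * τ).trace.re ≤
      c⁻¹ * (2 * ((M : ℝ) ^ s / c ^ s) * (matPow σbar (1 + s)).trace.re) := by
    have h1 : 2 * (1 - (P * τ).trace.re) + M * (P * τ * P * τ).trace.re =
      c⁻¹ * (2 * (σbar.trace.re - (P * σbar).trace.re) + M / c * (P * σbar * P * σbar).trace.re) := by
      rw [ht1, ht2, htrσ, Complex.ofReal_re]
      field_simp
    rw [h1]
    gcongr
  refine ⟨fun _ => L, fun _ x => vecMulVec (F x) (star (F x)), fun g x m => Γ x g m, ?_, ?_, ?_, ?_, ?_⟩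
  · exact fun _ x => posSemidef_vecMulVec_self_star _
  · intro g
    ext l l'
    simp only [Matrix.sum_apply, vecMulVec_apply, Pi.star_apply, Matrix.one_apply]
    have := hF2 l' l
    simp only [eq_comm (a := l')] at this
    rw [← this]
    exact Finset.sum_congr rfl fun x _ => mul_comm _ _
  · exact fun g x m => hΓ1 x g m
  · exact fun g x => hΓ2 x g
  · have hvw : ∀ x, (fun j => ∑ l, star (F x l) * w (j, l)) = v x := by
      intro x
      ext j
      simp only [hv, Finset.sum_apply, Pi.smul_apply, smul_eq_mul, hw]
      exact Finset.sum_congr rfl fun l _ => by ring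
    have hone : ∀ x (g : Fin M → G) m, (star (U (g m) *ᵥ v x) ⬝ᵥ (Γ x g m *ᵥ (U (g m) *ᵥ v x))).re ≥
        (star (v x) ⬝ᵥ v x).re - 2 * (c / L) * (1 - (star (U (g m) *ᵥ u x) ⬝ᵥ (Γ x g m *ᵥ (U (g m) *ᵥ u x))).re)
          - 2 * (star (r x) ⬝ᵥ r x).re := by
      intro x g m
      have hnm : ∀ y : Fin d → ℂ, star (U (g m) *ᵥ y) ⬝ᵥ (U (g m) *ᵥ y) = star y ⬝ᵥ y := by
        intro y
        rw [Matrix.star_mulVec, Matrix.dotProduct_mulVec, Matrix.vecMul_vecMul, hUU, Matrix.vecMul_one]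
      have hE : (1 - Γ x g m).PosSemidef := by
        rw [← hΓ2 x g, ← Finset.add_sum_erase _ _ (Finset.mem_univ m), add_sub_cancel_left]
        exact Matrix.posSemidef_sum _ fun m' _ => hΓ1 x g m'
      have hE1 : (1 - (1 - Γ x g m)).PosSemidef := by rw [sub_sub_cancel]; exact hΓ1 x g m
      have := noise_bound _ hE hE1 (U (g m) *ᵥ p x) (U (g m) *ᵥ r x)
      rw [← Matrix.mulVec_add, ← hvpr, hnm] at this
      have e1 : ∀ y : Fin d → ℂ, (star (U (g m) *ᵥ y) ⬝ᵥ ((1 - Γ x g m) *ᵥ (U (g m) *ᵥ y))).re =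
          (star y ⬝ᵥ y).re - (star (U (g m) *ᵥ y) ⬝ᵥ (Γ x g m *ᵥ (U (g m) *ᵥ y))).re := by
        intro y
        rw [Matrix.sub_mulVec, Matrix.one_mulVec, dotProduct_sub, hnm, Complex.sub_re]
      have e2 : (star (U (g m) *ᵥ p x) ⬝ᵥ ((1 - Γ x g m) *ᵥ (U (g m) *ᵥ p x))).re =
          (c / L) * (star (U (g m) *ᵥ u x) ⬝ᵥ ((1 - Γ x g m) *ᵥ (U (g m) *ᵥ u x))).re := by
        have gen : ∀ y : Fin d → ℂ, (star (U (g m) *ᵥ ((κ : ℂ) • y)) ⬝ᵥ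
            ((1 - Γ x g m) *ᵥ (U (g m) *ᵥ ((κ : ℂ) • y)))).re =
            (c / L) * (star (U (g m) *ᵥ y) ⬝ᵥ ((1 - Γ x g m) *ᵥ (U (g m) *ᵥ y))).re := by
          intro y
          have : star (κ : ℂ) = κ := Complex.conj_ofReal _
          rw [Matrix.mulVec_smul, Matrix.mulVec_smul, star_smul, smul_dotProduct, dotProduct_smul, this,
            smul_eq_mul, smul_eq_mul, Complex.re_ofReal_mul, Complex.re_ofReal_mul, ← mul_assoc, hκ2]
        rw [hpu x]
        exact gen (u x)
      rw [e2, e1, e1, hun, Complex.one_re] at this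
      linarith
    simp only [trace_term, hvw]
    have hg : ∀ g : Fin M → G, (1 - (M : ℝ)⁻¹ * ∑ m, ∑ x,
        (star (U (g m) *ᵥ v x) ⬝ᵥ (Γ x g m *ᵥ (U (g m) *ᵥ v x))).re) ≤
        2 * δ + 2 * (c / L) * ∑ x, ((M : ℝ)⁻¹ * ∑ m,
          (1 - (star (U (g m) *ᵥ u x) ⬝ᵥ (Γ x g m *ᵥ (U (g m) *ᵥ u x))).re)) := by
      intro g
      have h1 : ∀ m, 1 - 2 * (c / L) * ∑ x, (1 - (star (U (g m) *ᵥ u x) ⬝ᵥ (Γ x g m *ᵥ (U (g m) *ᵥ u x))).re)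
          - 2 * δ ≤ ∑ x, (star (U (g m) *ᵥ v x) ⬝ᵥ (Γ x g m *ᵥ (U (g m) *ᵥ v x))).re := by
        intro m
        have hs := Finset.sum_le_sum (fun x (_ : x ∈ Finset.univ) => ge_iff_le.1 (hone x g m))
        rw [Finset.sum_sub_distrib, Finset.sum_sub_distrib, hvsum, ← Finset.mul_sum, ← Finset.mul_sum,
          hrsum] at hs
        exact hs
      have h2 := mul_le_mul_of_nonneg_left (Finset.sum_le_sum fun m (_ : m ∈ Finset.univ) => h1 m)
        (inv_nonneg.2 hMR.le)
      have h3 : (M : ℝ)⁻¹ * ∑ m : Fin M, (1 - 2 * (c / L) * ∑ x, (1 - (star (U (g m) *ᵥ u x) ⬝ᵥ (Γ x g m *ᵥ (U (g m) *ᵥ u x))).re)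
          - 2 * δ) = 1 - 2 * δ - 2 * (c / L) * ∑ x, ((M : ℝ)⁻¹ * ∑ m,
          (1 - (star (U (g m) *ᵥ u x) ⬝ᵥ (Γ x g m *ᵥ (U (g m) *ᵥ u x))).re)) := by
        rw [← Finset.mul_sum, Finset.sum_comm]
        rw [Finset.sum_sub_distrib, Finset.sum_sub_distrib, ← Finset.mul_sum]
        simp only [Finset.sum_const, Finset.card_univ, Fintype.card_fin, nsmul_eq_mul]
        field_simp
        ring
      linarith
    calc _ ≤ ((Fintype.card G : ℝ) ^ M)⁻¹ * ∑ g : Fin M → G, (2 * δ + 2 * (c / L) * ∑ x, ((M : ℝ)⁻¹ * ∑ m,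
          (1 - (star (U (g m) *ᵥ u x) ⬝ᵥ (Γ x g m *ᵥ (U (g m) *ᵥ u x))).re))) := by
          gcongr with g _
          exact hg g
      _ = 2 * δ + 2 * (c / L) * ∑ x, (((Fintype.card G : ℝ) ^ M)⁻¹ * ∑ g : Fin M → G, (M : ℝ)⁻¹ * ∑ m,
          (1 - (star (U (g m) *ᵥ u x) ⬝ᵥ (Γ x g m *ᵥ (U (g m) *ᵥ u x))).re)) := by
          rw [Finset.sum_add_distrib, mul_add, ← Finset.mul_sum, ← Finset.mul_sum, Finset.sum_comm]
          simp only [Finset.sum_const, Finset.card_univ, Fintype.card_pi, Finset.prod_const,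
            Fintype.card_fin, nsmul_eq_mul]
          push_cast
          rw [← Finset.mul_sum]
          field_simp
      _ ≤ 2 * δ + 2 * (c / L) * ∑ x : Fin L, c⁻¹ * (2 * ((M : ℝ) ^ s / c ^ s) * (matPow σbar (1 + s)).trace.re) := by
          exact add_le_add le_rfl (mul_le_mul_of_nonneg_left
            (Finset.sum_le_sum fun x _ => (hΓ3 x).trans hbound) (by positivity))
      _ = 4 * (M : ℝ) ^ s / c ^ s * (matPow σbar (1 + s)).trace.re + 2 * δ := by
          simp only [Finset.sum_const, Finset.card_univ, Fintype.card_fin, nsmul_eq_mul]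
          field_simp
          ring
      _ ≤ _ := by
          gcongr
          norm_num
end
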